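/- The module D(Cat)^W of W-invariant logarithmic vector fields of the extended Catalan arrangement is a free module over the invariant ring S^W, and it admits a free basis θ_1,…,θ_N such that the top-degree homogeneous parts θ̄_1,…,θ̄_N (the vector fields formed by the highest-degree homogeneous components of the coefficients of each θ_i) are W-invariant, belong to D_m, and form a free basis of the S-module D_m. -/

import Mathlib

open MvPolynomial

noncomputable section

/-- Action of a matrix `M` on polynomials by linear substitution of the variables. -/
def polyActM {N : ℕ} (M : Matrix (Fin N) (Fin N) ℂ) (p : MvPolynomial (Fin N) ℂ) :
    MvPolynomial (Fin N) ℂ :=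
  MvPolynomial.aeval (fun i => ∑ j, MvPolynomial.C (M i j) * MvPolynomial.X j) p

/-- The linear polynomial with coefficient vector `a`. -/
def linPoly {N : ℕ} (a : Fin N → ℂ) : MvPolynomial (Fin N) ℂ :=
  ∑ i, MvPolynomial.C (a i) * MvPolynomial.X i

/-- The polynomial vector field `L = Σ f_i ∂_i` applied to a polynomial. -/
def applyVF {N : ℕ} (f : Fin N → MvPolynomial (Fin N) ℂ) (p : MvPolynomial (Fin N) ℂ) :
    MvPolynomial (Fin N) ℂ :=
  ∑ i, f i * MvPolynomial.pderiv i p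

/-- Complexification of a real vector. -/
def cplx {N : ℕ} (a : Fin N → ℝ) : Fin N → ℂ := fun i => (a i : ℂ)

/-- The (complexified) matrix of the orthogonal reflection `s_a(x) = x - (a,x) a^∨`. -/
def reflM {N : ℕ} (a : Fin N → ℝ) : Matrix (Fin N) (Fin N) ℂ :=
  1 - Matrix.of (fun i j => (2 / (∑ k, (a k : ℂ) ^ 2)) * (a i : ℂ) * (a j : ℂ))

/-- The degree of a polynomial vector field: the maximum of the total degrees of its
coefficients. -/
def vfDeg {N : ℕ} (f : Fin N → MvPolynomial (Fin N) ℂ) : ℕ :=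
  Finset.univ.sup fun i => (f i).totalDegree

/-- The top-degree homogeneous part of a polynomial vector field. -/
def topVF {N : ℕ} (f : Fin N → MvPolynomial (Fin N) ℂ) :
    Fin N → MvPolynomial (Fin N) ℂ :=
  fun i => MvPolynomial.homogeneousComponent (vfDeg f) (f i)

namespace Catalan

open Matrix

variable {N : ℕ}

/-- Polynomials on `ℂ^N`. -/
abbrev Pol (N : ℕ) := MvPolynomial (Fin N) ℂ

/-- Linear forms, as a linear map in the coefficient vector. -/
def lin : (Fin N → ℂ) →ₗ[ℂ] Pol N where
  toFun := linPoly
  map_add' v w := by simp [linPoly, add_mul, Finset.sum_add_distrib]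
  map_smul' c v := by simp [linPoly, Finset.mul_sum, mul_assoc, MvPolynomial.smul_eq_C_mul]

lemma lin_eq (v : Fin N → ℂ) : lin v = ∑ i, v i • X i := by
  simp_rw [MvPolynomial.smul_eq_C_mul]
  rfl

lemma lin_single (i : Fin N) : lin (Pi.single i 1) = X i := by
  simp [lin_eq, Pi.single_apply]

lemma lin_isHomogeneous (v : Fin N → ℂ) : (lin v).IsHomogeneous 1 := by
  rw [lin_eq]
  exact IsHomogeneous.sum _ _ _ fun i _ => by
    rw [MvPolynomial.smul_eq_C_mul]
    simpa using (isHomogeneous_C _ (v i)).mul (isHomogeneous_X ℂ i)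

lemma pderiv_lin (i : Fin N) (v : Fin N → ℂ) : pderiv i (lin v) = C (v i) := by
  simp [lin_eq, pderiv_X, Pi.single_apply, MvPolynomial.smul_eq_C_mul]

lemma lin_injective : Function.Injective (lin : (Fin N → ℂ) → Pol N) := by
  intro v w h
  funext i
  have := congrArg (pderiv i) h
  simpa [pderiv_lin] using this

lemma lin_ne_zero {v : Fin N → ℂ} (hv : v ≠ 0) : lin v ≠ 0 :=
  fun h => hv (lin_injective (by simpa using h))

lemma totalDegree_lin_sub_C {v : Fin N → ℂ} (hv : v ≠ 0) (c : ℂ) :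
    (lin v - C c).totalDegree = 1 := by
  have h1 := (lin_isHomogeneous v).totalDegree (lin_ne_zero hv)
  rw [sub_eq_add_neg, ← C_neg, totalDegree_add_eq_left_of_totalDegree_lt, h1]
  simp [h1]

lemma prime_lin_sub_C {v : Fin N → ℂ} (hv : v ≠ 0) (c : ℂ) : Prime (lin v - C c) := by
  refine (irreducible_of_totalDegree_eq_one (totalDegree_lin_sub_C hv c) fun x hx => ?_).prime
  rw [isUnit_iff_ne_zero]
  rintro rfl
  have : lin v - C c = 0 := by
    ext i
    simpa using hx i
  have h := totalDegree_lin_sub_C hv c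
  simp [this] at h

lemma prime_lin {v : Fin N → ℂ} (hv : v ≠ 0) : Prime (lin v) := by
  simpa using prime_lin_sub_C hv 0

lemma eval_zero_lin (v : Fin N → ℂ) : constantCoeff (lin v) = 0 := by
  simp [lin_eq, MvPolynomial.smul_eq_C_mul]

lemma lin_sub_C_dvd {v w : Fin N → ℂ} {c d : ℂ} (hv : v ≠ 0) (hw : w ≠ 0)
    (h : lin v - C c ∣ lin w - C d) : ∃ r : ℂ, w = r • v ∧ d = r * c := by
  obtain ⟨q, hq⟩ := h
  have hp0 := (prime_lin_sub_C hv c).ne_zero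
  have hq0 : q ≠ 0 := by
    rintro rfl
    exact (prime_lin_sub_C hw d).ne_zero (by simpa using hq)
  have hdeg := congrArg totalDegree hq
  rw [totalDegree_mul_of_isDomain hp0 hq0, totalDegree_lin_sub_C hw,
    totalDegree_lin_sub_C hv] at hdeg
  obtain ⟨r, rfl⟩ : ∃ r, q = C r := ⟨_, (totalDegree_eq_zero_iff_eq_C (p := q)).mp (by lia)⟩
  refine ⟨r, ?_, ?_⟩
  · funext i
    have := congrArg (pderiv i) hq
    rw [mul_comm, pderiv_C_mul, map_sub, map_sub, pderiv_lin, pderiv_lin, pderiv_C, pderiv_C,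
      sub_zero, sub_zero, ← C_mul] at this
    exact C_injective _ _ this
  · have := congrArg constantCoeff hq
    simp only [map_sub, map_mul, eval_zero_lin, constantCoeff_C] at this
    linear_combination -this

/-- The action of an invertible matrix on polynomials, `(g · p)(x) = p(g⁻¹ x)`. -/
def actHom (g : (Matrix (Fin N) (Fin N) ℂ)ˣ) : Pol N →ₐ[ℂ] Pol N :=
  aeval fun i => lin (g⁻¹.1 i)

lemma actHom_X (g : (Matrix (Fin N) (Fin N) ℂ)ˣ) (i : Fin N) :
    actHom g (X i) = lin (g⁻¹.1 i) := by simp [actHom]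

lemma actHom_lin (g : (Matrix (Fin N) (Fin N) ℂ)ˣ) (v : Fin N → ℂ) :
    actHom g (lin v) = lin (v ᵥ* g⁻¹.1) := by
  rw [lin_eq]
  simp only [map_sum, map_smul, actHom_X]
  simp only [← map_smul, ← map_sum]
  congr 1
  funext j
  simp [Matrix.vecMul, dotProduct]

lemma actHom_mul (g h : (Matrix (Fin N) (Fin N) ℂ)ˣ) :
    actHom (g * h) = (actHom g).comp (actHom h) := by
  refine algHom_ext fun i => ?_
  rw [AlgHom.comp_apply, actHom_X, actHom_X, actHom_lin]
  congr 1

lemma actHom_one : actHom (1 : (Matrix (Fin N) (Fin N) ℂ)ˣ) = AlgHom.id ℂ (Pol N) := by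
  refine algHom_ext fun i => ?_
  rw [actHom_X, inv_one, Units.val_one, AlgHom.id_apply, ← lin_single]
  congr 1
  funext j
  simp [Matrix.one_apply, Pi.single_apply, eq_comm]

/-- The action of invertible matrices on polynomials by algebra automorphisms. -/
def act : (Matrix (Fin N) (Fin N) ℂ)ˣ →* (Pol N ≃ₐ[ℂ] Pol N) where
  toFun g := AlgEquiv.ofAlgHom (actHom g) (actHom g⁻¹)
    (by rw [← actHom_mul, mul_inv_cancel, actHom_one])
    (by rw [← actHom_mul, inv_mul_cancel, actHom_one])
  map_one' := by ext x : 1; exact congrArg (fun f => f x) actHom_one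
  map_mul' g h := by ext x : 1; exact congrArg (fun f => f x) (actHom_mul g h)

lemma act_apply (g : (Matrix (Fin N) (Fin N) ℂ)ˣ) (p : Pol N) : act g p = actHom g p := rfl

lemma act_lin (g : (Matrix (Fin N) (Fin N) ℂ)ˣ) (v : Fin N → ℂ) :
    act g (lin v) = lin (v ᵥ* g⁻¹.1) := actHom_lin g v

lemma act_C (g : (Matrix (Fin N) (Fin N) ℂ)ˣ) (c : ℂ) : act g (C c) = C c :=
  (act g).commutes c

lemma act_isHomogeneous (g : (Matrix (Fin N) (Fin N) ℂ)ˣ) {p : Pol N} {d : ℕ}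
    (hp : p.IsHomogeneous d) : (act g p).IsHomogeneous d := by
  have := hp.aeval (fun i => lin (g⁻¹.1 i)) (n := 1) fun i => lin_isHomogeneous _
  simpa [act_apply, actHom] using this

end Catalan

namespace Catalan

open Matrix

variable {N : ℕ}

/-- Complexified dot product with itself. -/
lemma cplx_dot (a b : Fin N → ℝ) : cplx a ⬝ᵥ cplx b = ((a ⬝ᵥ b : ℝ) : ℂ) := by
  simp [dotProduct, cplx]

lemma cplx_injective : Function.Injective (cplx : (Fin N → ℝ) → Fin N → ℂ) := by
  intro a b h
  funext i
  simpa [cplx] using congrFun h i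

lemma cplx_single (i : Fin N) : cplx (Pi.single i 1) = Pi.single i 1 := by
  funext j
  simp only [cplx, Pi.single_apply]
  split_ifs <;> simp

lemma reflM_eq (a : Fin N → ℝ) :
    reflM a = 1 - (2 / (cplx a ⬝ᵥ cplx a)) • vecMulVec (cplx a) (cplx a) := by
  ext i j
  simp [reflM, vecMulVec_apply, cplx, dotProduct, sq, mul_assoc]

lemma reflM_mulVec (a : Fin N → ℝ) (v : Fin N → ℂ) :
    reflM a *ᵥ v = v - (2 * (cplx a ⬝ᵥ v) / (cplx a ⬝ᵥ cplx a)) • cplx a := by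
  rw [reflM_eq, sub_mulVec, one_mulVec, smul_mulVec, vecMulVec_mulVec]
  ext i
  simp
  ring

lemma reflM_transpose (a : Fin N → ℝ) : (reflM a)ᵀ = reflM a := by
  rw [reflM_eq]
  simp [transpose_vecMulVec]

lemma reflM_mul_self (a : Fin N → ℝ) : reflM a * reflM a = 1 := by
  by_cases h : cplx a ⬝ᵥ cplx a = 0
  · simp [reflM_eq, h]
  · ext1 i j
    have : reflM a *ᵥ (reflM a *ᵥ Pi.single j 1) = Pi.single j 1 := by
      rw [reflM_mulVec, reflM_mulVec, dotProduct_sub, dotProduct_smul]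
      ext k
      simp
      field_simp
      ring
    rw [mulVec_mulVec, mulVec_single_one] at this
    simpa [Matrix.one_apply, Pi.single_apply] using congrFun this i

/-- The reflection in the real vector `a`, as an invertible matrix. -/
def reflU (a : Fin N → ℝ) : (Matrix (Fin N) (Fin N) ℂ)ˣ :=
  ⟨reflM a, reflM a, reflM_mul_self a, reflM_mul_self a⟩

/-- An irreducible reduced crystallographic root system spanning `ℝ^N` with an invariant
multiplicity. -/
structure RootDatum (N : ℕ) where
  R : Finset (Fin N → ℝ)
  zero_notMem : (0 : Fin N → ℝ) ∉ R
  span : Submodule.span ℝ (R : Set (Fin N → ℝ)) = ⊤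
  reduced : ∀ a ∈ R, ∀ c : ℝ, c • a ∈ R → c = 1 ∨ c = -1
  refl_mem : ∀ a ∈ R, ∀ b ∈ R, b - (2 * (a ⬝ᵥ b) / (a ⬝ᵥ a)) • a ∈ R
  crys : ∀ a ∈ R, ∀ b ∈ R, ∃ k : ℤ, 2 * (a ⬝ᵥ b) / (b ⬝ᵥ b) = (k : ℝ)
  irr : ∀ U : Submodule ℝ (Fin N → ℝ),
    (∀ a ∈ R, ∀ v ∈ U, v - (2 * (a ⬝ᵥ v) / (a ⬝ᵥ a)) • a ∈ U) → U = ⊥ ∨ U = ⊤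
  m : (Fin N → ℝ) → ℕ
  m_refl : ∀ a ∈ R, ∀ b ∈ R, m (b - (2 * (a ⬝ᵥ b) / (a ⬝ᵥ a)) • a) = m b

namespace RootDatum

variable (D : RootDatum N)

/-- The roots. -/
abbrev Root := {a : Fin N → ℝ // a ∈ D.R}

variable {D}

/-- The complex vector of a root. -/
def vec (β : D.Root) : Fin N → ℂ := cplx β.1

/-- The multiplicity of a root. -/
def mul (β : D.Root) : ℕ := D.m β.1

/-- The linear form of a root. -/
def ell (β : D.Root) : Pol N := lin (vec β)

lemma vec_injective : Function.Injective (vec : D.Root → _) :=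
  cplx_injective.comp Subtype.val_injective

lemma root_ne_zero (β : D.Root) : β.1 ≠ 0 := fun h => D.zero_notMem (h ▸ β.2)

lemma vec_ne_zero (β : D.Root) : vec β ≠ 0 := fun h =>
  root_ne_zero β (cplx_injective (by simpa [vec, cplx, funext_iff] using h))

lemma root_dot_pos (β : D.Root) : 0 < β.1 ⬝ᵥ β.1 := by
  have := dotProduct_self_eq_zero.not.mpr (root_ne_zero β)
  exact lt_of_le_of_ne (Finset.sum_nonneg fun i _ => mul_self_nonneg _) (Ne.symm this)

lemma vec_dot_ne_zero (β : D.Root) : vec β ⬝ᵥ vec β ≠ 0 := by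
  rw [vec, cplx_dot]
  exact_mod_cast (root_dot_pos β).ne'

lemma prime_ell (β : D.Root) : Prime (ell β) := prime_lin (vec_ne_zero β)

variable (D) in
/-- The Weyl group. -/
def W : Subgroup (Matrix (Fin N) (Fin N) ℂ)ˣ :=
  Subgroup.closure (Set.range fun β : D.Root => reflU β.1)

/-- The reflection in a root. -/
def s (β : D.Root) : D.W := ⟨reflU β.1, Subgroup.subset_closure ⟨β, rfl⟩⟩

lemma W_induction {p : D.W → Prop} (hs : ∀ β, p (s β)) (h1 : p 1)
    (hm : ∀ g h, p g → p h → p (g * h)) (g : D.W) : p g := by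
  obtain ⟨g, hg⟩ := g
  have hinv : ∀ β : D.Root, (reflU β.1)⁻¹ = reflU β.1 := fun β => by
    rw [inv_eq_iff_mul_eq_one]
    exact Units.ext (reflM_mul_self _)
  refine Subgroup.closure_induction'' (p := fun g hg => p ⟨g, hg⟩) ?_ ?_ h1 ?_ hg
  · rintro _ ⟨β, rfl⟩
    exact hs β
  · rintro _ ⟨β, rfl⟩
    have := hs β
    simp only [hinv]
    exact this
  · intro x y hx hy h1 h2
    exact hm ⟨x, hx⟩ ⟨y, hy⟩ h1 h2

lemma s_mul_self (β : D.Root) : s β * s β = 1 :=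
  Subtype.ext (Units.ext (reflM_mul_self _))

/-- The matrix of a Weyl group element. -/
def mat (g : D.W) : Matrix (Fin N) (Fin N) ℂ := g.1.1

lemma mat_mul (g h : D.W) : mat (g * h) = mat g * mat h := rfl

lemma mat_one : mat (1 : D.W) = 1 := rfl

lemma mat_s (β : D.Root) : mat (s β) = reflM β.1 := rfl

lemma mat_injective : Function.Injective (mat : D.W → _) :=
  fun _ _ h => Subtype.ext (Units.ext h)

lemma mat_transpose_mul (g : D.W) : (mat g)ᵀ * mat g = 1 := by
  induction g using W_induction with
  | hs β => rw [mat_s, reflM_transpose, reflM_mul_self]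
  | h1 => simp [mat_one]
  | hm g h hg hh =>
    rw [mat_mul, transpose_mul, Matrix.mul_assoc, ← Matrix.mul_assoc _ (mat g), hg,
      Matrix.one_mul, hh]

lemma mat_inv (g : D.W) : mat g⁻¹ = (mat g)ᵀ := by
  have h : mat g * mat g⁻¹ = 1 := by rw [← mat_mul, mul_inv_cancel, mat_one]
  calc mat g⁻¹ = ((mat g)ᵀ * mat g) * mat g⁻¹ := by rw [mat_transpose_mul, Matrix.one_mul]
    _ = (mat g)ᵀ := by rw [Matrix.mul_assoc, h, Matrix.mul_one]

lemma dot_mat (g : D.W) (v w : Fin N → ℂ) : (mat g *ᵥ v) ⬝ᵥ (mat g *ᵥ w) = v ⬝ᵥ w := by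
  rw [dotProduct_mulVec, ← mulVec_transpose, mulVec_mulVec, mat_transpose_mul, one_mulVec]

lemma dot_mat_left (g : D.W) (v w : Fin N → ℂ) : (mat g *ᵥ v) ⬝ᵥ w = v ⬝ᵥ (mat g⁻¹ *ᵥ w) := by
  conv_rhs => rw [← dot_mat g, mulVec_mulVec, ← mat_mul, mul_inv_cancel, mat_one, one_mulVec]

/-- The image of a root under a reflection. -/
def reflRoot (β γ : D.Root) : D.Root :=
  ⟨γ.1 - (2 * (β.1 ⬝ᵥ γ.1) / (β.1 ⬝ᵥ β.1)) • β.1, D.refl_mem _ β.2 _ γ.2⟩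

lemma mat_s_mulVec (β : D.Root) (v : Fin N → ℂ) :
    mat (s β) *ᵥ v = v - (2 * (vec β ⬝ᵥ v) / (vec β ⬝ᵥ vec β)) • vec β := reflM_mulVec _ _

lemma vec_reflRoot (β γ : D.Root) : vec (reflRoot β γ) = mat (s β) *ᵥ vec γ := by
  rw [mat_s_mulVec]
  funext i
  simp only [vec, cplx_dot]
  simp [reflRoot, cplx]

lemma exists_smul (g : D.W) (γ : D.Root) : ∃ δ : D.Root, vec δ = mat g *ᵥ vec γ ∧ mul δ = mul γ := by
  induction g using W_induction generalizing γ with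
  | hs β => exact ⟨reflRoot β γ, vec_reflRoot β γ, D.m_refl _ β.2 _ γ.2⟩
  | h1 => exact ⟨γ, by simp [mat_one]⟩
  | hm g h hg hh =>
    obtain ⟨δ, h1, h2⟩ := hh γ
    obtain ⟨ε, h3, h4⟩ := hg δ
    exact ⟨ε, by rw [h3, h1, mulVec_mulVec, mat_mul], h4.trans h2⟩

instance : SMul D.W D.Root := ⟨fun g γ => (exists_smul g γ).choose⟩

lemma vec_smul (g : D.W) (γ : D.Root) : vec (g • γ) = mat g *ᵥ vec γ :=
  (exists_smul g γ).choose_spec.1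

instance : MulAction D.W D.Root where
  one_smul γ := vec_injective (by rw [vec_smul, mat_one, one_mulVec])
  mul_smul g h γ := vec_injective (by
    rw [vec_smul, vec_smul, vec_smul, mat_mul, mulVec_mulVec])

lemma mul_smul_root (g : D.W) (γ : D.Root) : mul (g • γ) = mul γ :=
  (exists_smul g γ).choose_spec.2

lemma s_smul (β γ : D.Root) : s β • γ = reflRoot β γ :=
  vec_injective (by rw [vec_smul, vec_reflRoot])

lemma s_smul_val (β γ : D.Root) :
    (s β • γ).1 = γ.1 - (2 * (β.1 ⬝ᵥ γ.1) / (β.1 ⬝ᵥ β.1)) • β.1 := by rw [s_smul]; rfl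

instance : Neg D.Root := ⟨fun β => ⟨-β.1, by
  have := (s β • β).2
  rwa [s_smul_val, mul_div_assoc, div_self (root_dot_pos β).ne', mul_one, two_smul,
    sub_add_cancel_left] at this⟩⟩

lemma neg_val (β : D.Root) : (-β).1 = -β.1 := rfl

lemma vec_neg (β : D.Root) : vec (-β) = -vec β := by
  funext i
  simp [vec, cplx, neg_val]

lemma ell_neg (β : D.Root) : ell (-β) = -ell β := by simp [ell, vec_neg]

instance : InvolutiveNeg D.Root where
  neg_neg β := Subtype.ext (by simp [neg_val])

lemma s_smul_self (β : D.Root) : s β • β = -β := Subtype.ext (by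
  rw [s_smul_val, mul_div_assoc, div_self (root_dot_pos β).ne', mul_one, two_smul,
    sub_add_cancel_left, neg_val])

lemma mul_neg_root (β : D.Root) : mul (-β) = mul β := by rw [← s_smul_self, mul_smul_root]

lemma smul_neg_root (g : D.W) (β : D.Root) : g • (-β) = -(g • β) :=
  vec_injective (by rw [vec_smul, vec_neg, vec_neg, vec_smul, mulVec_neg])

lemma neg_ne_self (β : D.Root) : -β ≠ β := fun h => by
  have := congrArg Subtype.val h
  rw [neg_val, neg_eq_self] at this
  exact root_ne_zero β this

lemma s_neg (β : D.Root) : s (-β) = s β := mat_injective (by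
  rw [mat_s, mat_s, reflM_eq, reflM_eq]
  change 1 - (2 / (vec (-β) ⬝ᵥ vec (-β))) • vecMulVec (vec (-β)) (vec (-β)) =
    1 - (2 / (vec β ⬝ᵥ vec β)) • vecMulVec (vec β) (vec β)
  simp [vec_neg])

lemma s_conj (g : D.W) (β : D.Root) : s (g • β) * g = g * s β := by
  refine mat_injective ?_
  rw [mat_mul, mat_mul]
  refine ext_of_mulVec_single fun j => ?_
  rw [← mulVec_mulVec, ← mulVec_mulVec, mat_s_mulVec, mat_s_mulVec, vec_smul, dot_mat, dot_mat,
    mulVec_sub, mulVec_smul]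

lemma span_vec : Submodule.span ℂ (Set.range (vec : D.Root → _)) = ⊤ := by
  have h : ∀ a ∈ Submodule.span ℝ (D.R : Set (Fin N → ℝ)),
      cplx a ∈ Submodule.span ℂ (Set.range (vec : D.Root → _)) := by
    intro a ha
    induction ha using Submodule.span_induction with
    | mem a ha => exact Submodule.subset_span ⟨⟨a, ha⟩, rfl⟩
    | zero => convert Submodule.zero_mem _; funext i; simp [cplx]
    | add a b _ _ ha hb => convert Submodule.add_mem _ ha hb; funext i; simp [cplx]
    | smul c a _ ha => convert Submodule.smul_mem _ (c : ℂ) ha; funext i; simp [cplx]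
  rw [eq_top_iff, ← (Pi.basisFun ℂ (Fin N)).span_eq, Submodule.span_le]
  rintro _ ⟨i, rfl⟩
  rw [Pi.basisFun_apply, ← cplx_single]
  exact h (Pi.single i 1) (by rw [D.span]; trivial)

lemma eq_of_smul_eq {g h : D.W} (H : ∀ β : D.Root, g • β = h • β) : g = h := by
  refine mat_injective ?_
  have : mulVecLin (mat g) = mulVecLin (mat h) := by
    refine LinearMap.ext_on_range (span_vec (D := D)) fun β => ?_
    rw [mulVecLin_apply, mulVecLin_apply, ← vec_smul, ← vec_smul, H]
  exact ext_of_mulVec_single fun j => by simpa using congrArg (fun f => f (Pi.single j 1)) this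

instance : Finite D.W :=
  Finite.of_injective (fun (g : D.W) (β : D.Root) => g • β)
    fun _ _ h => eq_of_smul_eq fun β => congrFun h β

instance : Fintype D.W := Fintype.ofFinite _

lemma exists_dot_ne_zero {v : Fin N → ℂ} (hv : v ≠ 0) : ∃ β : D.Root, vec β ⬝ᵥ v ≠ 0 := by
  by_contra! h
  refine hv (dotProduct_eq_zero v fun w => ?_)
  have hw : w ∈ Submodule.span ℂ (Set.range (vec : D.Root → _)) := by rw [span_vec]; trivial
  rw [dotProduct_comm]
  induction hw using Submodule.span_induction with
  | mem a ha => obtain ⟨β, rfl⟩ := ha; exact h β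
  | zero => simp
  | add a b _ _ ha hb => simp [add_dotProduct, ha, hb]
  | smul c a _ ha => simp [smul_dotProduct, ha]

/-- Irreducibility of the complexified reflection representation. -/
lemma irr_complex (U : Submodule ℂ (Fin N → ℂ)) (hU : ∀ (β : D.Root), ∀ v ∈ U, mat (s β) *ᵥ v ∈ U)
    (hne : U ≠ ⊥) : U = ⊤ := by
  obtain ⟨v, hv, hv0⟩ := U.ne_bot_iff.mp hne
  obtain ⟨β, hβ⟩ := exists_dot_ne_zero (D := D) hv0
  have hβU : vec β ∈ U := by
    have h1 := U.sub_mem hv (hU β v hv)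
    rw [mat_s_mulVec, sub_sub_cancel] at h1
    refine (U.smul_mem_iff ?_).mp h1
    simp [hβ, vec_dot_ne_zero]
  let U' : Submodule ℝ (Fin N → ℝ) :=
    { carrier := {a | cplx a ∈ U}
      add_mem' := fun {a b} ha hb => by
        have : cplx (a + b) = cplx a + cplx b := by funext i; simp [cplx]
        simpa only [Set.mem_ofPred_eq, this] using U.add_mem ha hb
      zero_mem' := by
        have : cplx (0 : Fin N → ℝ) = 0 := by funext i; simp [cplx]
        simp [this]
      smul_mem' := fun c a ha => by
        have : cplx (c • a) = (c : ℂ) • cplx a := by funext i; simp [cplx]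
        simpa only [Set.mem_ofPred_eq, this] using U.smul_mem _ ha }
  have htop : U' = ⊤ := by
    refine (D.irr U' fun a ha v hv => ?_).resolve_left fun h => ?_
    · have := hU ⟨a, ha⟩ _ hv
      change cplx _ ∈ U
      convert this using 1
      rw [mat_s_mulVec]
      funext i
      simp only [vec, cplx_dot]
      simp [cplx]
    · have : β.1 ∈ U' := hβU
      rw [h] at this
      exact root_ne_zero β (by simpa using this)
  rw [eq_top_iff, ← (Pi.basisFun ℂ (Fin N)).span_eq, Submodule.span_le]
  rintro _ ⟨i, rfl⟩
  have h3 : (Pi.single i 1 : Fin N → ℝ) ∈ U' := by rw [htop]; trivial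
  rw [Pi.basisFun_apply, ← cplx_single]
  exact h3

lemma eq_or_eq_neg_of_smul {β γ : D.Root} {c : ℂ} (h : vec γ = c • vec β) : γ = β ∨ γ = -β := by
  have hc : ∃ r : ℝ, γ.1 = r • β.1 := by
    obtain ⟨i, hi⟩ := Function.ne_iff.mp (root_ne_zero β)
    refine ⟨γ.1 i / β.1 i, ?_⟩
    have hi' : β.1 i ≠ 0 := hi
    have h1 : (γ.1 i : ℂ) = c * β.1 i := congrFun h i
    have h2 : c = ((γ.1 i / β.1 i : ℝ) : ℂ) := by
      push_cast
      rw [eq_div_iff (by exact_mod_cast hi'), h1]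
    funext j
    have h3 : (γ.1 j : ℂ) = c * β.1 j := congrFun h j
    rw [h2] at h3
    exact_mod_cast h3
  obtain ⟨r, hr⟩ := hc
  rcases D.reduced _ β.2 r (hr ▸ γ.2) with rfl | rfl
  · exact Or.inl (Subtype.ext (by simpa using hr))
  · exact Or.inr (Subtype.ext (by simpa [neg_val] using hr))

lemma ell_sub_C_dvd {β γ : D.Root} {c d : ℂ} (h : ell β - C c ∣ ell γ - C d) :
    (γ = β ∧ d = c) ∨ (γ = -β ∧ d = -c) := by
  obtain ⟨r, h1, h2⟩ := lin_sub_C_dvd (vec_ne_zero β) (vec_ne_zero γ) h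
  have hcancel : ∀ x : ℂ, x • vec β = r • vec β → x = r := fun x hx =>
    smul_left_injective ℂ (vec_ne_zero β) hx
  rcases eq_or_eq_neg_of_smul h1 with rfl | rfl
  · left
    have := hcancel 1 (by rw [one_smul, ← h1])
    simp [h2, ← this]
  · right
    have := hcancel (-1) (by rw [neg_one_smul, ← h1, vec_neg])
    simp [h2, ← this]

lemma ell_dvd_ell {β γ : D.Root} (h : ell β ∣ ell γ) : γ = β ∨ γ = -β := by
  have : ell β - C 0 ∣ ell γ - C 0 := by simpa using h
  exact (ell_sub_C_dvd this).imp And.left And.left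

/-- The action of the Weyl group on polynomials. -/
def act : D.W →* (Pol N ≃ₐ[ℂ] Pol N) := Catalan.act.comp D.W.subtype

lemma act_mul (g h : D.W) (p : Pol N) : act (g * h) p = act g (act h p) := by
  rw [map_mul]; rfl

lemma act_one (p : Pol N) : act (1 : D.W) p = p := by rw [map_one]; rfl

lemma act_lin (g : D.W) (v : Fin N → ℂ) : act g (lin v) = lin (mat g *ᵥ v) := by
  have : act g (lin v) = lin (v ᵥ* mat g⁻¹) := Catalan.act_lin g.1 v
  rw [this, mat_inv, vecMul_transpose]

lemma act_ell (g : D.W) (β : D.Root) : act g (ell β) = ell (g • β) := by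
  rw [ell, act_lin, ell, vec_smul]

lemma act_C (g : D.W) (c : ℂ) : act g (C c) = C c := Catalan.act_C g.1 c

lemma act_isHomogeneous (g : D.W) {p : Pol N} {d : ℕ} (hp : p.IsHomogeneous d) :
    (act g p).IsHomogeneous d := Catalan.act_isHomogeneous g.1 hp

lemma act_s (β : D.Root) (p : Pol N) : act (s β) p = polyActM (reflM β.1) p := rfl

end RootDatum

end Catalan

namespace Catalan

open Matrix TensorProduct

variable {N : ℕ}

set_option linter.unusedSectionVars false

section Field

variable (K : Type*) [Field K] [Algebra (Pol N) K] [IsFractionRing (Pol N) K] [Algebra ℂ K]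
  [IsScalarTower ℂ (Pol N) K]

/-- Extension of a derivation to the fraction field. -/
def extDer (d : Derivation ℂ (Pol N) (Pol N)) : Derivation ℂ K K :=
  haveI : Algebra.FormallyEtale (Pol N) K :=
    Algebra.FormallyEtale.of_isLocalization (nonZeroDivisors (Pol N))
  let φ : Ω[Pol N⁄ℂ] →ₗ[Pol N] K :=
    ((Algebra.linearMap (Pol N) K).compDer d).liftKaehlerDifferential
  let ψ : (K ⊗[Pol N] Ω[Pol N⁄ℂ]) →ₗ[K] K := φ.liftBaseChange K
  (ψ ∘ₗ (KaehlerDifferential.tensorKaehlerEquivOfFormallyEtale ℂ (Pol N) K).symm.toLinearMap).compDer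
    (KaehlerDifferential.D ℂ K)

lemma extDer_algebraMap (d : Derivation ℂ (Pol N) (Pol N)) (p : Pol N) :
    extDer K d (algebraMap (Pol N) K p) = algebraMap (Pol N) K (d p) := by
  have : Algebra.FormallyEtale (Pol N) K :=
    Algebra.FormallyEtale.of_isLocalization (nonZeroDivisors (Pol N))
  have h := KaehlerDifferential.tensorKaehlerEquivOfFormallyEtale_symm_D_algebraMap ℂ (Pol N) K p
  refine (congrArg (LinearMap.liftBaseChange K
    ((Algebra.linearMap (Pol N) K).compDer d).liftKaehlerDifferential) h).trans ?_
  simp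

variable {K}

lemma der_ext {d e : Derivation ℂ K K}
    (h : ∀ i : Fin N, d (algebraMap (Pol N) K (X i)) = e (algebraMap (Pol N) K (X i))) : d = e := by
  have hS : ∀ p : Pol N, d (algebraMap (Pol N) K p) = e (algebraMap (Pol N) K p) := by
    have : d.compAlgebraMap (Pol N) = e.compAlgebraMap (Pol N) := derivation_ext h
    exact fun p => congrArg (fun f => f p) this
  ext k
  obtain ⟨a, b, -, rfl⟩ := IsFractionRing.div_surjective (Pol N) k
  rw [Derivation.leibniz_div, Derivation.leibniz_div, hS, hS]

variable (K) in
/-- Directional derivatives on rational functions. -/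
def dK (ξ : Fin N → ℂ) : Derivation ℂ K K := ∑ i, ξ i • extDer K (pderiv i)

lemma dK_apply (ξ : Fin N → ℂ) (k : K) : dK K ξ k = ∑ i, ξ i • extDer K (pderiv i) k := by
  change Derivation.coeFnAddMonoidHom (dK K ξ) k = _
  rw [dK, map_sum, Finset.sum_apply]
  rfl

lemma dK_algebraMap (ξ : Fin N → ℂ) (p : Pol N) :
    dK K ξ (algebraMap (Pol N) K p) = algebraMap (Pol N) K (∑ i, ξ i • pderiv i p) := by
  simp only [dK_apply, extDer_algebraMap, map_sum, Algebra.smul_def, map_mul]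
  simp only [← IsScalarTower.algebraMap_apply]

lemma dK_lin (ξ v : Fin N → ℂ) : dK K ξ (algebraMap (Pol N) K (lin v)) = algebraMap ℂ K (v ⬝ᵥ ξ) := by
  rw [dK_algebraMap, IsScalarTower.algebraMap_apply ℂ (Pol N) K]
  congr 1
  simp [pderiv_lin, dotProduct, MvPolynomial.smul_eq_C_mul, mul_comm, algebraMap_eq]

lemma dK_smul (c : ℂ) (ξ : Fin N → ℂ) (k : K) : dK K (c • ξ) k = c • dK K ξ k := by
  simp [dK_apply, Finset.smul_sum, mul_smul]

lemma dK_add (ξ η : Fin N → ℂ) (k : K) : dK K (ξ + η) k = dK K ξ k + dK K η k := by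
  simp [dK_apply, Finset.sum_add_distrib, add_smul]

lemma dK_comm (ξ η : Fin N → ℂ) (k : K) : dK K ξ (dK K η k) = dK K η (dK K ξ k) := by
  have : ⁅dK K ξ, dK K η⁆ = 0 := der_ext (N := N) fun i => by
    rw [Derivation.commutator_apply, ← lin_single, dK_lin, dK_lin]
    simp
  have h := congrArg (fun f => f k) this
  simpa [Derivation.commutator_apply, sub_eq_zero] using h

variable (K) in
/-- Action on rational functions of automorphisms of the polynomial ring. -/
def extAut : (Pol N ≃ₐ[ℂ] Pol N) →* (K ≃ₐ[ℂ] K) := IsFractionRing.fieldEquivOfAlgEquivHom ℂ K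

lemma extAut_algebraMap (f : Pol N ≃ₐ[ℂ] Pol N) (p : Pol N) :
    extAut K f (algebraMap (Pol N) K p) = algebraMap (Pol N) K (f p) := by
  simp [extAut]

variable (K) in
/-- Rational functions that are regular at a prime. -/
def regAt (p : Pol N) (hp : Prime p) : Subalgebra (Pol N) K where
  carrier := {k | ∃ a b, ¬ p ∣ b ∧ k * algebraMap (Pol N) K b = algebraMap (Pol N) K a}
  mul_mem' := by
    rintro k l ⟨a, b, hb, h1⟩ ⟨c, d, hd, h2⟩
    refine ⟨a * c, b * d, fun h => (hp.dvd_or_dvd h).elim hb hd, ?_⟩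
    rw [map_mul, map_mul, ← h1, ← h2]
    ring
  add_mem' := by
    rintro k l ⟨a, b, hb, h1⟩ ⟨c, d, hd, h2⟩
    refine ⟨a * d + c * b, b * d, fun h => (hp.dvd_or_dvd h).elim hb hd, ?_⟩
    rw [map_mul, map_add, map_mul, map_mul, ← h1, ← h2]
    ring
  algebraMap_mem' a := ⟨a, 1, fun h => hp.not_isUnit (isUnit_of_dvd_one h), by simp⟩

variable {p : Pol N} {hp : Prime p}

lemma algebraMap_ne_zero {b : Pol N} (hb : b ≠ 0) : algebraMap (Pol N) K b ≠ 0 := by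
  simpa using hb

lemma algebraMap_mem_regAt (a : Pol N) : algebraMap (Pol N) K a ∈ regAt K p hp :=
  (regAt K p hp).algebraMap_mem a

lemma const_mem_regAt (c : ℂ) : algebraMap ℂ K c ∈ regAt K p hp := by
  rw [IsScalarTower.algebraMap_apply ℂ (Pol N) K]
  exact algebraMap_mem_regAt _

lemma inv_mem_regAt {b : Pol N} (hb : ¬ p ∣ b) : (algebraMap (Pol N) K b)⁻¹ ∈ regAt K p hp :=
  ⟨1, b, hb, by rw [inv_mul_cancel₀ (algebraMap_ne_zero (by rintro rfl; simp at hb)), map_one]⟩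

lemma mem_regAt_iff_div {k : K} : k ∈ regAt K p hp ↔
    ∃ a b, ¬ p ∣ b ∧ k = algebraMap (Pol N) K a / algebraMap (Pol N) K b := by
  constructor
  · rintro ⟨a, b, hb, h⟩
    exact ⟨a, b, hb, by rw [eq_div_iff (algebraMap_ne_zero (by rintro rfl; simp at hb)), h]⟩
  · rintro ⟨a, b, hb, rfl⟩
    rw [div_eq_mul_inv]
    exact mul_mem (algebraMap_mem_regAt a) (inv_mem_regAt hb)

lemma dK_mem_regAt (ξ : Fin N → ℂ) {k : K} (hk : k ∈ regAt K p hp) : dK K ξ k ∈ regAt K p hp := by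
  obtain ⟨a, b, hb, rfl⟩ := mem_regAt_iff_div.mp hk
  rw [Derivation.leibniz_div, dK_algebraMap, dK_algebraMap, smul_eq_mul, smul_eq_mul, smul_eq_mul]
  exact mul_mem (pow_mem (inv_mem_regAt hb) 2) (sub_mem (mul_mem (algebraMap_mem_regAt _)
    (algebraMap_mem_regAt _)) (mul_mem (algebraMap_mem_regAt _) (algebraMap_mem_regAt _)))

lemma extAut_mem_regAt (f : Pol N ≃ₐ[ℂ] Pol N) {q : Pol N} {hq : Prime q} (h : f p ∣ q) {k : K}
    (hk : k ∈ regAt K p hp) : extAut K f k ∈ regAt K q hq := by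
  obtain ⟨a, b, hb, rfl⟩ := mem_regAt_iff_div.mp hk
  rw [map_div₀, extAut_algebraMap, extAut_algebraMap]
  exact mem_regAt_iff_div.mpr ⟨_, _, fun h2 => hb ((map_dvd_iff f).mp (h.trans h2)), rfl⟩

/-- An automorphism congruent to the identity modulo a prime. -/
lemma dvd_aut_sub {f : Pol N ≃ₐ[ℂ] Pol N} (hf : ∀ i, p ∣ f (X i) - X i) (q : Pol N) :
    p ∣ f q - q := by
  rw [← Ideal.mem_span_singleton, ← Ideal.Quotient.eq]
  have : (Ideal.Quotient.mkₐ ℂ (Ideal.span {p})).comp f.toAlgHom =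
      Ideal.Quotient.mkₐ ℂ (Ideal.span {p}) := algHom_ext fun i => by
    have := hf i
    rw [← Ideal.mem_span_singleton, ← Ideal.Quotient.eq] at this
    exact this
  exact congrArg (fun g => g q) this

lemma extAut_sub_div_mem_regAt {f : Pol N ≃ₐ[ℂ] Pol N} (hf : ∀ i, p ∣ f (X i) - X i) {k : K}
    (hk : k ∈ regAt K p hp) : (extAut K f k - k) / algebraMap (Pol N) K p ∈ regAt K p hp := by
  obtain ⟨a, b, hb, rfl⟩ := mem_regAt_iff_div.mp hk
  obtain ⟨a', ha⟩ := dvd_aut_sub hf a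
  obtain ⟨b', hb'⟩ := dvd_aut_sub hf b
  have hfb : ¬ p ∣ f b := fun h => hb ((dvd_sub_right h).mp ⟨b', hb'⟩)
  rw [sub_eq_iff_eq_add] at ha hb'
  refine mem_regAt_iff_div.mpr ⟨a' * b - a * b', b * f b, fun h =>
    (hp.dvd_or_dvd h).elim hb hfb, ?_⟩
  have h1 : algebraMap (Pol N) K b ≠ 0 := algebraMap_ne_zero (by rintro rfl; simp at hb)
  have h2 : algebraMap (Pol N) K (f b) ≠ 0 := algebraMap_ne_zero (by intro h; simp [h] at hfb)
  have h3 : algebraMap (Pol N) K p ≠ 0 := algebraMap_ne_zero hp.ne_zero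
  rw [map_div₀, extAut_algebraMap, extAut_algebraMap, map_sub, map_mul, map_mul, map_mul]
  field_simp
  rw [ha, hb']
  simp only [map_add, map_mul]
  ring

lemma mem_range_of_prime_mul {k : K} (hk : k ∈ regAt K p hp) {a : Pol N}
    (h : algebraMap (Pol N) K p * k = algebraMap (Pol N) K a) : ∃ c, k = algebraMap (Pol N) K c := by
  obtain ⟨c, d, hd, h1⟩ := hk
  have h2 : a * d = p * c := by
    apply IsFractionRing.injective (Pol N) K
    rw [map_mul, map_mul, ← h, ← h1]
    ring
  obtain ⟨e, rfl⟩ := (hp.dvd_or_dvd ⟨c, h2⟩).resolve_right hd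
  exact ⟨e, mul_left_cancel₀ (algebraMap_ne_zero hp.ne_zero) (by rw [h, map_mul])⟩

end Field

end Catalan

namespace Catalan

/-- Removing the residue of a first-order operator with regular singularities along a hyperplane:
a chain of lattices ending with one that is stable under the operator. -/
lemma exists_stable_lattice {K M T : Type*} [Field K] [AddCommGroup M] [Module K M] [Module ℂ M]
    [SMulCommClass K ℂ M] {a : K} (ha : a ≠ 0) {n : M →ₗ[ℂ] M}
    (hn : ∀ f, n (a • f) = f + a • n f) {ν : T → M →ₗ[ℂ] M} (hνn : ∀ t f, ν t (n f) = n (ν t f))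
    (hνa : ∀ t f, ν t (a • f) = a • ν t f) (k : ℕ) (P Q : Submodule ℂ M)
    (hP : ∀ f ∈ P, a • f ∈ Q) (hQ : ∀ f ∈ Q, a • f ∈ P) (hnP : ∀ f ∈ P, n f ∈ Q)
    (hnQ : ∀ f, a • f ∈ Q → a • n f - (2 * k - 1 : ℂ) • f ∈ P)
    (hνP : ∀ t, ∀ f ∈ P, ν t f ∈ P) (hνQ : ∀ t, ∀ f ∈ Q, ν t f ∈ Q) :
    ∃ P₀ Q₀ : Submodule ℂ M, P ≤ P₀ ∧ Q ≤ Q₀ ∧ (∀ f ∈ P₀, n f ∈ Q₀) ∧ (∀ f ∈ Q₀, n f ∈ P₀) ∧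
      (∀ t, ∀ f ∈ P₀, ν t f ∈ P₀) ∧ (∀ t, ∀ f ∈ Q₀, ν t f ∈ Q₀) ∧
      (∀ f ∈ P₀, a ^ (2 * k) • f ∈ P) ∧ (∀ f ∈ Q₀, a ^ (2 * k) • f ∈ Q) ∧
      ∀ f ∈ P₀, n f = 0 → f ∈ P := by
  induction k generalizing P Q with
  | zero =>
    refine ⟨P, Q, le_rfl, le_rfl, hnP, fun f hf => ?_, hνP, hνQ, by simp, by simp,
      fun f hf _ => hf⟩
    have h1 := hnQ (a⁻¹ • f) (by rwa [smul_inv_smul₀ ha])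
    have h2 := hn (a⁻¹ • f)
    rw [smul_inv_smul₀ ha] at h2
    rw [h2]
    convert h1 using 1
    simp
    abel
  | succ k ih =>
    have hc : ∀ (c : ℂ) (f : M), a • c • f = c • a • f := fun c f => smul_comm _ _ _
    let P' : Submodule ℂ M :=
      { carrier := {f | a • f ∈ Q}
        add_mem' := fun {f g} hf hg => by
          simpa only [Set.mem_ofPred_eq, smul_add] using Q.add_mem hf hg
        zero_mem' := by simp
        smul_mem' := fun c f hf => by
          simpa only [Set.mem_ofPred_eq, hc] using Q.smul_mem c hf }
    let Q' : Submodule ℂ M := Q ⊔ P'.map n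
    have hP' : ∀ f, f ∈ P' ↔ a • f ∈ Q := fun f => Iff.rfl
    have hQ' : ∀ f, f ∈ Q' ↔ ∃ q ∈ Q, ∃ g ∈ P', q + n g = f := fun f => by
      simp [Q', Submodule.mem_sup]
    have key : ∀ g ∈ P', a • n g - (2 * k + 1 : ℂ) • g ∈ P := fun g hg => by
      have := hnQ g hg
      push_cast at this
      convert this using 3
      ring
    have key2 : ∀ g ∈ P', a • n (n g) - (2 * k : ℂ) • n g ∈ Q := fun g hg => by
      have := hnP _ (key g hg)
      rw [map_sub, n.map_smul (2 * k + 1 : ℂ), hn] at this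
      convert this using 1
      generalize a • n (n g) = y
      module
    have hPP' : P ≤ P' := fun f hf => hP f hf
    have key3 : ∀ f ∈ Q', a • a • f ∈ Q := fun f hf => by
      obtain ⟨q, hq, g, hg, rfl⟩ := (hQ' f).mp hf
      have h1 := hP _ (hQ q hq)
      have h2 := hP _ (key g hg)
      have h3 := Q.add_mem (Q.add_mem h1 h2) (Q.smul_mem (2 * k + 1 : ℂ) hg)
      convert h3 using 1
      rw [smul_sub, hc, smul_add, smul_add]
      abel
    obtain ⟨P₀, Q₀, h1, h2, h3, h4, h5, h6, h7, h8, h9⟩ := ih P' Q'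
      (fun f hf => (hQ' _).mpr ⟨_, hf, 0, zero_mem _, by simp⟩) key3
      (fun f hf => (hQ' _).mpr ⟨0, zero_mem _, f, hf, by simp⟩)
      (fun f hf => by
        obtain ⟨q, hq, g, hg, h⟩ := (hQ' _).mp hf
        have e1 : a • a⁻¹ • q = q := smul_inv_smul₀ ha q
        have hf1 : a⁻¹ • q ∈ P' := by rw [hP', e1]; exact hq
        have h1 := hP _ (key _ hf1)
        have h2 := Q.add_mem (Q.add_mem h1 (Q.smul_mem (2 : ℂ) hf1)) (key2 g hg)
        rw [hP']
        have e2 : a • n f = n q + n (n g) - f := by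
          rw [← map_add, h, hn]; abel
        have e3 := hn (a⁻¹ • q)
        rw [e1] at e3
        convert h2 using 1
        rw [smul_sub, e2, smul_sub, smul_add, smul_sub, hc, hc, e1, ← h, e3, smul_add, e1]
        generalize a • a • n (a⁻¹ • q) = x
        generalize a • n (n g) = y
        module)
      (fun t f hf => by
        rw [hP', ← hνa]; exact hνQ t _ hf)
      (fun t f hf => by
        obtain ⟨q, hq, g, hg, rfl⟩ := (hQ' f).mp hf
        refine (hQ' _).mpr ⟨_, hνQ t q hq, ν t g, ?_, by rw [map_add, hνn]⟩
        rw [hP', ← hνa]; exact hνQ t _ hg)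
    have hpow : ∀ f : M, a ^ (2 * (k + 1)) • f = a • a • a ^ (2 * k) • f := fun f => by
      simp only [smul_smul]; congr 1; ring
    refine ⟨P₀, Q₀, hPP'.trans h1, le_sup_left.trans h2, h3, h4, h5, h6, fun f hf => ?_,
      fun f hf => ?_, fun f hf h => ?_⟩
    · rw [hpow]; exact hQ _ (h7 f hf)
    · rw [hpow]; exact key3 _ (h8 f hf)
    · have := key f (h9 f hf h)
      rw [h, smul_zero, zero_sub, P.neg_mem_iff] at this
      exact (P.smul_mem_iff (by exact_mod_cast (2 * k).succ_ne_zero)).mp this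

end Catalan

namespace Catalan

open Matrix

variable {N : ℕ}

/-- The pairing of a vector with a polynomial vector field. -/
def contr (v : Fin N → ℂ) (F : Fin N → Pol N) : Pol N := ∑ i, v i • F i

namespace RootDatum

variable {D : RootDatum N}

/-- The action of the Weyl group on polynomial vector fields. -/
def actV (g : D.W) (F : Fin N → Pol N) : Fin N → Pol N := fun i => ∑ j, mat g i j • act g (F j)

variable (D) in
/-- A finite-dimensional representation of the Weyl group on homogeneous polynomial vector fields
killed by all the Dunkl operators. -/
structure DunklKernel (ι : Type*) [Fintype ι] [DecidableEq ι] where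
  ρ : D.W → Matrix ι ι ℂ
  ρ_mul : ∀ g h, ρ (g * h) = ρ g * ρ h
  ρ_one : ρ 1 = 1
  b : ι → Fin N → Pol N
  deg : ℕ
  hom : ∀ i n, (b i n).IsHomogeneous deg
  indep : LinearIndependent ℂ b
  ne_zero : ∃ i, b i ≠ 0
  act_b : ∀ g j, actV g (b j) = ∑ i, ρ g i j • b i
  mem : ∀ i (β : D.Root), ell β ^ (2 * mul β) ∣ contr (vec β) (b i)
  dunkl : ∀ (ξ : Fin N → ℂ) j n,
    algebraMap (Pol N) (FractionRing (Pol N)) (∑ i, ξ i • pderiv i (b j n)) =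
    ∑ β : D.Root, algebraMap ℂ (FractionRing (Pol N)) (mul β / 2 * (vec β ⬝ᵥ ξ)) /
      algebraMap (Pol N) (FractionRing (Pol N)) (ell β) *
      algebraMap (Pol N) (FractionRing (Pol N)) (b j n - actV (s β) (b j) n)

end RootDatum

namespace RootDatum.DunklKernel

variable {D : RootDatum N} {ι : Type*} [Fintype ι] [DecidableEq ι] (B : D.DunklKernel ι)

set_option linter.unusedSectionVars false

section Field

variable (K : Type*) [Field K] [Algebra (Pol N) K] [IsFractionRing (Pol N) K] [Algebra ℂ K]
  [IsScalarTower ℂ (Pol N) K]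

/-- The image of a root form in the field of rational functions. -/
def el (β : D.Root) : K := algebraMap (Pol N) K (ell β)

variable {K} in
lemma el_ne_zero (β : D.Root) : el K β ≠ 0 := algebraMap_ne_zero (prime_ell β).ne_zero

/-- The coefficient of a reflection in a Dunkl operator. -/
def cf (ξ : Fin N → ℂ) (β : D.Root) : K :=
  algebraMap ℂ K (mul β / 2 * (vec β ⬝ᵥ ξ)) / el K β

/-- The constant action of the group. -/
def P (g : D.W) : (ι → K) →ₗ[K] (ι → K) := Matrix.mulVecLin ((B.ρ g).map (algebraMap ℂ K))

variable {K}

lemma P_mul (g h : D.W) (f : ι → K) : B.P K (g * h) f = B.P K g (B.P K h f) := by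
  simp [P, B.ρ_mul, Matrix.map_mul]

lemma P_one (f : ι → K) : B.P K 1 f = f := by
  simp [P, B.ρ_one]

lemma P_apply (g : D.W) (f : ι → K) (i : ι) : B.P K g f i = ∑ j, B.ρ g i j • f j := by
  simp [P, mulVec, dotProduct, Algebra.smul_def]

lemma P_csmul (g : D.W) (c : ℂ) (f : ι → K) : B.P K g (c • f) = c • B.P K g f := by
  rw [← algebraMap_smul K c f, map_smul, algebraMap_smul]

variable (K ι) in
/-- Componentwise directional derivative. -/
def dM (ξ : Fin N → ℂ) : (ι → K) →ₗ[ℂ] (ι → K) :=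
  LinearMap.pi fun i => (dK K ξ).toLinearMap ∘ₗ LinearMap.proj i

@[simp] lemma dM_apply (ξ : Fin N → ℂ) (f : ι → K) (i : ι) : dM ι K ξ f i = dK K ξ (f i) := rfl

lemma dM_P (ξ : Fin N → ℂ) (g : D.W) (f : ι → K) : dM ι K ξ (B.P K g f) = B.P K g (dM ι K ξ f) := by
  funext i
  simp [P_apply]

lemma dM_smul (ξ : Fin N → ℂ) (k : K) (f : ι → K) :
    dM ι K ξ (k • f) = dK K ξ k • f + k • dM ι K ξ f := by
  funext i
  simp [mul_comm, add_comm]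

lemma dM_comm (ξ η : Fin N → ℂ) (f : ι → K) : dM ι K ξ (dM ι K η f) = dM ι K η (dM ι K ξ f) := by
  funext i
  simp [dK_comm ξ η]

variable (K) in
/-- The connection whose flat sections are mapped to constant vector fields. -/
def nab (ξ : Fin N → ℂ) : (ι → K) →ₗ[ℂ] (ι → K) where
  toFun f := dM ι K ξ f + ∑ β : D.Root, cf K ξ β • (f - B.P K (s β) f)
  map_add' f g := by
    simp only [map_add, add_sub_add_comm, smul_add, Finset.sum_add_distrib]
    abel
  map_smul' c f := by
    simp only [map_smul, P_csmul, ← smul_sub, Finset.smul_sum, RingHom.id_apply, smul_add,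
      smul_comm _ c]

lemma nab_apply (ξ : Fin N → ℂ) (f : ι → K) :
    B.nab K ξ f = dM ι K ξ f + ∑ β : D.Root, cf K ξ β • (f - B.P K (s β) f) := rfl

lemma nab_smul (ξ : Fin N → ℂ) (k : K) (f : ι → K) :
    B.nab K ξ (k • f) = dK K ξ k • f + k • B.nab K ξ f := by
  simp only [nab_apply, dM_smul, map_smul, ← smul_sub, smul_comm _ k, ← Finset.smul_sum, smul_add]
  abel

lemma cf_add (ξ η : Fin N → ℂ) (β : D.Root) : cf K (ξ + η) β = cf K ξ β + cf K η β := by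
  simp only [cf, dotProduct_add, mul_add, map_add, add_div]

lemma cf_smul (c : ℂ) (ξ : Fin N → ℂ) (β : D.Root) : cf K (c • ξ) β = c • cf K ξ β := by
  simp only [cf, dotProduct_smul, smul_eq_mul, map_mul]
  rw [Algebra.smul_def]
  ring

lemma nab_add (ξ η : Fin N → ℂ) (f : ι → K) : B.nab K (ξ + η) f = B.nab K ξ f + B.nab K η f := by
  have : dM ι K (ξ + η) f = dM ι K ξ f + dM ι K η f := by funext i; simp [dK_add]
  simp only [nab_apply, this, cf_add, add_smul, Finset.sum_add_distrib]
  abel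

lemma nab_csmul (c : ℂ) (ξ : Fin N → ℂ) (f : ι → K) : B.nab K (c • ξ) f = c • B.nab K ξ f := by
  have : dM ι K (c • ξ) f = c • dM ι K ξ f := by funext i; simp [dK_smul]
  simp only [nab_apply, this, cf_smul, smul_assoc, ← Finset.smul_sum, smul_add]

lemma dK_cf (ξ η : Fin N → ℂ) (β : D.Root) : dK K ξ (cf K η β) = dK K η (cf K ξ β) := by
  simp only [cf, Derivation.leibniz_div, el, ell, dK_lin, Derivation.map_algebraMap, smul_eq_mul,
    mul_zero, zero_sub]
  simp only [map_mul]
  ring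

/-- The antisymmetrised coefficient appearing in the curvature. -/
def crv (ξ η : Fin N → ℂ) (β γ : D.Root) : K := cf K ξ β * cf K η γ - cf K η β * cf K ξ γ

lemma crv_swap (ξ η : Fin N → ℂ) (β γ : D.Root) :
    crv (K := K) ξ η γ β = - crv (K := K) ξ η β γ := by
  simp only [crv]
  ring

lemma s_inv (β : D.Root) : (s β)⁻¹ = s β := inv_eq_of_mul_eq_one_left (s_mul_self β)

lemma mat_mul_sub (β γ : D.Root) (y : Fin N → ℂ) :
    (mat (s β * s γ) - (mat (s β * s γ))ᵀ) *ᵥ y =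
      (4 * (vec β ⬝ᵥ vec γ) / ((vec β ⬝ᵥ vec β) * (vec γ ⬝ᵥ vec γ))) •
        ((vec γ ⬝ᵥ y) • vec β - (vec β ⬝ᵥ y) • vec γ) := by
  have h1 : (mat (s β * s γ))ᵀ = mat (s γ * s β) := by
    rw [← mat_inv, _root_.mul_inv_rev, s_inv, s_inv]
  rw [h1, sub_mulVec, mat_mul, mat_mul, ← mulVec_mulVec, ← mulVec_mulVec]
  have hc := dotProduct_comm (vec γ) (vec β)
  rw [mat_s_mulVec γ y, mat_s_mulVec β y, mat_s_mulVec, mat_s_mulVec, dotProduct_sub,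
    dotProduct_sub, dotProduct_smul, dotProduct_smul, hc]
  funext i
  simp only [Pi.sub_apply, Pi.smul_apply, smul_eq_mul]
  ring

lemma sum_crv_fiber (ξ η : Fin N → ℂ) (w : D.W) :
    ∑ p : D.Root × D.Root with s p.1 * s p.2 = w, crv (K := K) ξ η p.1 p.2 = 0 := by
  by_cases hw : mat w = (mat w)ᵀ
  · have hw' : w⁻¹ = w := mat_injective (by rw [mat_inv, ← hw])
    have h : ∑ p : D.Root × D.Root with s p.1 * s p.2 = w, crv (K := K) ξ η p.1 p.2 =
        ∑ p : D.Root × D.Root with s p.1 * s p.2 = w, crv (K := K) ξ η p.2 p.1 := by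
      refine Finset.sum_nbij' Prod.swap Prod.swap ?_ ?_ (by simp) (by simp) (by simp)
      all_goals
        rintro ⟨β, γ⟩ hp
        simp only [Finset.mem_filter, Finset.mem_univ, true_and, Prod.swap] at hp ⊢
        rw [← hw', ← hp, _root_.mul_inv_rev, s_inv, s_inv]
    have h3 : ∑ p : D.Root × D.Root with s p.1 * s p.2 = w, crv (K := K) ξ η p.2 p.1 =
        -∑ p : D.Root × D.Root with s p.1 * s p.2 = w, crv (K := K) ξ η p.1 p.2 := by
      rw [← Finset.sum_neg_distrib]
      exact Finset.sum_congr rfl fun p _ => crv_swap _ _ _ _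
    have : CharZero K := charZero_of_injective_algebraMap (algebraMap ℂ K).injective
    exact self_eq_neg.mp (h.trans h3)
  · obtain ⟨y, hy⟩ : ∃ y, (mat w - (mat w)ᵀ) *ᵥ y ≠ 0 := by
      by_contra! h
      exact hw (sub_eq_zero.mp (ext_of_mulVec_single fun j => by rw [h, zero_mulVec]))
    have hl : algebraMap (Pol N) K (lin ((mat w - (mat w)ᵀ) *ᵥ y)) ≠ 0 :=
      algebraMap_ne_zero (lin_ne_zero hy)
    refine (mul_eq_zero.mp ?_).resolve_left hl
    let g : D.Root → K := fun β => algebraMap ℂ K (vec β ⬝ᵥ y) / el K β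
    let μ : D.Root → D.Root → K := fun β γ => algebraMap ℂ K (mul β * mul γ / 4)
    have h1 : ∀ p : D.Root × D.Root, s p.1 * s p.2 = w →
        algebraMap (Pol N) K (lin ((mat w - (mat w)ᵀ) *ᵥ y)) * crv (K := K) ξ η p.1 p.2 =
        algebraMap ℂ K (ξ ⬝ᵥ ((mat w - (mat w)ᵀ) *ᵥ η)) *
          (μ p.1 p.2 * g p.2 - μ p.1 p.2 * g p.1) := by
      rintro ⟨β, γ⟩ rfl
      have hβ := el_ne_zero (K := K) β
      have hγ := el_ne_zero (K := K) γ
      have e1 : ∀ c : ℂ, ∀ q : Pol N, algebraMap (Pol N) K (c • q) =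
        algebraMap ℂ K c * algebraMap (Pol N) K q := fun c q => by
          rw [Algebra.smul_def, map_mul, ← IsScalarTower.algebraMap_apply]
      have e2 : ∀ δ : D.Root, algebraMap (Pol N) K (lin (vec δ)) = el K δ := fun δ => rfl
      simp only [mat_mul_sub, dotProduct_smul, dotProduct_sub, map_smul, map_sub, e1, e2, crv, cf, g,
        μ, smul_eq_mul, map_mul, map_div₀, dotProduct_comm ξ (vec β),
        dotProduct_comm ξ (vec γ)]
      have h4 : algebraMap ℂ K 4 = 4 := map_ofNat _ _
      have h2 : algebraMap ℂ K 2 = 2 := map_ofNat _ _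
      have : CharZero K := charZero_of_injective_algebraMap (algebraMap ℂ K).injective
      rw [h4, h2]
      field_simp
      ring
    rw [Finset.mul_sum, Finset.sum_congr rfl fun p hp => h1 p (Finset.mem_filter.mp hp).2,
      ← Finset.mul_sum, Finset.sum_sub_distrib]
    refine mul_eq_zero_of_right _ (sub_eq_zero.mpr (Eq.symm ?_))
    refine Finset.sum_nbij' (fun p => (s p.1 • p.2, p.1)) (fun p => (p.2, s p.2 • p.1))
      ?_ ?_ ?_ ?_ ?_
    · rintro ⟨β, γ⟩ hp
      simp only [Finset.mem_filter, Finset.mem_univ, true_and] at hp ⊢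
      rw [s_conj, hp]
    · rintro ⟨β, γ⟩ hp
      simp only [Finset.mem_filter, Finset.mem_univ, true_and] at hp ⊢
      rw [← s_conj, ← mul_smul, s_mul_self, one_smul, hp]
    · rintro ⟨β, γ⟩ -
      simp only [← mul_smul, s_mul_self, one_smul]
    · rintro ⟨β, γ⟩ -
      simp only [← mul_smul, s_mul_self, one_smul]
    · rintro ⟨β, γ⟩ -
      simp only [μ, mul_smul_root, mul_comm]

lemma nab_comm (ξ η : Fin N → ℂ) (f : ι → K) :
    B.nab K ξ (B.nab K η f) = B.nab K η (B.nab K ξ f) := by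
  have h1 : ∀ ξ η : Fin N → ℂ, B.nab K ξ (B.nab K η f) = dM ι K ξ (dM ι K η f) +
      ∑ β : D.Root, dK K ξ (cf K η β) • (f - B.P K (s β) f) +
      (∑ β : D.Root, cf K η β • (dM ι K ξ f - B.P K (s β) (dM ι K ξ f)) +
      ∑ β : D.Root, cf K ξ β • (dM ι K η f - B.P K (s β) (dM ι K η f))) +
      ∑ p : D.Root × D.Root, (cf K ξ p.1 * cf K η p.2) •
        (f - B.P K (s p.1) f - B.P K (s p.2) f + B.P K (s p.1 * s p.2) f) := fun ξ η => by
    rw [B.nab_apply ξ, B.nab_apply η]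
    simp only [map_add, map_sum, dM_smul, map_smul, map_sub, dM_P, Finset.sum_add_distrib,
      Fintype.sum_prod_type, P_mul]
    have : ∀ β : D.Root, cf K ξ β • (dM ι K η f + ∑ γ : D.Root, cf K η γ • (f - B.P K (s γ) f) -
        (B.P K (s β) (dM ι K η f) + ∑ γ : D.Root, cf K η γ • (B.P K (s β) f -
          B.P K (s β) (B.P K (s γ) f)))) =
        cf K ξ β • (dM ι K η f - B.P K (s β) (dM ι K η f)) +
        ∑ γ : D.Root, (cf K ξ β * cf K η γ) •
          (f - B.P K (s β) f - B.P K (s γ) f + B.P K (s β) (B.P K (s γ) f)) := fun β => by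
      rw [add_sub_add_comm, smul_add, ← Finset.sum_sub_distrib, Finset.smul_sum]
      congr 1
      refine Finset.sum_congr rfl fun γ _ => ?_
      rw [mul_smul, ← smul_sub]
      congr 2
      abel
    simp only [this, Finset.sum_add_distrib]
    abel
  rw [← sub_eq_zero, h1, h1, dM_comm ξ η]
  simp only [dK_cf ξ η]
  rw [add_comm (∑ β : D.Root, cf K ξ β • _) (∑ β : D.Root, cf K η β • _), add_sub_add_left_eq_sub,
    ← Finset.sum_sub_distrib]
  simp only [← sub_smul]
  change ∑ p : D.Root × D.Root, crv ξ η p.1 p.2 • _ = _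
  have h2 : ∑ p : D.Root × D.Root, crv (K := K) ξ η p.1 p.2 •
      (f - B.P K (s p.1) f - B.P K (s p.2) f) = 0 := by
    have : ∑ p : D.Root × D.Root, crv (K := K) ξ η p.1 p.2 •
      (f - B.P K (s p.1) f - B.P K (s p.2) f) = - ∑ p : D.Root × D.Root, crv (K := K) ξ η p.1 p.2 •
      (f - B.P K (s p.1) f - B.P K (s p.2) f) := by
      conv_lhs => rw [← (Equiv.prodComm _ _).sum_comp]
      rw [← Finset.sum_neg_distrib]
      refine Finset.sum_congr rfl fun p _ => ?_
      rw [Equiv.prodComm_apply, Prod.fst_swap, Prod.snd_swap, crv_swap, neg_smul, sub_right_comm]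
    have h : CharZero K := charZero_of_injective_algebraMap (algebraMap ℂ K).injective
    have := add_eq_zero_iff_eq_neg.mpr this
    rw [← two_smul K] at this
    exact (smul_eq_zero.mp this).resolve_left two_ne_zero
  simp only [smul_add, Finset.sum_add_distrib, h2, zero_add]
  rw [← Finset.sum_fiberwise Finset.univ fun p : D.Root × D.Root => s p.1 * s p.2]
  refine Finset.sum_eq_zero fun w _ => ?_
  rw [Finset.sum_congr rfl fun p hp => by rw [(Finset.mem_filter.mp hp).2], ← Finset.sum_smul,
    sum_crv_fiber, zero_smul]

end Field

end RootDatum.DunklKernel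

end Catalan

namespace Catalan.RootDatum.DunklKernel

open Matrix

variable {N : ℕ} {D : RootDatum N} {ι : Type*} [Fintype ι] [DecidableEq ι] (B : D.DunklKernel ι)

set_option linter.unusedSectionVars false

section Field

variable {K : Type*} [Field K] [Algebra (Pol N) K] [IsFractionRing (Pol N) K] [Algebra ℂ K]
  [IsScalarTower ℂ (Pol N) K]

lemma algebraMap_csmul (c : ℂ) (p : Pol N) : algebraMap (Pol N) K (c • p) =
    algebraMap ℂ K c * algebraMap (Pol N) K p := by
  rw [Algebra.smul_def, map_mul, ← IsScalarTower.algebraMap_apply]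

lemma extAut_dK (g : D.W) (ξ : Fin N → ℂ) (k : K) :
    extAut K (act g) (dK K ξ k) = dK K (mat g *ᵥ ξ) (extAut K (act g) k) := by
  have hS : ∀ p : Pol N, extAut K (act g) (dK K ξ (algebraMap (Pol N) K p)) =
      dK K (mat g *ᵥ ξ) (extAut K (act g) (algebraMap (Pol N) K p)) := fun p => by
    induction p using MvPolynomial.induction_on with
    | C a =>
      have : algebraMap (Pol N) K (C a) = algebraMap ℂ K a :=
        (IsScalarTower.algebraMap_apply ℂ (Pol N) K a).symm
      simp [this]
    | add p q hp hq => simp only [map_add, hp, hq]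
    | mul_X p i hp =>
      have hX : extAut K (act g) (dK K ξ (algebraMap (Pol N) K (X i))) =
          dK K (mat g *ᵥ ξ) (extAut K (act g) (algebraMap (Pol N) K (X i))) := by
        rw [← lin_single, dK_lin, extAut_algebraMap, act_lin, dK_lin, dot_mat]
        simp
      simp only [map_mul, Derivation.leibniz, smul_eq_mul, map_add, hp, hX]
  obtain ⟨a, b, -, rfl⟩ := IsFractionRing.div_surjective (Pol N) k
  rw [Derivation.leibniz_div, map_div₀ (extAut K (act g)), Derivation.leibniz_div]
  simp only [map_mul, map_sub, smul_eq_mul, hS, map_pow, map_inv₀]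

lemma extAut_el (g : D.W) (β : D.Root) : extAut K (act g) (el K β) = el K (g • β) := by
  rw [el, extAut_algebraMap, act_ell, el]

lemma extAut_cf (g : D.W) (ξ : Fin N → ℂ) (β : D.Root) :
    extAut K (act g) (cf K ξ β) = cf K (mat g *ᵥ ξ) (g • β) := by
  rw [cf, cf, map_div₀, extAut_el, AlgEquiv.commutes, mul_smul_root, vec_smul, dot_mat]

variable (ι K) in
/-- The componentwise action of the group. -/
def A (g : D.W) : (ι → K) →ₗ[ℂ] (ι → K) :=
  LinearMap.pi fun i => (extAut K (act g)).toLinearMap ∘ₗ LinearMap.proj i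

@[simp] lemma A_apply (g : D.W) (f : ι → K) (i : ι) : A ι K g f i = extAut K (act g) (f i) := rfl

lemma A_mul (g h : D.W) (f : ι → K) : A ι K (g * h) f = A ι K g (A ι K h f) := by
  funext i
  simp only [A_apply, map_mul, AlgEquiv.mul_apply]

lemma A_one (f : ι → K) : A ι K (1 : D.W) f = f := by
  funext i
  simp only [A_apply, map_one, AlgEquiv.one_apply]

lemma A_smul (g : D.W) (k : K) (f : ι → K) :
    A ι K g (k • f) = extAut K (act g) k • A ι K g f := by
  funext i
  simp

lemma A_P (g h : D.W) (f : ι → K) : A ι K g (B.P K h f) = B.P K h (A ι K g f) := by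
  funext i
  simp [P_apply]

variable (K) in
/-- The twisted action of the group. -/
def sg (g : D.W) : (ι → K) →ₗ[ℂ] (ι → K) where
  toFun f := B.P K g (A ι K g f)
  map_add' := by simp
  map_smul' c f := by simp only [map_smul, P_csmul, RingHom.id_apply]

lemma sg_apply (g : D.W) (f : ι → K) : B.sg K g f = B.P K g (A ι K g f) := rfl

lemma sg_mul (g h : D.W) (f : ι → K) : B.sg K (g * h) f = B.sg K g (B.sg K h f) := by
  rw [sg_apply, sg_apply, sg_apply, A_P, A_mul, P_mul]

lemma sg_one (f : ι → K) : B.sg K 1 f = f := by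
  rw [sg_apply, A_one, P_one]

lemma sg_smul (g : D.W) (k : K) (f : ι → K) :
    B.sg K g (k • f) = extAut K (act g) k • B.sg K g f := by
  rw [sg_apply, A_smul, map_smul, sg_apply]

lemma sg_nab (g : D.W) (ξ : Fin N → ℂ) (f : ι → K) :
    B.sg K g (B.nab K ξ f) = B.nab K (mat g *ᵥ ξ) (B.sg K g f) := by
  rw [nab_apply, nab_apply, map_add, map_sum]
  congr 1
  · rw [sg_apply, sg_apply, dM_P]
    congr 1
    funext i
    simp [extAut_dK]
  · rw [← Equiv.sum_comp (MulAction.toPerm g : Equiv.Perm D.Root)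
      fun β => cf K (mat g *ᵥ ξ) β • (B.sg K g f - B.P K (s β) (B.sg K g f))]
    refine Finset.sum_congr rfl fun β _ => ?_
    rw [sg_smul, extAut_cf, map_sub, MulAction.toPerm_apply, sg_apply, sg_apply, A_P, ← P_mul,
      ← P_mul, s_conj]

variable (K) in
/-- The `K`-linear extension of the inclusion of the kernel of the Dunkl operators. -/
def Psi : (ι → K) →ₗ[K] (Fin N → K) where
  toFun f n := ∑ j, f j * algebraMap (Pol N) K (B.b j n)
  map_add' f g := by funext n; simp [add_mul, Finset.sum_add_distrib]
  map_smul' c f := by funext n; simp [Finset.mul_sum, mul_assoc]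

lemma Psi_apply (f : ι → K) (n : Fin N) :
    B.Psi K f n = ∑ j, f j * algebraMap (Pol N) K (B.b j n) := rfl

lemma Psi_csmul (c : ℂ) (f : ι → K) : B.Psi K (c • f) = c • B.Psi K f := by
  rw [← algebraMap_smul K c f, map_smul, algebraMap_smul]

lemma act_b_apply (g : D.W) (j : ι) (n : Fin N) :
    actV g (B.b j) n = ∑ i, B.ρ g i j • B.b i n := by
  rw [B.act_b, Finset.sum_apply]
  rfl

lemma Psi_P (g : D.W) (f : ι → K) (n : Fin N) :
    B.Psi K (B.P K g f) n = ∑ j, f j * algebraMap (Pol N) K (actV g (B.b j) n) := by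
  simp only [Psi_apply, P_apply, act_b_apply, map_sum, Finset.sum_mul, Finset.mul_sum,
    algebraMap_csmul]
  rw [Finset.sum_comm]
  refine Finset.sum_congr rfl fun i _ => Finset.sum_congr rfl fun j _ => ?_
  rw [Algebra.smul_def]
  ring

lemma Psi_sg (g : D.W) (f : ι → K) (n : Fin N) :
    B.Psi K (B.sg K g f) n = ∑ j, mat g n j • extAut K (act g) (B.Psi K f j) := by
  rw [sg_apply, Psi_P]
  simp only [actV, map_sum, algebraMap_csmul, A_apply, Psi_apply, map_mul, extAut_algebraMap,
    Finset.smul_sum, Finset.mul_sum]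
  rw [Finset.sum_comm]
  refine Finset.sum_congr rfl fun i _ => Finset.sum_congr rfl fun j _ => ?_
  rw [Algebra.smul_def]
  ring

end Field

variable (K : Type*) [Field K] [Algebra (Pol N) K] [IsFractionRing (Pol N) K] [Algebra ℂ K]
  [IsScalarTower ℂ (Pol N) K]

lemma dunkl_field (ξ : Fin N → ℂ) (j : ι) (n : Fin N) :
    algebraMap (Pol N) K (∑ i, ξ i • pderiv i (B.b j n)) =
      ∑ β : D.Root, cf K ξ β * algebraMap (Pol N) K (B.b j n - actV (s β) (B.b j) n) := by
  let φ := IsLocalization.algEquiv (nonZeroDivisors (Pol N)) (FractionRing (Pol N)) K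
  have hφ : ∀ p, φ (algebraMap (Pol N) (FractionRing (Pol N)) p) = algebraMap (Pol N) K p :=
    φ.commutes
  have hφ2 : ∀ c : ℂ, φ (algebraMap ℂ (FractionRing (Pol N)) c) = algebraMap ℂ K c := fun c => by
    rw [IsScalarTower.algebraMap_apply ℂ (Pol N) (FractionRing (Pol N)), hφ,
      ← IsScalarTower.algebraMap_apply]
  have h := congrArg φ (B.dunkl ξ j n)
  rw [hφ] at h
  rw [h, map_sum]
  refine Finset.sum_congr rfl fun β _ => ?_
  rw [map_mul, map_div₀, hφ, hφ, hφ2, cf, el]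

variable {K}

lemma Psi_nab (ξ : Fin N → ℂ) (f : ι → K) (n : Fin N) :
    B.Psi K (B.nab K ξ f) n = dK K ξ (B.Psi K f n) := by
  rw [nab_apply, map_add, map_sum, Pi.add_apply, Finset.sum_apply]
  simp only [map_smul, Pi.smul_apply, map_sub, Pi.sub_apply, Psi_P]
  simp only [Psi_apply, dM_apply, map_sum, Derivation.leibniz, smul_eq_mul, dK_algebraMap,
    Finset.sum_add_distrib]
  rw [add_comm]
  congr 1
  · simp only [← map_sum, B.dunkl_field K, ← Finset.sum_sub_distrib, ← mul_sub, ← map_sub,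
      Finset.mul_sum]
    rw [Finset.sum_comm]
    refine Finset.sum_congr rfl fun i _ => Finset.sum_congr rfl fun j _ => ?_
    ring
  · exact Finset.sum_congr rfl fun i _ => mul_comm _ _

lemma sum_X_cf (β : D.Root) :
    ∑ i, algebraMap (Pol N) K (X i) * cf K (Pi.single i 1) β = algebraMap ℂ K (mul β / 2) := by
  simp only [cf, dotProduct_single_one, map_mul, mul_div_assoc, mul_left_comm]
  rw [← Finset.mul_sum, ← mul_one (algebraMap ℂ K (mul β / 2)), mul_assoc]
  congr 1
  rw [one_mul, ← div_self (el_ne_zero (K := K) β)]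
  have h : el K β = ∑ i, algebraMap ℂ K (vec β i) * algebraMap (Pol N) K (X i) := by
    rw [el, ell, lin_eq, map_sum]
    exact Finset.sum_congr rfl fun i _ => algebraMap_csmul _ _
  conv_rhs => rw [← mul_one_div, h, Finset.sum_mul]
  refine Finset.sum_congr rfl fun i _ => ?_
  rw [← h]
  ring

lemma casimir_b (j : ι) :
    (B.deg : ℂ) • B.b j = ∑ β : D.Root, (mul β / 2 : ℂ) • (B.b j - actV (s β) (B.b j)) := by
  funext n
  apply IsFractionRing.injective (Pol N) (FractionRing (Pol N))
  have h := (B.hom j n).sum_X_mul_pderiv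
  rw [nsmul_eq_mul] at h
  simp only [Pi.smul_apply, Finset.sum_apply, Pi.sub_apply, map_sum, algebraMap_csmul, ← sum_X_cf,
    Finset.sum_mul]
  rw [Finset.sum_comm]
  have h2 : ∀ i : Fin N, pderiv i (B.b j n) =
      ∑ k, (Pi.single i 1 : Fin N → ℂ) k • pderiv k (B.b j n) := fun i => by
    simp [Pi.single_apply, ite_smul]
  simp only [mul_assoc, ← Finset.mul_sum, ← B.dunkl_field, ← h2]
  rw [← algebraMap_csmul, MvPolynomial.smul_eq_C_mul]
  simp only [← map_mul, ← map_sum]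
  rw [h]
  simp

lemma casimir_aux (i j : ι) :
    ∑ β : D.Root, (mul β / 2 : ℂ) * ((1 : Matrix ι ι ℂ) i j - B.ρ (s β) i j) =
      B.deg * (1 : Matrix ι ι ℂ) i j := by
  have h := B.casimir_b j
  have h1 : B.b j = ∑ i, (1 : Matrix ι ι ℂ) i j • B.b i := by
    simp [Matrix.one_apply, ite_smul]
  have h2 : ∀ β : D.Root, B.b j - actV (s β) (B.b j) =
      ∑ i, ((1 : Matrix ι ι ℂ) i j - B.ρ (s β) i j) • B.b i := fun β => by
    simp only [sub_smul, Finset.sum_sub_distrib, ← h1, B.act_b]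
  simp only [h2, Finset.smul_sum, smul_smul] at h
  rw [Finset.sum_comm] at h
  simp only [← Finset.sum_smul] at h
  conv_lhs at h => rw [h1, Finset.smul_sum]
  simp only [smul_smul] at h
  rw [← sub_eq_zero, ← Finset.sum_sub_distrib] at h
  simp only [← sub_smul] at h
  exact (sub_eq_zero.mp (Fintype.linearIndependent_iff.mp B.indep _ h i)).symm

lemma casimir (f : ι → K) :
    ∑ β : D.Root, (mul β / 2 : ℂ) • (f - B.P K (s β) f) = (B.deg : ℂ) • f := by
  funext i
  have h1 : ∀ f : ι → K, f i = ∑ j, (1 : Matrix ι ι ℂ) i j • f j := fun f => by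
    simp [Matrix.one_apply, ite_smul]
  simp only [Finset.sum_apply, Pi.smul_apply, Pi.sub_apply, P_apply]
  have h2 : ∀ β : D.Root, f i - ∑ j, B.ρ (s β) i j • f j =
      ∑ j, ((1 : Matrix ι ι ℂ) i j - B.ρ (s β) i j) • f j := fun β => by
    simp only [sub_smul, Finset.sum_sub_distrib, ← h1]
  simp only [h2, Finset.smul_sum, smul_smul]
  rw [Finset.sum_comm]
  simp only [← Finset.sum_smul, B.casimir_aux]
  simp only [mul_smul]
  rw [← Finset.smul_sum, ← h1]

lemma sum_X_nab (f : ι → K) :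
    ∑ i, algebraMap (Pol N) K (X i) • B.nab K (Pi.single i 1) f =
      ∑ i, algebraMap (Pol N) K (X i) • dM ι K (Pi.single i 1) f + (B.deg : ℂ) • f := by
  simp only [nab_apply, smul_add, Finset.sum_add_distrib]
  rw [← B.casimir]
  congr 1
  simp only [Finset.smul_sum, smul_smul]
  rw [Finset.sum_comm]
  simp only [← Finset.sum_smul, sum_X_cf, algebraMap_smul]

lemma sum_X_nab_nab (η : Fin N → ℂ) (f : ι → K) :
    ∑ i, algebraMap (Pol N) K (X i) • B.nab K (Pi.single i 1) (B.nab K η f) =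
      B.nab K η (∑ i, algebraMap (Pol N) K (X i) • B.nab K (Pi.single i 1) f) - B.nab K η f := by
  simp only [map_sum, nab_smul, Finset.sum_add_distrib, B.nab_comm η]
  rw [eq_sub_iff_add_eq, add_comm]
  congr 1
  have : ∀ i, dK K η (algebraMap (Pol N) K (X i)) = algebraMap ℂ K (η i) := fun i => by
    rw [← lin_single, dK_lin]; simp
  simp only [this, algebraMap_smul, ← nab_csmul]
  have hs : ∀ t : Finset (Fin N), ∑ i ∈ t, B.nab K (η i • Pi.single i 1) f =
      B.nab K (∑ i ∈ t, η i • Pi.single i 1) f := fun t => by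
    induction t using Finset.induction_on with
    | empty =>
      have := B.nab_csmul (K := K) 0 0 f
      simp only [zero_smul] at this
      simp [this]
    | insert i t hi ih => rw [Finset.sum_insert hi, Finset.sum_insert hi, ih, nab_add]
  rw [hs]
  congr 2
  funext k
  simp [Finset.sum_apply, Pi.single_apply]

end Catalan.RootDatum.DunklKernel

namespace Catalan.RootDatum.DunklKernel

open Matrix

variable {N : ℕ} {D : RootDatum N} {ι : Type*} [Fintype ι] [DecidableEq ι] (B : D.DunklKernel ι)

set_option linter.unusedSectionVars false

variable {K : Type*} [Field K] [Algebra (Pol N) K] [IsFractionRing (Pol N) K] [Algebra ℂ K]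
  [IsScalarTower ℂ (Pol N) K]

variable (ι K) in
/-- Vectors of rational functions that are regular at a prime. -/
def reg (p : Pol N) (hp : Prime p) : Submodule (regAt K p hp) (ι → K) where
  carrier := {f | ∀ i, f i ∈ regAt K p hp}
  add_mem' hf hg i := add_mem (hf i) (hg i)
  zero_mem' _ := zero_mem _
  smul_mem' c _ hf i := mul_mem c.2 (hf i)

section

variable {p : Pol N} {hp : Prime p}

lemma smul_mem_reg {k : K} (hk : k ∈ regAt K p hp) {f : ι → K} (hf : f ∈ reg ι K p hp) :
    k • f ∈ reg ι K p hp := (reg ι K p hp).smul_mem ⟨k, hk⟩ hf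

lemma csmul_mem_reg (c : ℂ) {f : ι → K} (hf : f ∈ reg ι K p hp) : c • f ∈ reg ι K p hp := by
  rw [← algebraMap_smul K c f]
  exact smul_mem_reg (const_mem_regAt c) hf

lemma P_mem_reg (g : D.W) {f : ι → K} (hf : f ∈ reg ι K p hp) : B.P K g f ∈ reg ι K p hp :=
  fun i => by
    rw [P_apply]
    refine sum_mem fun j _ => ?_
    rw [Algebra.smul_def]
    exact mul_mem (const_mem_regAt _) (hf j)

lemma dM_mem_reg (ξ : Fin N → ℂ) {f : ι → K} (hf : f ∈ reg ι K p hp) :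
    dM ι K ξ f ∈ reg ι K p hp := fun i => dK_mem_regAt ξ (hf i)

lemma cf_mem_regAt {β : D.Root} (hβ : ¬ p ∣ ell β) (ξ : Fin N → ℂ) : cf K ξ β ∈ regAt K p hp := by
  rw [cf, div_eq_mul_inv]
  exact mul_mem (const_mem_regAt _) (inv_mem_regAt hβ)

lemma nab_mem_reg (hβ : ∀ β : D.Root, ¬ p ∣ ell β) (ξ : Fin N → ℂ) {f : ι → K}
    (hf : f ∈ reg ι K p hp) : B.nab K ξ f ∈ reg ι K p hp := by
  rw [nab_apply]
  exact add_mem (dM_mem_reg ξ hf) (sum_mem fun β _ =>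
    smul_mem_reg (cf_mem_regAt (hβ β) ξ) (sub_mem hf (B.P_mem_reg _ hf)))

end

lemma cf_neg (ξ : Fin N → ℂ) (β : D.Root) : cf K ξ (-β) = cf K ξ β := by
  simp [cf, el, mul_neg_root, vec_neg, ell_neg, neg_div, div_neg]

/-- The singular part of the connection at a root hyperplane. -/
lemma nab_sub_mem_reg (α : D.Root) (ξ : Fin N → ℂ) {f : ι → K}
    (hf : f ∈ reg ι K _ (prime_ell α)) :
    B.nab K ξ f - (2 * cf K ξ α) • (f - B.P K (s α) f) ∈ reg ι K _ (prime_ell α) := by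
  classical
  rw [nab_apply, ← Finset.sum_add_sum_compl {α, -α}, Finset.sum_pair (neg_ne_self α).symm, cf_neg,
    s_neg, ← add_smul, ← two_mul, add_sub_assoc, add_sub_cancel_left]
  refine add_mem (dM_mem_reg ξ hf) (sum_mem fun β hβ => smul_mem_reg (cf_mem_regAt (fun h => ?_) ξ)
    (sub_mem hf (B.P_mem_reg _ hf)))
  have := ell_dvd_ell h
  simp at hβ
  tauto

lemma P_P_self (α : D.Root) (f : ι → K) : B.P K (s α) (B.P K (s α) f) = f := by
  rw [← P_mul, s_mul_self, P_one]

lemma sg_sg_self (α : D.Root) (f : ι → K) : B.sg K (s α) (B.sg K (s α) f) = f := by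
  rw [← sg_mul, s_mul_self, sg_one]

lemma dvd_act_s_sub (α : D.Root) (i : Fin N) : ell α ∣ act (s α) (X i) - X i := by
  rw [← lin_single, act_lin, mat_s_mulVec, ← map_sub, sub_sub_cancel_left, ← neg_smul, map_smul,
    MvPolynomial.smul_eq_C_mul]
  exact Dvd.intro_left _ rfl

lemma A_sub_mem_reg (α : D.Root) {f : ι → K} (hf : f ∈ reg ι K _ (prime_ell α)) :
    (el K α)⁻¹ • (A ι K (s α) f - f) ∈ reg ι K _ (prime_ell α) := fun i => by
  have := extAut_sub_div_mem_regAt (dvd_act_s_sub α) (hf i)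
  rwa [div_eq_inv_mul] at this

lemma sg_mem_reg (α : D.Root) {f : ι → K} (hf : f ∈ reg ι K _ (prime_ell α)) :
    B.sg K (s α) f ∈ reg ι K _ (prime_ell α) :=
  B.P_mem_reg _ fun i => extAut_mem_regAt (act (s α)) (by
    rw [act_ell, s_smul_self, ell_neg, neg_dvd]) (hf i)

lemma sg_el_smul (α : D.Root) (f : ι → K) :
    B.sg K (s α) (el K α • f) = - (el K α • B.sg K (s α) f) := by
  rw [sg_smul, extAut_el, s_smul_self, el, ell_neg, map_neg, neg_smul]
  rfl

variable (K) in
/-- Regular vectors with a given parity with respect to a reflection. -/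
def par (α : D.Root) (ε : ℂ) : Submodule ℂ (ι → K) where
  carrier := {f | f ∈ reg ι K _ (prime_ell α) ∧ B.sg K (s α) f = ε • f}
  add_mem' := fun ⟨h1, h2⟩ ⟨h3, h4⟩ => ⟨add_mem h1 h3, by rw [map_add, h2, h4, smul_add]⟩
  zero_mem' := ⟨zero_mem _, by simp⟩
  smul_mem' c f := fun ⟨h1, h2⟩ => ⟨csmul_mem_reg c h1, by rw [map_smul, h2, smul_comm]⟩

lemma smul_el_mem_par {α : D.Root} {ε : ℂ} {f : ι → K} (hf : f ∈ B.par K α ε) :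
    el K α • f ∈ B.par K α (-ε) :=
  ⟨smul_mem_reg (algebraMap_mem_regAt _) hf.1, by
    rw [sg_el_smul, hf.2, smul_comm, neg_smul]⟩

lemma P_eq_of_mem_par {α : D.Root} {ε : ℂ} {f : ι → K} (hf : f ∈ B.par K α ε) :
    ε • B.P K (s α) f = A ι K (s α) f := by
  rw [← P_csmul, ← hf.2, sg_apply, P_P_self]

/-- A lattice at a root hyperplane that is stable under the connection. -/
lemma exists_lattice (α : D.Root) : ∃ V : Submodule ℂ (ι → K),
    (∀ ξ, ∀ f ∈ V, B.nab K ξ f ∈ V) ∧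
    (∀ f ∈ reg ι K _ (prime_ell α), f ∈ V) ∧
    (∀ f ∈ V, el K α ^ (2 * mul α) • f ∈ reg ι K _ (prime_ell α)) ∧
    (∀ f ∈ V, (∀ ξ, B.nab K ξ f = 0) → B.sg K (s α) f = f → f ∈ reg ι K _ (prime_ell α)) := by
  let ξ₀ : Fin N → ℂ := (vec α ⬝ᵥ vec α)⁻¹ • vec α
  have hξ₀ : vec α ⬝ᵥ ξ₀ = 1 := by
    simp [ξ₀, vec_dot_ne_zero]
  have hsξ₀ : mat (s α) *ᵥ ξ₀ = (-1 : ℂ) • ξ₀ := by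
    rw [mat_s_mulVec, hξ₀]
    simp only [ξ₀]
    module
  have hel := el_ne_zero (K := K) α
  have hcf : 2 * cf K ξ₀ α = algebraMap ℂ K (mul α) * (el K α)⁻¹ := by
    rw [cf, hξ₀, ← map_ofNat (algebraMap ℂ K) 2, ← mul_div_assoc, ← map_mul, div_eq_mul_inv]
    congr 2
    ring
  have hdel : dK K ξ₀ (el K α) = 1 := by rw [el, ell, dK_lin, hξ₀, map_one]
  have hpar : ∀ (ε : ℂ) (f : ι → K), B.sg K (s α) f = ε • f →
      B.sg K (s α) (B.nab K ξ₀ f) = (-ε) • B.nab K ξ₀ f := fun ε f hf => by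
    rw [sg_nab, hsξ₀, nab_csmul, hf, map_smul, smul_smul, neg_one_mul]
  have hν : ∀ (ε : ℂ) (η : {η : Fin N → ℂ // vec α ⬝ᵥ η = 0}), ∀ f ∈ B.par K α ε,
      B.nab K η.1 f ∈ B.par K α ε := fun ε η f hf => by
    refine ⟨?_, ?_⟩
    · have := B.nab_sub_mem_reg α η.1 hf.1
      rwa [show cf K η.1 α = 0 by simp [cf, η.2], mul_zero, zero_smul, sub_zero] at this
    · rw [sg_nab, mat_s_mulVec, η.2, mul_zero, zero_div, zero_smul, sub_zero, hf.2, map_smul]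
  have hn : ∀ f : ι → K, B.nab K ξ₀ (el K α • f) = f + el K α • B.nab K ξ₀ f := fun f => by
    rw [nab_smul, hdel, one_smul]
  obtain ⟨P₀, Q₀, h1, h2, h3, h4, h5, h6, h7, h8, h9⟩ := exists_stable_lattice (M := ι → K) hel
    (n := B.nab K ξ₀) hn
    (ν := fun η : {η : Fin N → ℂ // vec α ⬝ᵥ η = 0} => B.nab K η.1) (fun η f => B.nab_comm _ _ f)
    (fun η f => by
      rw [nab_smul, el, ell, dK_lin, η.2, map_zero, zero_smul, zero_add])
    (mul α) (B.par K α 1) (B.par K α (-1)) (fun f hf => B.smul_el_mem_par hf)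
    (fun f hf => by simpa using B.smul_el_mem_par hf)
    (fun f hf => by
      refine ⟨?_, hpar 1 f hf.2⟩
      have := B.nab_sub_mem_reg α ξ₀ hf.1
      have hP := B.P_eq_of_mem_par hf
      rw [one_smul] at hP
      rw [hcf, mul_smul, hP] at this
      have h2 := smul_mem_reg (const_mem_regAt (mul α : ℂ)) (A_sub_mem_reg α hf.1)
      convert sub_mem this h2 using 1
      simp only [smul_sub]
      abel)
    (fun f hf => by
      have hP := B.P_eq_of_mem_par hf
      have hs : B.sg K (s α) f = (1 : ℂ) • f := by
        have := hf.2
        rw [sg_el_smul, neg_smul, one_smul, neg_inj] at this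
        rw [one_smul]
        exact smul_right_injective _ hel this
      refine ⟨?_, ?_⟩
      · have := B.nab_sub_mem_reg α ξ₀ hf.1
        rw [neg_smul, one_smul, neg_eq_iff_eq_neg] at hP
        rw [hcf, mul_smul, hP, hn] at this
        have h2 := smul_mem_reg (const_mem_regAt (mul α : ℂ)) (A_sub_mem_reg α hf.1)
        convert add_mem this h2 using 1
        have e1 : (el K α)⁻¹ • el K α • f = f := inv_smul_smul₀ hel f
        simp only [smul_sub, sub_neg_eq_add, smul_add, e1, sub_smul, one_smul, mul_smul,
          algebraMap_smul]
        generalize (el K α)⁻¹ • A ι K (s α) (el K α • f) = y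
        generalize el K α • B.nab K ξ₀ f = z
        module
      · rw [map_sub, sg_el_smul, map_smul, hpar 1 f hs, hs]
        simp)
    (hν 1) (hν (-1))
  have hev : ∀ (ε : ℂ) (f : ι → K), el K α ^ (2 * mul α) • f ∈ B.par K α ε →
      B.sg K (s α) f = ε • f := fun ε f hf => by
    have := hf.2
    rw [sg_smul, map_pow, extAut_el, s_smul_self, el, ell_neg, map_neg, Even.neg_pow (by simp),
      smul_comm ε] at this
    exact smul_right_injective _ (pow_ne_zero _ hel) this
  refine ⟨P₀ ⊔ Q₀, fun ξ f hf => ?_, fun f hf => ?_, fun f hf => ?_, fun f hf h hs => ?_⟩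
  · obtain ⟨p, hp, q, hq, rfl⟩ := Submodule.mem_sup.mp hf
    have hξ : ξ = (vec α ⬝ᵥ ξ) • ξ₀ + (ξ - (vec α ⬝ᵥ ξ) • ξ₀) := by abel
    have hη : vec α ⬝ᵥ (ξ - (vec α ⬝ᵥ ξ) • ξ₀) = 0 := by
      rw [dotProduct_sub, dotProduct_smul, hξ₀]; simp
    rw [hξ, nab_add, nab_csmul, map_add, map_add]
    refine add_mem (Submodule.smul_mem _ _ (add_mem ?_ ?_)) (add_mem ?_ ?_)
    · exact Submodule.mem_sup_right (h3 p hp)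
    · exact Submodule.mem_sup_left (h4 q hq)
    · exact Submodule.mem_sup_left (h5 ⟨_, hη⟩ p hp)
    · exact Submodule.mem_sup_right (h6 ⟨_, hη⟩ q hq)
  · have hsf := B.sg_mem_reg α hf
    have : f = (1 / 2 : ℂ) • (f + B.sg K (s α) f) + (1 / 2 : ℂ) • (f - B.sg K (s α) f) := by
      module
    rw [this]
    refine add_mem (Submodule.smul_mem _ _ (Submodule.mem_sup_left (h1 ⟨add_mem hf hsf, ?_⟩)))
      (Submodule.smul_mem _ _ (Submodule.mem_sup_right (h2 ⟨sub_mem hf hsf, ?_⟩)))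
    · rw [map_add, sg_sg_self, one_smul, add_comm]
    · rw [map_sub, sg_sg_self, neg_one_smul, neg_sub]
  · obtain ⟨p, hp, q, hq, rfl⟩ := Submodule.mem_sup.mp hf
    rw [smul_add]
    exact add_mem (h7 p hp).1 (h8 q hq).1
  · obtain ⟨p, hp, q, hq, rfl⟩ := Submodule.mem_sup.mp hf
    rw [map_add, hev 1 p (h7 p hp), hev (-1) q (h8 q hq), one_smul, add_right_inj, neg_one_smul] at hs
    have hq0 : q = 0 := by
      have : q = (1 / 2 : ℂ) • (q - -q) := by module
      rw [this, hs, sub_self, smul_zero]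
    rw [hq0, add_zero] at h ⊢
    exact (h9 p hp (h ξ₀)).1

end Catalan.RootDatum.DunklKernel

namespace Catalan

variable {N : ℕ}

/-- The Euler vector field. -/
def euler (F : Pol N) : Pol N := ∑ i, X i * pderiv i F

lemma coeff_euler (F : Pol N) (d : Fin N →₀ ℕ) :
    coeff d (euler F) = (d.degree : ℂ) * coeff d F := by
  classical
  rw [euler, coeff_sum]
  induction F using MvPolynomial.induction_on' with
  | monomial e a =>
    have : ∀ i, coeff d (X i * pderiv i (monomial e a)) = if e = d then a * e i else 0 := by
      intro i
      rw [pderiv_monomial, X, monomial_mul, coeff_monomial, one_mul]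
      by_cases hi : e i = 0
      · simp [hi]
      · rw [add_tsub_cancel_of_le (Finsupp.single_le_iff.mpr (Nat.one_le_iff_ne_zero.mpr hi))]
    simp only [this, coeff_monomial]
    split_ifs with h
    · subst h
      rw [← Finset.mul_sum, mul_comm, Finsupp.degree_eq_sum]
      simp
    · simp
  | add p q hp hq =>
    simp only [map_add, mul_add, coeff_add, Finset.sum_add_distrib, hp, hq]

lemma isHomogeneous_of_euler {F : Pol N} {n : ℕ} (h : euler F = (n : ℂ) • F) :
    F.IsHomogeneous n := by
  intro d hd
  have := coeff_euler F d
  rw [h, coeff_smul, smul_eq_mul] at this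
  have := mul_right_cancel₀ hd this
  rw [show (1 : Fin N → ℕ) = fun _ => 1 from rfl, ← Finsupp.degree_eq_weight_one]
  exact_mod_cast this.symm

lemma eq_zero_of_euler {F : Pol N} {n : ℕ} (hn : 0 < n) (h : euler F = (-n : ℂ) • F) : F = 0 := by
  ext d
  by_contra hd
  have := coeff_euler F d
  rw [h, coeff_smul, smul_eq_mul] at this
  have := mul_right_cancel₀ hd this
  have h2 : ((d.degree + n : ℕ) : ℂ) = 0 := by push_cast; rw [← this]; ring
  have := Nat.cast_eq_zero.mp h2
  omega

lemma IsHomogeneous.euler {F : Pol N} {n : ℕ} (h : F.IsHomogeneous n) :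
    euler F = (n : ℂ) • F := by
  ext d
  rw [coeff_euler, coeff_smul, smul_eq_mul]
  by_cases hd : coeff d F = 0
  · simp [hd]
  · rw [← h hd, Finsupp.degree_eq_weight_one]
    rfl

section

set_option linter.unusedSectionVars false

variable {K : Type*} [Field K] [Algebra (Pol N) K] [IsFractionRing (Pol N) K] [Algebra ℂ K]
  [IsScalarTower ℂ (Pol N) K]

/-- A rational function that is regular at every prime is a polynomial. -/
lemma mem_range_of_regAt {k : K} (h : ∀ (p : Pol N) (hp : Prime p), k ∈ regAt K p hp) :
    ∃ c, k = algebraMap (Pol N) K c := by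
  obtain ⟨a, b, hb, rfl⟩ := IsFractionRing.div_surjective (A := Pol N) k
  have hb := nonZeroDivisors.ne_zero hb
  have key : ∀ b : Pol N, b ≠ 0 → ∀ k : K, (∀ (p : Pol N) (hp : Prime p), k ∈ regAt K p hp) → ∀ a,
      algebraMap (Pol N) K b * k = algebraMap (Pol N) K a →
      ∃ c, k = algebraMap (Pol N) K c := by
    intro b
    induction b using UniqueFactorizationMonoid.induction_on_prime with
    | h₁ => exact fun h => absurd rfl h
    | h₂ b hb =>
      obtain ⟨u, rfl⟩ := hb
      intro _ k _ a hk
      refine ⟨↑u⁻¹ * a, ?_⟩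
      rw [map_mul, ← hk, ← mul_assoc, ← map_mul, Units.inv_mul, map_one, one_mul]
    | h₃ b p hb hp ih =>
      intro _ k hk a ha
      rw [map_mul, mul_assoc] at ha
      obtain ⟨c, hc⟩ := mem_range_of_prime_mul (K := K) (hp := hp)
        (mul_mem (algebraMap_mem_regAt b) (hk p hp)) ha
      exact ih hb k hk c hc
  refine key b hb _ h a ?_
  rw [mul_div_cancel₀ _ (algebraMap_ne_zero hb)]

lemma regAt_of_dvd {p q : Pol N} {hp : Prime p} {hq : Prime q} (h : q ∣ p) {k : K}
    (hk : k ∈ regAt K p hp) : k ∈ regAt K q hq := by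
  obtain ⟨a, b, hb, h1⟩ := hk
  exact ⟨a, b, fun h2 => hb (((hq.dvd_prime_iff_associated hp).mp h).symm.dvd.trans h2), h1⟩

lemma sum_X_dK (k : Pol N) : ∑ i, algebraMap (Pol N) K (X i) *
    dK K (Pi.single i 1) (algebraMap (Pol N) K k) = algebraMap (Pol N) K (euler k) := by
  classical
  rw [euler, map_sum]
  refine Finset.sum_congr rfl fun i _ => ?_
  rw [dK_algebraMap, map_mul, Fintype.sum_eq_single i (fun j hj => by simp [hj]),
    Pi.single_eq_same, one_smul]

end

namespace RootDatum.DunklKernel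

open Matrix

variable {D : RootDatum N} {ι : Type*} [Fintype ι] [DecidableEq ι] (B : D.DunklKernel ι)

set_option linter.unusedSectionVars false

variable (K : Type*) [Field K] [Algebra (Pol N) K] [IsFractionRing (Pol N) K] [Algebra ℂ K]
  [IsScalarTower ℂ (Pol N) K]

/-- Iterated covariant derivatives of constant vectors. -/
def jets : ℕ → Submodule ℂ (ι → K)
  | 0 => Submodule.span ℂ (Set.range fun i : ι => Pi.single i 1)
  | r + 1 => ⨆ ξ, (jets r).map (B.nab K ξ)

variable {K}

lemma nab_mem_jets {r : ℕ} {u : ι → K} (hu : u ∈ B.jets K r) (ξ : Fin N → ℂ) :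
    B.nab K ξ u ∈ B.jets K (r + 1) :=
  Submodule.mem_iSup_of_mem ξ (Submodule.mem_map_of_mem hu)

lemma jets_induction (p : ℕ → (ι → K) → Prop) (h0 : ∀ i, p 0 (Pi.single i 1))
    (hadd : ∀ r u v, p r u → p r v → p r (u + v)) (hzero : ∀ r, p r 0)
    (hsmul : ∀ r (c : ℂ) u, p r u → p r (c • u))
    (hnab : ∀ r ξ, ∀ u ∈ B.jets K r, p r u → p (r + 1) (B.nab K ξ u)) :
    ∀ r, ∀ u ∈ B.jets K r, p r u := by
  intro r
  induction r with
  | zero =>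
    intro u hu
    refine Submodule.span_induction ?_ (hzero 0) (fun x y _ _ => hadd 0 x y)
      (fun c x _ => hsmul 0 c x) hu
    rintro _ ⟨i, rfl⟩
    exact h0 i
  | succ r ih =>
    intro u hu
    refine Submodule.iSup_induction _ (motive := p (r + 1)) hu ?_ (hzero _) (hadd _)
    rintro ξ _ ⟨u, hu, rfl⟩
    exact hnab r ξ u hu (ih u hu)

lemma jets_le (V : Submodule ℂ (ι → K)) (h0 : ∀ i, Pi.single i 1 ∈ V)
    (h : ∀ ξ, ∀ f ∈ V, B.nab K ξ f ∈ V) (r : ℕ) : B.jets K r ≤ V :=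
  B.jets_induction (fun _ u => u ∈ V) h0 (fun _ _ _ => add_mem) (fun _ => zero_mem _)
    (fun _ c _ => V.smul_mem c) (fun _ ξ u _ hu => h ξ u hu) r

lemma single_mem_reg {p : Pol N} {hp : Prime p} (i : ι) : (Pi.single i 1 : ι → K) ∈ reg ι K p hp :=
  fun j => by
    by_cases h : j = i
    · subst h; simp
    · simp [h]

lemma jets_mem_reg {p : Pol N} {hp : Prime p} (hβ : ∀ β : D.Root, ¬ p ∣ ell β) {r : ℕ} {u : ι → K}
    (hu : u ∈ B.jets K r) : u ∈ reg ι K p hp :=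
  B.jets_induction (fun _ u => u ∈ reg ι K p hp) single_mem_reg (fun _ _ _ => add_mem)
    (fun _ => zero_mem _) (fun _ c _ => csmul_mem_reg c)
    (fun _ ξ _ _ hu => nab_mem_reg B hβ ξ hu) r u hu

lemma sg_single (g : D.W) (i : ι) : B.sg K g (Pi.single i 1) ∈ B.jets K 0 := by
  have : B.sg K g (Pi.single i 1) = ∑ j, B.ρ g j i • (Pi.single j 1 : ι → K) := by
    funext k
    rw [sg_apply, P_apply, Finset.sum_apply, Finset.sum_eq_single i]
    · rw [Finset.sum_eq_single k]
      · simp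
      · intro j _ hj; simp [hj.symm]
      · simp
    · intro j _ hj; simp [hj]
    · simp
  rw [this]
  exact sum_mem fun j _ => Submodule.smul_mem _ _ (Submodule.subset_span ⟨j, rfl⟩)

lemma sg_mem_jets (g : D.W) {r : ℕ} {u : ι → K} (hu : u ∈ B.jets K r) :
    B.sg K g u ∈ B.jets K r :=
  B.jets_induction (fun r u => B.sg K g u ∈ B.jets K r) (B.sg_single g)
    (fun _ _ _ h1 h2 => by rw [map_add]; exact add_mem h1 h2)
    (fun _ => by rw [map_zero]; exact zero_mem _)
    (fun _ c _ h => by rw [map_smul]; exact Submodule.smul_mem _ _ h)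
    (fun _ ξ _ _ h => by rw [sg_nab]; exact B.nab_mem_jets h _) r u hu

lemma dM_single (ξ : Fin N → ℂ) (i : ι) : dM ι K ξ (Pi.single i 1) = 0 := by
  funext j
  by_cases h : j = i
  · subst h; simp
  · simp [h]

lemma sum_X_nab_jets {r : ℕ} {u : ι → K} (hu : u ∈ B.jets K r) :
    ∑ i, algebraMap (Pol N) K (X i) • B.nab K (Pi.single i 1) u = (B.deg - r : ℂ) • u :=
  B.jets_induction (fun r u => ∑ i, algebraMap (Pol N) K (X i) • B.nab K (Pi.single i 1) u =
      (B.deg - r : ℂ) • u)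
    (fun i => by rw [sum_X_nab]; simp [dM_single])
    (fun _ _ _ h1 h2 => by
      simp only [map_add, smul_add, Finset.sum_add_distrib] at *
      rw [h1, h2])
    (fun _ => by simp)
    (fun _ c u h => by
      simp only [map_smul]
      rw [smul_comm, ← h, Finset.smul_sum]
      simp only [smul_comm c])
    (fun r ξ u _ h => by
      rw [sum_X_nab_nab, h, map_smul]
      push_cast
      generalize B.nab K ξ u = y
      module) r u hu

lemma Psi_jets {r : ℕ} {u : ι → K} (hu : u ∈ B.jets K r) : ∃ F : Fin N → Pol N,
    (∀ n, (F n).IsHomogeneous (B.deg - r)) ∧ ∀ n, B.Psi K u n = algebraMap (Pol N) K (F n) :=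
  B.jets_induction (fun r u => ∃ F : Fin N → Pol N,
    (∀ n, (F n).IsHomogeneous (B.deg - r)) ∧ ∀ n, B.Psi K u n = algebraMap (Pol N) K (F n))
    (fun i => ⟨B.b i, B.hom i, fun n => by
      rw [Psi_apply, Finset.sum_eq_single i] <;> simp +contextual⟩)
    (fun r u v ⟨F, h1, h2⟩ ⟨G, h3, h4⟩ => ⟨F + G, fun n => (h1 n).add (h3 n), fun n => by
      rw [map_add, Pi.add_apply, h2, h4, Pi.add_apply, map_add]⟩)
    (fun r => ⟨0, fun n => isHomogeneous_zero _ _ _, fun n => by simp⟩)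
    (fun r c u ⟨F, h1, h2⟩ => ⟨fun n => c • F n, fun n => by
      exact (homogeneousSubmodule _ _ _).smul_mem c (h1 n), fun n => by
      rw [Psi_csmul, Pi.smul_apply, h2, algebraMap_csmul, Algebra.smul_def]⟩)
    (fun r ξ u _ ⟨F, h1, h2⟩ => ⟨fun n => ∑ i, ξ i • pderiv i (F n), fun n =>
      IsHomogeneous.sum _ _ _ fun i _ => by
        rw [smul_eq_C_mul, ← Nat.sub_sub]; exact ((h1 n).pderiv).C_mul _, fun n => by
      rw [Psi_nab, h2, dK_algebraMap]⟩) r u hu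

end RootDatum.DunklKernel

end Catalan

namespace Catalan.RootDatum.DunklKernel

open Matrix

variable {N : ℕ} {D : RootDatum N} {ι : Type*} [Fintype ι] [DecidableEq ι] (B : D.DunklKernel ι)

set_option linter.unusedSectionVars false

variable {K : Type*} [Field K] [Algebra (Pol N) K] [IsFractionRing (Pol N) K] [Algebra ℂ K]
  [IsScalarTower ℂ (Pol N) K]

lemma sum_X_dM_smul (q : Pol N) (f : ι → K) :
    ∑ i, algebraMap (Pol N) K (X i) • dM ι K (Pi.single i 1) (algebraMap (Pol N) K q • f) =
      algebraMap (Pol N) K (euler q) • f + algebraMap (Pol N) K q •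
        ∑ i, algebraMap (Pol N) K (X i) • dM ι K (Pi.single i 1) f := by
  simp only [dM_smul, smul_add, Finset.sum_add_distrib, Finset.smul_sum, ← sum_X_dK,
    Finset.sum_smul, mul_smul]
  congr 1
  exact Finset.sum_congr rfl fun i _ => smul_comm _ _ _

lemma sum_X_dM_algebraMap (q : ι → Pol N) :
    ∑ i, algebraMap (Pol N) K (X i) • dM ι K (Pi.single i 1) (fun j => algebraMap (Pol N) K (q j)) =
      fun j => algebraMap (Pol N) K (euler (q j)) := by
  funext j
  simp only [Finset.sum_apply, Pi.smul_apply, dM_apply, smul_eq_mul, sum_X_dK]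

variable (K) in
lemma jets_eq_bot_of_lt (r : ℕ) (hr : ∑ β : D.Root, 2 * mul β < r) : B.jets K r = ⊥ := by
  classical
  rw [eq_bot_iff]
  intro u hu
  rw [Submodule.mem_bot]
  set q : Pol N := ∏ β : D.Root, ell β ^ (2 * mul β) with hq
  have hq0 : q ≠ 0 := Finset.prod_ne_zero_iff.mpr fun β _ => pow_ne_zero _ (prime_ell β).ne_zero
  have hqh : q.IsHomogeneous (∑ β : D.Root, 2 * mul β) :=
    IsHomogeneous.prod _ _ _ fun β _ => by
      simpa [ell] using (lin_isHomogeneous (vec β)).pow (2 * mul β)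
  have hreg : ∀ (p : Pol N) (hp : Prime p), algebraMap (Pol N) K q • u ∈ reg ι K p hp := by
    intro p hp
    by_cases h : ∀ β : D.Root, ¬ p ∣ ell β
    · exact smul_mem_reg (algebraMap_mem_regAt _) (B.jets_mem_reg h hu)
    · push Not at h
      obtain ⟨β, hβ⟩ := h
      obtain ⟨V, h1, h2, h3, -⟩ := B.exists_lattice (K := K) β
      have huV := B.jets_le V (fun i => h2 _ (single_mem_reg i)) h1 r hu
      have := h3 u huV
      intro i
      refine regAt_of_dvd (hp := prime_ell β) hβ ?_
      revert i
      change _ ∈ reg ι K _ (prime_ell β)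
      rw [hq, ← Finset.mul_prod_erase _ _ (Finset.mem_univ β), mul_comm, map_mul, mul_smul, map_pow]
      exact smul_mem_reg (algebraMap_mem_regAt _) this
  choose F hF using fun i => mem_range_of_regAt fun p hp => hreg p hp i
  have hF' : algebraMap (Pol N) K q • u = fun i => algebraMap (Pol N) K (F i) := funext hF
  have hE : ∑ i, algebraMap (Pol N) K (X i) • dM ι K (Pi.single i 1) u = (-r : ℂ) • u := by
    have h1 := B.sum_X_nab u
    rw [B.sum_X_nab_jets hu] at h1
    rw [← sub_eq_iff_eq_add] at h1
    rw [← h1]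
    module
  have h2 := sum_X_dM_smul q u
  rw [hE, hF', sum_X_dM_algebraMap, IsHomogeneous.euler hqh, algebraMap_csmul] at h2
  have h3 : ∀ i, F i = 0 := fun i => by
    refine eq_zero_of_euler (n := r - ∑ β : D.Root, 2 * mul β) (by omega) ?_
    apply IsFractionRing.injective (Pol N) K
    have h4 := congrFun h2 i
    have h5 := hF i
    simp only [Pi.smul_apply, Pi.add_apply, smul_eq_mul] at h4 h5
    rw [h4, algebraMap_csmul, ← h5, Nat.cast_sub hr.le, Algebra.smul_def (-(r : ℂ))]
    simp only [map_neg, map_sub, map_natCast]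
    ring
  have h4 : algebraMap (Pol N) K q • u = 0 := by
    rw [hF']
    funext i
    simp [h3]
  exact (smul_eq_zero.mp h4).resolve_left (algebraMap_ne_zero hq0)

variable (K) in
lemma jets_eq_bot {r : ℕ} (hr : B.deg < r) : B.jets K r = ⊥ := by
  obtain ⟨k, hk⟩ : ∃ k, ∑ β : D.Root, 2 * mul β < r + k := ⟨_, by
    rw [add_comm]; exact Nat.lt_add_of_pos_right (by omega)⟩
  induction k generalizing r with
  | zero => exact B.jets_eq_bot_of_lt K r hk
  | succ k ih =>
    rw [eq_bot_iff]
    intro u hu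
    have h := ih (r := r + 1) (by omega) (by omega)
    have h1 := B.sum_X_nab_jets hu
    have h2 : ∀ ξ, B.nab K ξ u = 0 := fun ξ => by
      have := B.nab_mem_jets hu ξ
      rwa [h] at this
    simp only [h2, smul_zero, Finset.sum_const_zero] at h1
    refine (smul_eq_zero.mp h1.symm).resolve_left ?_
    exact sub_ne_zero.mpr (by exact_mod_cast hr.ne)

variable (K) in
lemma exists_Psi_ne_zero {r : ℕ} (hr : r ≤ B.deg) : ∃ u ∈ B.jets K r, B.Psi K u ≠ 0 := by
  induction r with
  | zero =>
    obtain ⟨i, hi⟩ := B.ne_zero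
    refine ⟨Pi.single i 1, Submodule.subset_span ⟨i, rfl⟩, fun h => hi ?_⟩
    funext n
    have := congrFun h n
    rw [Psi_apply, Finset.sum_eq_single i (by simp +contextual) (by simp)] at this
    simpa using this
  | succ r ih =>
    obtain ⟨u, hu, hu0⟩ := ih (by omega)
    by_contra! h
    have h1 := congrArg (B.Psi K) (B.sum_X_nab_jets hu)
    rw [map_sum, Psi_csmul] at h1
    simp only [map_smul, h _ (B.nab_mem_jets hu _), smul_zero, Finset.sum_const_zero] at h1
    refine hu0 ((smul_eq_zero.mp h1.symm).resolve_left ?_)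
    exact sub_ne_zero.mpr (by exact_mod_cast (by omega : B.deg ≠ r))

variable (K) in
lemma exists_jets_Psi_eq (v : Fin N → ℂ) :
    ∃ u ∈ B.jets K B.deg, ∀ n, B.Psi K u n = algebraMap ℂ K (v n) := by
  let Z : Submodule ℂ (Fin N → ℂ) :=
    { carrier := {v | ∃ u ∈ B.jets K B.deg, ∀ n, B.Psi K u n = algebraMap ℂ K (v n)}
      add_mem' := by
        rintro v w ⟨u, hu, h1⟩ ⟨u', hu', h2⟩
        exact ⟨u + u', add_mem hu hu', fun n => by
          rw [map_add, Pi.add_apply, h1, h2, Pi.add_apply, map_add]⟩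
      zero_mem' := ⟨0, zero_mem _, fun n => by simp⟩
      smul_mem' := by
        rintro c v ⟨u, hu, h1⟩
        exact ⟨c • u, Submodule.smul_mem _ _ hu, fun n => by
          rw [Psi_csmul, Pi.smul_apply, h1, Pi.smul_apply, smul_eq_mul, map_mul,
            Algebra.smul_def]⟩ }
  have hZ : Z = ⊤ := by
    refine irr_complex (D := D) Z ?_ ?_
    · rintro β v ⟨u, hu, h1⟩
      refine ⟨B.sg K (s β) u, B.sg_mem_jets _ hu, fun n => ?_⟩
      rw [Psi_sg]
      simp only [h1, AlgEquiv.commutes, mulVec, dotProduct, map_sum, map_mul, Algebra.smul_def]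
    · obtain ⟨u, hu, h0⟩ := B.exists_Psi_ne_zero K le_rfl
      obtain ⟨F, hF, h1⟩ := B.Psi_jets hu
      rw [Nat.sub_self] at hF
      have h2 : ∀ n, F n = C (coeff 0 (F n)) := fun n =>
        totalDegree_eq_zero_iff_eq_C.mp (Nat.le_zero.mp (hF n).totalDegree_le)
      have h3 : ∀ n, B.Psi K u n = algebraMap ℂ K (coeff 0 (F n)) := fun n => by
        rw [h1, IsScalarTower.algebraMap_apply ℂ (Pol N) K, algebraMap_eq, ← h2]
      rw [Submodule.ne_bot_iff]
      refine ⟨fun n => coeff 0 (F n), ⟨u, hu, h3⟩, fun h => h0 ?_⟩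
      funext n
      rw [h3, congrFun h n, Pi.zero_apply, map_zero, Pi.zero_apply]
  have : v ∈ Z := hZ ▸ Submodule.mem_top
  exact this

variable (K) in
lemma exists_section : ∃ j : (Fin N → ℂ) →ₗ[ℂ] (ι → K), (∀ v, j v ∈ B.jets K B.deg) ∧
    (∀ v n, B.Psi K (j v) n = algebraMap ℂ K (v n)) ∧
    (∀ v g, B.sg K g (j v) = j (mat g *ᵥ v)) := by
  choose j₀ h1 h2 using fun n => B.exists_jets_Psi_eq K (Pi.single n 1)
  let j₁ : (Fin N → ℂ) →ₗ[ℂ] (ι → K) := Fintype.linearCombination ℂ j₀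
  have h3 : ∀ v, j₁ v ∈ B.jets K B.deg := fun v => by
    rw [Fintype.linearCombination_apply]
    exact sum_mem fun n _ => Submodule.smul_mem _ _ (h1 n)
  have h4 : ∀ v n, B.Psi K (j₁ v) n = algebraMap ℂ K (v n) := fun v n => by
    simp only [j₁, Fintype.linearCombination_apply, map_sum, Psi_csmul, Finset.sum_apply,
      Pi.smul_apply, h2]
    rw [Fintype.sum_eq_single n (fun i hi => by simp [hi.symm]), Pi.single_eq_same, map_one,
      Algebra.algebraMap_eq_smul_one]
  have hcard : (Fintype.card D.W : ℂ) ≠ 0 := Nat.cast_ne_zero.mpr Fintype.card_ne_zero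
  refine ⟨(Fintype.card D.W : ℂ)⁻¹ • ∑ g : D.W, B.sg K g ∘ₗ j₁ ∘ₗ (mat g⁻¹).mulVecLin,
    fun v => ?_, fun v n => ?_, fun v h => ?_⟩
  · simp only [LinearMap.smul_apply, LinearMap.sum_apply, LinearMap.comp_apply]
    exact Submodule.smul_mem _ _ (sum_mem fun g _ => B.sg_mem_jets g (h3 _))
  · simp only [LinearMap.smul_apply, LinearMap.sum_apply, LinearMap.comp_apply, Psi_csmul, map_sum,
      Pi.smul_apply, Finset.sum_apply, Psi_sg, h4, AlgEquiv.commutes, mulVecLin_apply]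
    have : ∀ g : D.W, ∑ j, mat g n j • algebraMap ℂ K ((mat g⁻¹ *ᵥ v) j) =
        algebraMap ℂ K (v n) := fun g => by
      simp only [Algebra.smul_def, ← map_mul, ← map_sum]
      congr 1
      change (mat g *ᵥ (mat g⁻¹ *ᵥ v)) n = v n
      rw [mulVec_mulVec, ← mat_mul, mul_inv_cancel, mat_one, one_mulVec]
    simp only [this, Finset.sum_const, Finset.card_univ, ← Nat.cast_smul_eq_nsmul ℂ, smul_smul,
      inv_mul_cancel₀ hcard, one_smul]
  · simp only [LinearMap.smul_apply, LinearMap.sum_apply, LinearMap.comp_apply, map_smul, map_sum,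
      mulVecLin_apply, ← sg_mul]
    congr 1
    refine Fintype.sum_equiv (Equiv.mulLeft h) _ _ fun g => ?_
    rw [Equiv.coe_mulLeft, mulVec_mulVec, ← mat_mul, _root_.mul_inv_rev, inv_mul_cancel_right]

variable (K) in
/-- A section of `Psi` with polynomial values on logarithmic vector fields. -/
lemma exists_coord : ∃ J : (Fin N → K) →ₗ[K] (ι → K),
    (∀ f, B.Psi K (J f) = f) ∧
    (∀ F : Fin N → Pol N, (∀ β : D.Root, ell β ^ (2 * mul β) ∣ contr (vec β) F) →
      ∃ q : ι → Pol N, J (fun n => algebraMap (Pol N) K (F n)) =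
        fun i => algebraMap (Pol N) K (q i)) ∧
    (∀ F : Fin N → Pol N, (∀ n, (F n).IsHomogeneous B.deg) →
      ∑ i, algebraMap (Pol N) K (X i) • dM ι K (Pi.single i 1)
        (J (fun n => algebraMap (Pol N) K (F n))) = 0) := by
  obtain ⟨j, h1, h2, h3⟩ := B.exists_section K
  have hflat : ∀ v ξ, B.nab K ξ (j v) = 0 := fun v ξ => by
    have := B.nab_mem_jets (h1 v) ξ
    rwa [B.jets_eq_bot K (Nat.lt_succ_self _)] at this
  refine ⟨Fintype.linearCombination K fun n => j (Pi.single n 1), fun f => ?_, fun F hF => ?_,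
    fun F hF => ?_⟩
  · funext n
    simp only [Fintype.linearCombination_apply, map_sum, map_smul, Finset.sum_apply,
      Pi.smul_apply, h2]
    rw [Fintype.sum_eq_single n (fun i hi => by simp [hi.symm]), Pi.single_eq_same, map_one,
      smul_eq_mul, mul_one]
  · suffices h : ∀ (p : Pol N) (hp : Prime p), Fintype.linearCombination K
        (fun n => j (Pi.single n 1)) (fun n => algebraMap (Pol N) K (F n)) ∈ reg ι K p hp by
      choose q hq using fun i => mem_range_of_regAt fun p hp => h p hp i
      exact ⟨q, funext hq⟩
    intro p hp
    by_cases h : ∀ β : D.Root, ¬ p ∣ ell β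
    · rw [Fintype.linearCombination_apply]
      exact sum_mem fun n _ => smul_mem_reg (algebraMap_mem_regAt _) (B.jets_mem_reg h (h1 _))
    push Not at h
    obtain ⟨β, hβ⟩ := h
    intro i
    refine regAt_of_dvd (hp := prime_ell β) hβ ?_
    revert i
    change _ ∈ reg ι K _ (prime_ell β)
    obtain ⟨V, h4, h5, h6, h7⟩ := B.exists_lattice (K := K) β
    have hV := fun v => B.jets_le V (fun i => h5 _ (single_mem_reg i)) h4 _ (h1 v)
    let v : Fin N → Fin N → ℂ := fun n => Pi.single n 1 - (vec β n / (vec β ⬝ᵥ vec β)) • vec β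
    have hv : ∀ n, vec β ⬝ᵥ v n = 0 := fun n => by
      simp [v, dotProduct_sub, dotProduct_smul, vec_dot_ne_zero]
    have e1 : ∀ n, j (Pi.single n 1) = j (v n) + (vec β n / (vec β ⬝ᵥ vec β)) • j (vec β) :=
      fun n => by simp [v]
    obtain ⟨q, hq⟩ := hF β
    have e2 : ∑ n, algebraMap (Pol N) K (F n) • (vec β n / (vec β ⬝ᵥ vec β)) • j (vec β) =
        (vec β ⬝ᵥ vec β)⁻¹ • algebraMap (Pol N) K q • el K β ^ (2 * mul β) • j (vec β) := by
      have e3 : algebraMap (Pol N) K q * el K β ^ (2 * mul β) =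
          ∑ n, vec β n • algebraMap (Pol N) K (F n) := by
        rw [el, ← map_pow, ← map_mul, mul_comm, ← hq, contr, map_sum]
        simp only [algebraMap_csmul]
        simp only [Algebra.smul_def]
      rw [← mul_smul (algebraMap (Pol N) K q), e3, Finset.sum_smul, Finset.smul_sum]
      refine Finset.sum_congr rfl fun n _ => ?_
      rw [smul_assoc, smul_smul, smul_comm, div_eq_inv_mul]
    rw [Fintype.linearCombination_apply]
    simp only [e1, smul_add, Finset.sum_add_distrib, e2]
    refine add_mem (sum_mem fun n _ => smul_mem_reg (algebraMap_mem_regAt _) ?_)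
      (csmul_mem_reg _ (smul_mem_reg (algebraMap_mem_regAt _) (h6 _ (hV _))))
    refine h7 _ (hV _) (hflat _) ?_
    rw [h3, mat_s_mulVec, hv]
    simp
  · have h4 : ∀ v, ∑ i, algebraMap (Pol N) K (X i) • dM ι K (Pi.single i 1) (j v) =
        (-B.deg : ℂ) • j v := fun v => by
      have := B.sum_X_nab (j v)
      simp only [hflat, smul_zero, Finset.sum_const_zero] at this
      rw [neg_smul, eq_neg_iff_add_eq_zero, ← this]
    rw [Fintype.linearCombination_apply]
    simp only [map_sum, Finset.smul_sum]
    rw [Finset.sum_comm]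
    refine Finset.sum_eq_zero fun n _ => ?_
    rw [sum_X_dM_smul, h4, IsHomogeneous.euler (hF n), algebraMap_csmul]
    generalize j (Pi.single n 1) = y
    rw [smul_comm _ (-B.deg : ℂ), mul_smul, algebraMap_smul]
    module

/-- The vector fields of a Dunkl kernel generate the module of logarithmic vector fields. -/
theorem exists_eq_sum (F : Fin N → Pol N)
    (hF : ∀ β : D.Root, ell β ^ (2 * mul β) ∣ contr (vec β) F) :
    ∃ q : ι → Pol N, ∀ n, F n = ∑ i, q i * B.b i n := by
  obtain ⟨J, h1, h2, -⟩ := B.exists_coord (FractionRing (Pol N))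
  obtain ⟨q, hq⟩ := h2 F hF
  refine ⟨q, fun n => ?_⟩
  apply IsFractionRing.injective (Pol N) (FractionRing (Pol N))
  have := congrFun (h1 fun n => algebraMap (Pol N) _ (F n)) n
  rw [hq, Psi_apply] at this
  rw [← this, map_sum]
  simp only [map_mul]

/-- The vector fields of a Dunkl kernel are independent over the polynomial ring. -/
theorem eq_zero_of_sum_eq_zero (q : ι → Pol N) (hq : ∀ n, ∑ i, q i * B.b i n = 0) (i : ι) :
    q i = 0 := by
  let K := FractionRing (Pol N)
  obtain ⟨J, h1, h2, h3⟩ := B.exists_coord K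
  have hJ : ∀ i, J (fun n => algebraMap (Pol N) K (B.b i n)) = Pi.single i 1 := fun i => by
    obtain ⟨c, hc⟩ := h2 (B.b i) (B.mem i)
    have h4 := h3 (B.b i) (B.hom i)
    rw [hc, sum_X_dM_algebraMap] at h4
    have h5 : ∀ k, c k = C (coeff 0 (c k)) := fun k => by
      refine totalDegree_eq_zero_iff_eq_C.mp (Nat.le_zero.mp
        (isHomogeneous_of_euler (n := 0) ?_).totalDegree_le)
      rw [Nat.cast_zero, zero_smul]
      apply IsFractionRing.injective (Pol N) K
      rw [map_zero]
      exact congrFun h4 k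
    have h6 : B.b i = ∑ k, coeff 0 (c k) • B.b k := by
      funext n
      apply IsFractionRing.injective (Pol N) K
      have := congrFun (h1 fun n => algebraMap (Pol N) _ (B.b i n)) n
      rw [hc, Psi_apply] at this
      rw [← this, Finset.sum_apply, map_sum]
      refine Finset.sum_congr rfl fun k _ => ?_
      rw [Pi.smul_apply, smul_eq_C_mul, ← h5, map_mul]
    have h7 := Fintype.linearIndependent_iff.mp B.indep
      (fun k => coeff 0 (c k) - Pi.single (M := fun _ => ℂ) i 1 k) (by
        simp only [sub_smul, Finset.sum_sub_distrib, ← h6]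
        rw [Fintype.sum_eq_single i (fun k hk => by simp [hk])]
        simp)
    rw [hc]
    funext k
    rw [h5 k, sub_eq_zero.mp (h7 k)]
    by_cases hk : k = i
    · subst hk; simp
    · simp [hk]
  have h4 : (0 : Fin N → K) = ∑ k, algebraMap (Pol N) K (q k) •
      fun n => algebraMap (Pol N) K (B.b k n) := by
    funext n
    have := congrArg (algebraMap (Pol N) K) (hq n)
    rw [map_zero, map_sum] at this
    rw [Pi.zero_apply, ← this, Finset.sum_apply]
    simp
  have h5 := congrFun (congrArg J h4) i
  simp only [map_sum, map_smul, hJ, map_zero, Finset.sum_apply, Pi.smul_apply] at h5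
  rw [Fintype.sum_eq_single i (fun k hk => by simp [hk.symm]), Pi.single_eq_same, smul_eq_mul,
    mul_one, Pi.zero_apply] at h5
  exact IsFractionRing.injective (Pol N) K (by rw [← h5, map_zero])

end Catalan.RootDatum.DunklKernel

namespace Catalan

open Matrix

variable {N : ℕ}

namespace RootDatum

variable {D : RootDatum N}

/-- The Cartan integer `2 (β, γ) / (γ, γ)`. -/
def cart (β γ : D.Root) : ℤ := (D.crys β.1 β.2 γ.1 γ.2).choose

lemma cart_spec (β γ : D.Root) : 2 * (β.1 ⬝ᵥ γ.1) / (γ.1 ⬝ᵥ γ.1) = (cart β γ : ℝ) :=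
  (D.crys β.1 β.2 γ.1 γ.2).choose_spec

lemma cart_mul (β γ : D.Root) : 2 * (β.1 ⬝ᵥ γ.1) = cart β γ * (γ.1 ⬝ᵥ γ.1) := by
  rw [← cart_spec, div_mul_cancel₀ _ (root_dot_pos γ).ne']

lemma cart_complex (β γ : D.Root) :
    2 * (vec γ ⬝ᵥ vec β) / (vec γ ⬝ᵥ vec γ) = (cart β γ : ℂ) := by
  have h := congrArg (fun x : ℝ => (x : ℂ)) (cart_spec β γ)
  simp only [vec, cplx_dot]
  rw [dotProduct_comm]
  exact_mod_cast h

lemma s_smul_cart (β γ : D.Root) : (s γ • β).1 = β.1 - (cart β γ : ℝ) • γ.1 := by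
  rw [s_smul_val, ← cart_spec, dotProduct_comm β.1 γ.1]

lemma cart_neg_left (β γ : D.Root) : cart (-β) γ = -cart β γ := by
  have : ((cart (-β) γ : ℤ) : ℝ) = ((-cart β γ : ℤ) : ℝ) := by
    push_cast
    rw [← cart_spec, ← cart_spec, neg_val, neg_dotProduct, mul_neg, neg_div]
  exact_mod_cast this

lemma norm_s_smul (β γ : D.Root) : (s γ • β).1 ⬝ᵥ (s γ • β).1 = β.1 ⬝ᵥ β.1 := by
  rw [s_smul_cart]
  simp only [dotProduct_sub, sub_dotProduct, dotProduct_smul, smul_dotProduct, smul_eq_mul]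
  rw [dotProduct_comm γ.1 β.1]
  linear_combination (-(cart β γ : ℝ)) * cart_mul β γ

variable (D) in
/-- A linear functional vanishing on no root. -/
structure Height where
  φ : (Fin N → ℝ) →ₗ[ℝ] ℝ
  ne : ∀ β : D.Root, φ β.1 ≠ 0

variable (D) in
lemma exists_height : Nonempty D.Height := by
  obtain ⟨f, hf⟩ := Module.exists_dual_forall_apply_ne_zero (K := ℝ)
    (fun β : D.Root => β.1) root_ne_zero
  exact ⟨⟨f, hf⟩⟩

namespace Height

variable (H : D.Height)

/-- The height of a root. -/
def ht (β : D.Root) : ℝ := H.φ β.1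

lemma ht_neg (β : D.Root) : H.ht (-β) = -H.ht β := by simp [ht, neg_val]

lemma ht_ne (β : D.Root) : H.ht β ≠ 0 := H.ne β

lemma ht_neg_pos {β : D.Root} (h : ¬ 0 < H.ht β) : 0 < H.ht (-β) := by
  rw [ht_neg]
  exact neg_pos.mpr (lt_of_le_of_ne (not_lt.mp h) (H.ht_ne β))

lemma ht_s (β γ : D.Root) : H.ht (s γ • β) = H.ht β - cart β γ * H.ht γ := by
  simp [ht, s_smul_cart]

/-- The indicator function of the positive roots. -/
def pos (β : D.Root) : ℤ := if 0 < H.ht β then 1 else 0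

lemma pos_of_pos {β : D.Root} (h : 0 < H.ht β) : H.pos β = 1 := if_pos h

lemma pos_of_neg {β : D.Root} (h : 0 < H.ht (-β)) : H.pos β = 0 := by
  rw [ht_neg] at h
  exact if_neg (by linarith)

lemma pos_neg (β : D.Root) : H.pos (-β) = 1 - H.pos β := by
  by_cases h : 0 < H.ht β
  · rw [H.pos_of_pos h, H.pos_of_neg (by rwa [neg_neg]), sub_self]
  · rw [H.pos_of_pos (H.ht_neg_pos h), H.pos_of_neg (H.ht_neg_pos h), sub_zero]

/-- A positive root `α` whose affine reflection in `α = j` permutes the Shi hyperplanes not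
parallel to it. -/
structure Adm (α : D.Root) (j : ℤ) : Prop where
  pos : 0 < H.ht α
  mem : j = 0 ∨ j = 1
  smul : ∀ β, β ≠ α → β ≠ -α → H.pos (s α • β) = H.pos β - j * cart β α

lemma Adm.mk' {α : D.Root} {j : ℤ} (hp : 0 < H.ht α) (hj : j = 0 ∨ j = 1)
    (h : ∀ β, 0 < H.ht β → β ≠ α → H.pos (s α • β) = 1 - j * cart β α) : H.Adm α j := by
  refine ⟨hp, hj, fun β h1 h2 => ?_⟩
  by_cases hβ : 0 < H.ht β
  · rw [h β hβ h1, H.pos_of_pos hβ]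
  · have := h (-β) (H.ht_neg_pos hβ) (fun e => h2 (by rw [← e, neg_neg]))
    rw [smul_neg_root, H.pos_neg, cart_neg_left] at this
    rw [H.pos_of_neg (H.ht_neg_pos hβ)]
    linarith

/-- Simple roots, characterised by permuting the other positive roots. -/
def Simple (α : D.Root) : Prop :=
  0 < H.ht α ∧ ∀ β, 0 < H.ht β → β ≠ α → 0 < H.ht (s α • β)

lemma Simple.adm {α : D.Root} (h : H.Simple α) : H.Adm α 0 :=
  Adm.mk' H h.1 (Or.inl rfl) fun β hβ hne => by
    rw [H.pos_of_pos (h.2 β hβ hne), zero_mul, sub_zero]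

lemma cone_zero_or_pos {T : Set (Fin N → ℝ)} (hT : ∀ v ∈ T, 0 < H.φ v) {v : Fin N → ℝ}
    (hv : v ∈ Submodule.span NNReal T) : v = 0 ∨ 0 < H.φ v := by
  induction hv using Submodule.span_induction with
  | mem x hx => exact Or.inr (hT x hx)
  | zero => exact Or.inl rfl
  | add x y _ _ hx hy =>
    rcases hx with rfl | hx <;> rcases hy with rfl | hy
    · simp
    · simpa using Or.inr hy
    · simpa using Or.inr hx
    · right; rw [map_add]; positivity
  | smul a x _ hx =>
    rcases hx with rfl | hx
    · simp
    · rcases eq_or_ne a 0 with rfl | ha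
      · simp
      · right
        rw [NNReal.smul_def, map_smul, smul_eq_mul]
        have : (0 : ℝ) < a := NNReal.coe_pos.mpr (pos_iff_ne_zero.mpr ha)
        positivity

lemma mem_span_simple (β : D.Root) (hβ : 0 < H.ht β) :
    β.1 ∈ Submodule.span NNReal {v | ∃ α : D.Root, H.Simple α ∧ v = α.1} := by
  classical
  let P : Finset D.Root := Finset.univ.filter fun γ => 0 < H.ht γ
  let V : Finset D.Root → Set (Fin N → ℝ) := fun T => Subtype.val '' (T : Set D.Root)
  let G : Finset D.Root → Prop := fun T =>
    T ⊆ P ∧ ∀ γ ∈ P, γ.1 ∈ Submodule.span NNReal (V T)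
  have hP : G P := ⟨subset_rfl, fun γ hγ => Submodule.subset_span ⟨γ, hγ, rfl⟩⟩
  obtain ⟨T, hT, hmin⟩ : ∃ T, G T ∧ ∀ T', G T' → T.card ≤ T'.card := by
    obtain ⟨T, hT, h⟩ := Finset.exists_min_image (Finset.univ.filter G) Finset.card
      ⟨P, by simpa using hP⟩
    exact ⟨T, by simpa using hT, fun T' h' => h T' (by simpa using h')⟩
  have hsimple : ∀ α ∈ T, H.Simple α := by
    intro α hα
    have hα0 : 0 < H.ht α := by simpa [P] using hT.1 hα
    refine ⟨hα0, fun γ hγ hne => ?_⟩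
    by_contra hneg
    set δ := -(s α • γ) with hδ
    have hδ0 : 0 < H.ht δ := H.ht_neg_pos hneg
    have hsum : (cart γ α : ℝ) • α.1 = γ.1 + δ.1 := by
      rw [hδ, neg_val, s_smul_cart]; abel
    have hV : V T = insert α.1 (V (T.erase α)) := by
      simp only [V]
      rw [← Set.image_insert_eq, ← Finset.coe_insert, Finset.insert_erase hα]
    have hpos : ∀ v ∈ V (T.erase α), 0 < H.φ v := by
      rintro _ ⟨η, hη, rfl⟩
      have := hT.1 (Finset.mem_of_mem_erase (Finset.mem_coe.mp hη))
      exact (Finset.mem_filter.mp this).2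
    have key : ∀ η : D.Root, 0 < H.ht η → ∃ a : NNReal, ∃ z ∈ Submodule.span NNReal (V (T.erase α)),
        η.1 = a • α.1 + z := fun η hη => by
      have := hT.2 η (by simpa [P] using hη)
      rwa [hV, Submodule.mem_span_insert] at this
    obtain ⟨a, z, hz, h1⟩ := key γ hγ
    obtain ⟨b, y, hy, h2⟩ := key δ hδ0
    have h3 : ((cart γ α : ℝ) - a - b) • α.1 = z + y := by
      rw [sub_smul, sub_smul, hsum, h1, h2, NNReal.smul_def, NNReal.smul_def]; abel
    have hzy := Submodule.add_mem _ hz hy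
    by_cases hk : 0 < (cart γ α : ℝ) - a - b
    · have hαmem : α.1 ∈ Submodule.span NNReal (V (T.erase α)) := by
        have h4 : α.1 = (⟨((cart γ α : ℝ) - a - b)⁻¹, by positivity⟩ : NNReal) • (z + y) := by
          rw [← h3]
          change _ = ((cart γ α : ℝ) - a - b)⁻¹ • (((cart γ α : ℝ) - a - b) • α.1)
          rw [smul_smul, inv_mul_cancel₀ hk.ne', one_smul]
        rw [h4]
        exact Submodule.smul_mem _ _ hzy
      have hG : G (T.erase α) := by
        refine ⟨(Finset.erase_subset _ _).trans hT.1, fun η hη => ?_⟩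
        have := hT.2 η hη
        rwa [hV, Submodule.span_insert_eq_span hαmem] at this
      have := hmin _ hG
      rw [Finset.card_erase_of_mem hα] at this
      have := Finset.card_pos.mpr ⟨α, hα⟩
      omega
    · have h5 : H.φ (z + y) ≤ 0 := by
        rw [← h3, map_smul, smul_eq_mul]
        exact mul_nonpos_of_nonpos_of_nonneg (not_lt.mp hk) hα0.le
      have hz' := H.cone_zero_or_pos hpos hz
      have hy' := H.cone_zero_or_pos hpos hy
      rw [map_add] at h5
      have hz0 : z = 0 := by
        rcases hz' with h | h
        · exact h
        · rcases hy' with rfl | h'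
          · rw [map_zero] at h5; linarith
          · linarith
      rw [hz0, add_zero, NNReal.smul_def] at h1
      have := D.reduced α.1 α.2 a (h1 ▸ γ.2)
      rcases this with h | h
      · rw [h, one_smul] at h1
        exact hne (Subtype.ext h1)
      · have := a.2
        change (0 : ℝ) ≤ (a : ℝ) at this
        linarith
  refine Submodule.span_mono ?_ (hT.2 β (by simpa [P] using hβ))
  rintro _ ⟨α, hα, rfl⟩
  exact ⟨α, hsimple α hα, rfl⟩

lemma exists_simple_dot_pos (β : D.Root) (hβ : 0 < H.ht β) :
    ∃ α, H.Simple α ∧ 0 < β.1 ⬝ᵥ α.1 := by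
  by_contra! h
  have : ∀ v ∈ Submodule.span NNReal {v | ∃ α : D.Root, H.Simple α ∧ v = α.1},
      β.1 ⬝ᵥ v ≤ 0 := by
    intro v hv
    induction hv using Submodule.span_induction with
    | mem x hx => obtain ⟨α, hα, rfl⟩ := hx; exact h α hα
    | zero => simp
    | add x y _ _ hx hy => rw [dotProduct_add]; linarith
    | smul a x _ hx =>
      rw [NNReal.smul_def, dotProduct_smul, smul_eq_mul]
      exact mul_nonpos_of_nonneg_of_nonpos a.2 hx
  have := this _ (H.mem_span_simple β hβ)
  have := root_dot_pos β
  linarith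

lemma simple_induction {p : D.W → Prop} (hs : ∀ α, H.Simple α → p (s α)) (h1 : p 1)
    (hm : ∀ g h, p g → p h → p (g * h)) (g : D.W) : p g := by
  have key : ∀ β : D.Root, 0 < H.ht β → p (s β) := by
    have hwf : WellFounded fun β γ : D.Root => H.ht β < H.ht γ :=
      Finite.wellFounded_of_trans_of_irrefl _ |>.mono (fun _ _ h => h)
    intro β
    induction β using hwf.induction with
    | _ β ih =>
      intro hβ
      obtain ⟨α, hα, hdot⟩ := H.exists_simple_dot_pos β hβ
      rcases eq_or_ne β α with rfl | hne
      · exact hs _ hα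
      have hc : 0 < (cart β α : ℝ) := by
        rw [← cart_spec]
        have := root_dot_pos α
        positivity
      have h2 := hα.2 β hβ hne
      have h3 : p (s (s α • β)) := ih _ (by
        rw [ht_s]
        have := mul_pos hc hα.1
        linarith) h2
      have h4 : s β = s α * (s (s α • β) * s α) := by
        rw [s_conj, ← _root_.mul_assoc, s_mul_self, _root_.one_mul]
      rw [h4]
      exact hm _ _ (hs α hα) (hm _ _ h3 (hs α hα))
  refine W_induction (fun β => ?_) h1 hm g
  by_cases hβ : 0 < H.ht β
  · exact key β hβ
  · rw [← s_neg]
    exact key _ (H.ht_neg_pos hβ)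

lemma exists_adm_one (hN : 0 < N) : ∃ θ, H.Adm θ 1 := by
  have hne : (Finset.univ : Finset D.Root).Nonempty := by
    obtain ⟨β, -⟩ := exists_dot_ne_zero (D := D) (v := Pi.single ⟨0, hN⟩ 1) (by simp)
    exact ⟨β, Finset.mem_univ _⟩
  obtain ⟨θ, -, hθ⟩ := Finset.exists_max_image Finset.univ
    (fun β : D.Root => toLex (β.1 ⬝ᵥ β.1, H.ht β)) hne
  have hmax : ∀ β : D.Root, β.1 ⬝ᵥ β.1 ≤ θ.1 ⬝ᵥ θ.1 ∧
      (β.1 ⬝ᵥ β.1 = θ.1 ⬝ᵥ θ.1 → H.ht β ≤ H.ht θ) := by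
    intro β
    have := hθ β (Finset.mem_univ _)
    rw [Prod.Lex.toLex_le_toLex] at this
    rcases this with h | ⟨h, h'⟩
    · exact ⟨h.le, fun e => absurd e h.ne⟩
    · exact ⟨h.le, fun _ => h'⟩
  have hθ0 : 0 < H.ht θ := by
    have := (hmax (-θ)).2 (by simp [neg_val])
    rw [ht_neg] at this
    exact lt_of_le_of_ne (by linarith) (H.ht_ne θ).symm
  have hθp := root_dot_pos θ
  have hdot : ∀ β, 0 < H.ht β → 0 ≤ cart β θ := by
    intro β hβ
    by_contra! hc
    have hc' : (cart β θ : ℝ) < 0 := by exact_mod_cast hc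
    have h1 := (hmax (s β • θ)).2 (norm_s_smul _ _)
    rw [ht_s] at h1
    have h2 := cart_mul β θ
    have h3 := cart_mul θ β
    rw [dotProduct_comm] at h3
    have h4 := root_dot_pos β
    have h5 : (cart θ β : ℝ) < 0 := by nlinarith
    nlinarith
  refine ⟨θ, Adm.mk' H hθ0 (Or.inr rfl) fun β hβ hne => ?_⟩
  have h0 := hdot β hβ
  have h2 : cart β θ < 2 := by
    by_contra! hc
    have hc' : (2 : ℝ) ≤ (cart β θ : ℝ) := by exact_mod_cast hc
    have h3 := cart_mul β θ
    have h4 : (β.1 - θ.1) ⬝ᵥ (β.1 - θ.1) ≤ 0 := by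
      simp only [dotProduct_sub, sub_dotProduct]
      rw [dotProduct_comm θ.1 β.1]
      have := (hmax β).1
      nlinarith
    have h5 : β.1 - θ.1 = 0 := dotProduct_self_eq_zero.mp
      (le_antisymm h4 (Finset.sum_nonneg fun i _ => mul_self_nonneg _))
    exact hne (Subtype.ext (sub_eq_zero.mp h5))
  rw [_root_.one_mul]
  obtain hc | hc : cart β θ = 0 ∨ cart β θ = 1 := by omega
  · have : s θ • β = β := Subtype.ext (by rw [s_smul_cart, hc]; simp)
    rw [this, H.pos_of_pos hβ, hc, sub_zero]
  · rw [hc, sub_self]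
    refine H.pos_of_neg (H.ht_neg_pos fun h => ?_)
    have h6 := hdot _ h
    have h7 : (cart (s θ • β) θ : ℝ) = -1 := by
      rw [← cart_spec, s_smul_cart, hc, sub_dotProduct, smul_dotProduct, mul_sub, cart_mul, hc]
      have := hθp.ne'
      field_simp
      push_cast
      simp
      ring
    have h8 : (0 : ℝ) ≤ (cart (s θ • β) θ : ℝ) := by exact_mod_cast h6
    linarith

end Height

end RootDatum

end Catalan

namespace Catalan

variable {N : ℕ}

/-- The homogeneous component of integral degree `k`, which vanishes for negative `k`. -/
def hZ (k : ℤ) : Pol N →ₗ[ℂ] Pol N := if 0 ≤ k then homogeneousComponent k.toNat else 0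

lemma hZ_natCast (k : ℕ) (p : Pol N) : hZ (k : ℤ) p = homogeneousComponent k p := by
  simp [hZ]

lemma hZ_neg {k : ℤ} (hk : k < 0) (p : Pol N) : hZ k p = 0 := by
  simp [hZ, not_le.mpr hk]

lemma hZ_isHomogeneous (d : ℕ) (p : Pol N) : (hZ (d : ℤ) p).IsHomogeneous d := by
  rw [hZ_natCast]
  exact homogeneousComponent_isHomogeneous d p

lemma hZ_of_isHomogeneous {p : Pol N} {d : ℕ} (hp : p.IsHomogeneous d) (k : ℤ) :
    hZ k p = if k = d then p else 0 := by
  rcases lt_or_ge k 0 with hk | hk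
  · rw [hZ_neg hk, if_neg (by omega)]
  · lift k to ℕ using hk
    rw [hZ_natCast, homogeneousComponent_of_mem hp]
    simp [eq_comm]

lemma hZ_mul {h : Pol N} {e : ℕ} (hh : h.IsHomogeneous e) (k : ℤ) (f : Pol N) :
    hZ k (f * h) = hZ (k - e) f * h := by
  have key : ∀ f : Pol N, ∀ n, f.IsHomogeneous n → hZ k (f * h) = hZ (k - e) f * h := by
    intro f n hf
    rw [hZ_of_isHomogeneous (hf.mul hh), hZ_of_isHomogeneous hf]
    push_cast
    by_cases hk : k = n + e
    · rw [if_pos hk, if_pos (by omega)]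
    · rw [if_neg hk, if_neg (by omega), zero_mul]
  conv_lhs => rw [← sum_homogeneousComponent f]
  conv_rhs => rw [← sum_homogeneousComponent f]
  rw [Finset.sum_mul, map_sum, map_sum, Finset.sum_mul]
  exact Finset.sum_congr rfl fun i _ => key _ i (homogeneousComponent_isHomogeneous i f)

/-- The degree of `p` is at most `d`, where `d` may be negative. -/
def DegLe (d : ℤ) (p : Pol N) : Prop := ∀ k : ℤ, d < k → hZ k p = 0

lemma degLe_iff {d : ℤ} {p : Pol N} : DegLe d p ↔ p = 0 ∨ (p.totalDegree : ℤ) ≤ d := by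
  constructor
  · intro h
    by_contra! hc
    have h0 := h _ hc.2
    rw [hZ_natCast] at h0
    obtain ⟨e, he, he'⟩ := Finset.exists_mem_eq_sup p.support (support_nonempty.mpr hc.1)
      fun s => s.sum fun _ n => n
    have h1 := congrArg (coeff e) h0
    rw [coeff_homogeneousComponent, if_pos (by rw [totalDegree, he']; rfl), coeff_zero] at h1
    exact mem_support_iff.mp he h1
  · rintro (rfl | h) k hk
    · simp
    · rcases lt_or_ge k 0 with hk0 | hk0
      · exact hZ_neg hk0 p
      · lift k to ℕ using hk0
        rw [hZ_natCast]
        exact homogeneousComponent_eq_zero _ _ (by omega)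

lemma degLe_natCast {d : ℕ} {p : Pol N} : DegLe d p ↔ p.totalDegree ≤ d := by
  rw [degLe_iff]
  constructor
  · rintro (rfl | h)
    · simp
    · exact_mod_cast h
  · intro h
    right
    exact_mod_cast h

lemma DegLe.mono {d e : ℤ} {p : Pol N} (h : DegLe d p) (hde : d ≤ e) : DegLe e p :=
  fun k hk => h k (by omega)

lemma DegLe.add {d : ℤ} {p q : Pol N} (hp : DegLe d p) (hq : DegLe d q) : DegLe d (p + q) :=
  fun k hk => by rw [map_add, hp k hk, hq k hk, add_zero]

lemma DegLe.sub {d : ℤ} {p q : Pol N} (hp : DegLe d p) (hq : DegLe d q) : DegLe d (p - q) :=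
  fun k hk => by rw [map_sub, hp k hk, hq k hk, sub_zero]

lemma DegLe.smul {d : ℤ} {p : Pol N} (hp : DegLe d p) (c : ℂ) : DegLe d (c • p) :=
  fun k hk => by rw [map_smul, hp k hk, smul_zero]

lemma DegLe.sum {ι : Type*} {d : ℤ} {t : Finset ι} {p : ι → Pol N} (h : ∀ i ∈ t, DegLe d (p i)) :
    DegLe d (∑ i ∈ t, p i) := fun k hk => by
  rw [map_sum]
  exact Finset.sum_eq_zero fun i hi => h i hi k hk

lemma DegLe.of_isHomogeneous {p : Pol N} {d : ℕ} (hp : p.IsHomogeneous d) : DegLe d p :=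
  fun k hk => by rw [hZ_of_isHomogeneous hp, if_neg (by omega)]

lemma DegLe.sub_hZ {d : ℤ} {p : Pol N} (hp : DegLe d p) (hd : hZ d p = 0) : DegLe (d - 1) p :=
  fun k hk => by
    rcases eq_or_ne k d with rfl | h
    · exact hd
    · exact hp k (by omega)

lemma lin_sub_C_ne_zero {v : Fin N → ℂ} (hv : v ≠ 0) (c : ℂ) : lin v - C c ≠ 0 :=
  (prime_lin_sub_C hv c).ne_zero

lemma DegLe.of_lin_mul {v : Fin N → ℂ} (hv : v ≠ 0) {c : ℂ} {d : ℤ} {q : Pol N}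
    (h : DegLe d ((lin v - C c) * q)) : DegLe (d - 1) q := by
  rcases eq_or_ne q 0 with rfl | hq
  · exact fun k _ => map_zero _
  · rw [degLe_iff] at h ⊢
    rcases h with h | h
    · exact absurd h (mul_ne_zero (lin_sub_C_ne_zero hv c) hq)
    · right
      rw [totalDegree_mul_of_isDomain (lin_sub_C_ne_zero hv c) hq, totalDegree_lin_sub_C hv] at h
      push_cast at h
      omega

lemma hZ_lin_mul (v : Fin N → ℂ) (c : ℂ) (d : ℤ) (q : Pol N) :
    hZ d ((lin v - C c) * q) = lin v * hZ (d - 1) q - c • hZ d q := by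
  rw [sub_mul, ← smul_eq_C_mul, map_sub, map_smul, mul_comm, hZ_mul (lin_isHomogeneous v),
    mul_comm]
  simp

lemma hZ_lin_mul_top {v : Fin N → ℂ} (hv : v ≠ 0) {c : ℂ} {d : ℤ} {q : Pol N}
    (h : DegLe d ((lin v - C c) * q)) :
    hZ d ((lin v - C c) * q) = lin v * hZ (d - 1) q := by
  rw [hZ_lin_mul, h.of_lin_mul hv d (by omega), smul_zero, sub_zero]

lemma pow_dvd_hZ_of_prod {v : Fin N → ℂ} (hv : v ≠ 0) (t : Finset ℤ) {d : ℤ} {q : Pol N}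
    (h : DegLe d ((∏ i ∈ t, (lin v - C (i : ℂ))) * q)) :
    lin v ^ t.card ∣ hZ d ((∏ i ∈ t, (lin v - C (i : ℂ))) * q) := by
  induction t using Finset.induction_on generalizing d with
  | empty => simp
  | insert i t hi ih =>
    rw [Finset.prod_insert hi, mul_assoc] at h ⊢
    rw [hZ_lin_mul_top hv h, Finset.card_insert_of_notMem hi, pow_succ']
    exact mul_dvd_mul_left _ (ih (h.of_lin_mul hv))

lemma pow_dvd_hZ {v : Fin N → ℂ} (hv : v ≠ 0) (t : Finset ℤ) {d : ℤ} {p : Pol N}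
    (hd : DegLe d p) (h : ∀ i ∈ t, lin v - C (i : ℂ) ∣ p) : lin v ^ t.card ∣ hZ d p := by
  have hdvd : ∏ i ∈ t, (lin v - C (i : ℂ)) ∣ p := by
    refine Finset.prod_dvd_of_coprime (fun i _ k _ hik => ?_) h
    refine ⟨C (((k : ℂ) - i)⁻¹), -C (((k : ℂ) - i)⁻¹), ?_⟩
    have hne : (k : ℂ) - i ≠ 0 := sub_ne_zero.mpr (by exact_mod_cast hik.symm)
    have : C (((k : ℂ) - i)⁻¹) * (C (k : ℂ) - C (i : ℂ)) = (1 : Pol N) := by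
      rw [← C_sub, ← C_mul, inv_mul_cancel₀ hne, C_1]
    linear_combination this
  obtain ⟨q, rfl⟩ := hdvd
  exact pow_dvd_hZ_of_prod hv t hd

/-- The derivative in the direction `c`. -/
def dir (c : Fin N → ℂ) : Derivation ℂ (Pol N) (Pol N) := ∑ i, c i • pderiv i

lemma dir_apply (c : Fin N → ℂ) (p : Pol N) : dir c p = ∑ i, c i • pderiv i p := by
  change Derivation.coeFnAddMonoidHom (dir c) p = _
  rw [dir, map_sum, Finset.sum_apply]
  rfl

lemma dir_X (c : Fin N → ℂ) (i : Fin N) : dir c (X i) = C (c i) := by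
  rw [dir_apply, Finset.sum_eq_single i]
  · simp [smul_eq_C_mul]
  · intro j _ hj
    rw [pderiv_X_of_ne hj.symm, smul_zero]
  · simp

section affine

variable (σ : Pol N →ₐ[ℂ] Pol N) (c : Fin N → ℂ)

/-- The linear substitution `σ` followed by a translation. -/
def affHom : Pol N →ₐ[ℂ] Pol N := aeval fun i => σ (X i) + C (c i)

lemma affHom_X (i : Fin N) : affHom σ c (X i) = σ (X i) + C (c i) := by simp [affHom]

variable {σ c}

lemma hZ_affHom_hZ (hσ : ∀ i, (σ (X i)).IsHomogeneous 1) (p : Pol N) (n : ℤ) :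
    (∀ k, n < k → hZ k (affHom σ c (hZ n p)) = 0) ∧
      hZ n (affHom σ c (hZ n p)) = σ (hZ n p) ∧
      hZ (n - 1) (affHom σ c (hZ n p)) = σ (dir c (hZ n p)) := by
  induction p using MvPolynomial.induction_on generalizing n with
  | C a =>
    rw [hZ_of_isHomogeneous (isHomogeneous_C (Fin N) a)]
    split_ifs with h
    · rw [← algebraMap_eq, AlgHom.commutes, AlgHom.commutes, Derivation.map_algebraMap, map_zero,
        algebraMap_eq]
      simp only [hZ_of_isHomogeneous (isHomogeneous_C (Fin N) a)]
      refine ⟨fun k hk => if_neg ?_, if_pos h, if_neg ?_⟩ <;> push_cast at * <;> omega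
    · simp
  | add p q hp hq =>
    obtain ⟨h1, h2, h3⟩ := hp n
    obtain ⟨h1', h2', h3'⟩ := hq n
    simp only [map_add, h2, h2', h3, h3', and_true]
    intro k hk
    rw [h1 k hk, h1' k hk, add_zero]
  | mul_X p i hp =>
    obtain ⟨h1, h2, h3⟩ := hp (n - 1)
    rw [hZ_mul (isHomogeneous_X ℂ i)]
    push_cast
    set q := hZ (n - 1) p
    have hk : ∀ k, hZ k (affHom σ c (q * X i)) =
        hZ (k - 1) (affHom σ c q) * σ (X i) + c i • hZ k (affHom σ c q) := fun k => by
      rw [map_mul, affHom_X, mul_add, map_add, hZ_mul (hσ i), mul_comm _ (C (c i)),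
        ← smul_eq_C_mul, map_smul]
      simp
    refine ⟨fun k hk' => ?_, ?_, ?_⟩
    · rw [hk, h1 _ (by omega), h1 _ (by omega), zero_mul, smul_zero, add_zero]
    · rw [hk, h2, h1 _ (by omega), smul_zero, add_zero, map_mul]
    · rw [hk, h3, h2, Derivation.leibniz, dir_X]
      simp only [smul_eq_mul, map_add, map_mul]
      rw [← algebraMap_eq, AlgHom.commutes, Algebra.smul_def]
      ring

lemma eq_sum_hZ (p : Pol N) : p = ∑ n ∈ Finset.range (p.totalDegree + 1), hZ (n : ℤ) p := by
  simp_rw [hZ_natCast]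
  exact (sum_homogeneousComponent p).symm

lemma hZ_affHom (hσ : ∀ i, (σ (X i)).IsHomogeneous 1) {p : Pol N} {d : ℤ} (hp : DegLe d p) :
    DegLe d (affHom σ c p) ∧ hZ d (affHom σ c p) = σ (hZ d p) ∧
      hZ (d - 1) (affHom σ c p) = σ (hZ (d - 1) p + dir c (hZ d p)) := by
  have hz : ∀ (n k : ℤ), n < k ∨ d < n → hZ k (affHom σ c (hZ n p)) = 0 := by
    rintro n k (h | h)
    · exact (hZ_affHom_hZ hσ p n).1 k h
    · rw [hp n h, map_zero, map_zero]
  have hsum : ∀ k : ℤ, hZ k (affHom σ c p) =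
      ∑ n ∈ Finset.range (p.totalDegree + 1), hZ k (affHom σ c (hZ (n : ℤ) p)) := fun k => by
    conv_lhs => rw [eq_sum_hZ p, map_sum, map_sum]
  have hout : ∀ n : ℕ, n ∉ Finset.range (p.totalDegree + 1) → hZ (n : ℤ) p = 0 := fun n hn => by
    rw [hZ_natCast]
    exact homogeneousComponent_eq_zero _ _ (by simpa using hn)
  have hcoll : ∀ k m : ℤ, (∀ n : ℕ, (n : ℤ) ≠ m → hZ k (affHom σ c (hZ (n : ℤ) p)) = 0) →
      hZ k (affHom σ c p) = hZ k (affHom σ c (hZ m p)) := by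
    intro k m h
    rw [hsum]
    rcases lt_or_ge m 0 with hm | hm
    · rw [hZ_neg hm p, map_zero, map_zero]
      exact Finset.sum_eq_zero fun n _ => h n (by omega)
    · lift m to ℕ using hm
      refine Finset.sum_eq_single m (fun n _ hn => h n (by exact_mod_cast hn)) fun hm => ?_
      rw [hout m hm, map_zero, map_zero]
  have hdeg : DegLe d (affHom σ c p) := fun k hk => by
    rw [hsum]
    exact Finset.sum_eq_zero fun n _ => hz n k (by omega)
  refine ⟨hdeg, ?_, ?_⟩
  · rw [hcoll d d fun n hn => hz n d (by omega), (hZ_affHom_hZ hσ p d).2.1]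
  · have h : affHom σ c p = affHom σ c (p - hZ d p) + affHom σ c (hZ d p) := by
      rw [← map_add, sub_add_cancel]
    have h' : ∀ n : ℤ, hZ n (p - hZ d p) = if n = d then 0 else hZ n p := by
      intro n
      rw [map_sub]
      rcases lt_or_ge d 0 with hd | hd
      · rw [hZ_neg hd p, map_zero, sub_zero]
        split_ifs with hn
        · rw [hn, hZ_neg hd p]
        · rfl
      · lift d to ℕ using hd
        rw [hZ_of_isHomogeneous (hZ_isHomogeneous d p)]
        split_ifs with hn
        · rw [hn, sub_self]
        · rw [sub_zero]
    have hlow : hZ (d - 1) (affHom σ c (p - hZ d p)) = σ (hZ (d - 1) p) := by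
      have e := (hZ_affHom_hZ (c := c) hσ (p - hZ d p) (d - 1)).2.1
      rw [h', if_neg (by omega)] at e
      rw [← e]
      conv_lhs => rw [eq_sum_hZ (p - hZ d p), map_sum, map_sum]
      rcases lt_or_ge (d - 1) 0 with hd | hd
      · rw [hZ_neg hd p, map_zero, map_zero]
        refine Finset.sum_eq_zero fun n _ => ?_
        rw [h']
        split_ifs with hn
        · rw [map_zero, map_zero]
        · exact hz n _ (by omega)
      · obtain ⟨e', he'⟩ : ∃ e : ℕ, (e : ℤ) = d - 1 := ⟨(d - 1).toNat, by omega⟩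
        rw [Finset.sum_eq_single e']
        · rw [h', if_neg (by omega), he']
        · intro n _ hn
          rw [h']
          split_ifs with hn'
          · rw [map_zero, map_zero]
          · exact hz n _ (by omega)
        · intro he
          rw [hZ_natCast, homogeneousComponent_eq_zero _ _ (by simpa using he), map_zero,
            map_zero]
    rw [h, map_add, hlow, (hZ_affHom_hZ hσ p d).2.2, map_add]

end affine

end Catalan

namespace Catalan

open Matrix

variable {N : ℕ}

lemma contr_add (v : Fin N → ℂ) (F G : Fin N → Pol N) :
    contr v (F + G) = contr v F + contr v G := by
  simp [contr, Finset.sum_add_distrib]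

lemma contr_sub (v : Fin N → ℂ) (F G : Fin N → Pol N) :
    contr v (F - G) = contr v F - contr v G := by
  simp [contr, smul_sub, Finset.sum_sub_distrib]

lemma contr_smul (v : Fin N → ℂ) (q : Pol N) (F : Fin N → Pol N) :
    contr v (q • F) = q * contr v F := by
  simp [contr, Finset.mul_sum]

lemma contr_csmul (v : Fin N → ℂ) (c : ℂ) (F : Fin N → Pol N) :
    contr v (c • F) = c • contr v F := by
  simp only [contr, Pi.smul_apply, Finset.smul_sum]
  exact Finset.sum_congr rfl fun i _ => smul_comm _ _ _

lemma contr_zero (v : Fin N → ℂ) : contr v (0 : Fin N → Pol N) = 0 := by simp [contr]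

lemma contr_neg_vec (v : Fin N → ℂ) (F : Fin N → Pol N) : contr (-v) F = -contr v F := by
  simp [contr]

lemma contr_sum {ι : Type*} (v : Fin N → ℂ) (t : Finset ι) (F : ι → Fin N → Pol N) :
    contr v (∑ i ∈ t, F i) = ∑ i ∈ t, contr v (F i) := by
  simp only [contr, Finset.sum_apply, Finset.smul_sum]
  exact Finset.sum_comm

lemma affHom_lin (σ : Pol N →ₐ[ℂ] Pol N) (c v : Fin N → ℂ) :
    affHom σ c (lin v) = σ (lin v) + C (v ⬝ᵥ c) := by
  simp only [lin_eq, map_sum, map_smul, affHom_X, smul_add, Finset.sum_add_distrib, dotProduct]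
  simp only [smul_eq_C_mul, C_mul]

lemma dvd_algHom_sub {p : Pol N} {f : Pol N →ₐ[ℂ] Pol N} (hf : ∀ i, p ∣ f (X i) - X i)
    (q : Pol N) : p ∣ f q - q := by
  induction q using MvPolynomial.induction_on with
  | C a => rw [← algebraMap_eq, AlgHom.commutes, sub_self]; exact dvd_zero _
  | add a b ha hb => rw [map_add, add_sub_add_comm]; exact dvd_add ha hb
  | mul_X a i ha =>
    have : f (a * X i) - a * X i = (f a - a) * f (X i) + a * (f (X i) - X i) := by
      rw [map_mul]; ring
    rw [this]
    exact dvd_add (ha.mul_right _) ((hf i).mul_left _)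

namespace RootDatum

variable {D : RootDatum N}

lemma cart_s_smul (β α : D.Root) : cart (s α • β) α = -cart β α := by
  have h : (cart (s α • β) α : ℂ) = ((-cart β α : ℤ) : ℂ) := by
    push_cast
    rw [← cart_complex, ← cart_complex, vec_smul, dotProduct_comm (vec α) (mat (s α) *ᵥ vec β),
      dot_mat_left, ← neg_div]
    have hinv : (s α)⁻¹ = s α := by rw [inv_eq_iff_mul_eq_one, s_mul_self]
    rw [hinv, ← vec_smul, s_smul_self, vec_neg, dotProduct_neg, dotProduct_comm (vec β), mul_neg]
  exact_mod_cast h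

/-- The coroot of a root. -/
def coroot (α : D.Root) : Fin N → ℂ := (2 / (vec α ⬝ᵥ vec α)) • vec α

lemma vec_dot_coroot (β α : D.Root) : vec β ⬝ᵥ coroot α = (cart β α : ℂ) := by
  rw [coroot, dotProduct_smul, ← cart_complex, dotProduct_comm (vec β), smul_eq_mul]
  ring

/-- The affine reflection in the hyperplane `α = j`, acting on polynomials. -/
def aff (α : D.Root) (j : ℤ) : Pol N →ₐ[ℂ] Pol N :=
  affHom (act (s α) : Pol N →ₐ[ℂ] Pol N) ((j : ℂ) • coroot α)

lemma aff_ell (α : D.Root) (j : ℤ) (β : D.Root) (i : ℤ) :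
    aff α j (ell β - C (i : ℂ)) = ell (s α • β) - C ((i - j * cart β α : ℤ) : ℂ) := by
  have : aff α j (C (i : ℂ)) = C (i : ℂ) := (aff α j).commutes _
  rw [map_sub, this, ell, aff, affHom_lin, dotProduct_smul, vec_dot_coroot]
  change act (s α) (ell β) + _ - _ = _
  rw [act_ell]
  simp only [smul_eq_mul, Int.cast_sub, Int.cast_mul, C_sub]
  ring

lemma act_s_X (α : D.Root) (i : Fin N) : act (s α) (X i) = X i - coroot α i • ell α := by
  rw [← lin_single, act_lin, mat_s_mulVec, map_sub, map_smul, coroot, ell]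
  simp only [dotProduct_single, mul_one, Pi.smul_apply, smul_eq_mul]
  congr 2
  ring

lemma dvd_aff_sub (α : D.Root) (j : ℤ) (q : Pol N) : ell α - C (j : ℂ) ∣ aff α j q - q := by
  refine dvd_algHom_sub (fun i => ⟨-C (coroot α i), ?_⟩) q
  rw [aff, affHom_X]
  change act (s α) (X i) + _ - _ = _
  rw [act_s_X, smul_eq_C_mul]
  simp only [Pi.smul_apply, smul_eq_mul, C_mul]
  ring

/-- The affine reflection in the hyperplane `α = j`, acting on vector fields. -/
def affV (α : D.Root) (j : ℤ) (F : Fin N → Pol N) : Fin N → Pol N :=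
  fun n => ∑ k, mat (s α) n k • aff α j (F k)

lemma mat_s_apply (α : D.Root) (n k : Fin N) :
    mat (s α) n k = (if n = k then 1 else 0) - coroot α n * vec α k := by
  rw [mat_s, reflM_eq]
  change (1 : Matrix _ _ ℂ) n k - 2 / (vec α ⬝ᵥ vec α) * (vec α n * vec α k) = _
  rw [Matrix.one_apply, coroot]
  simp only [Pi.smul_apply, smul_eq_mul]
  ring

lemma affV_apply (α : D.Root) (j : ℤ) (F : Fin N → Pol N) (n : Fin N) :
    affV α j F n = aff α j (F n) - coroot α n • aff α j (contr (vec α) F) := by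
  simp only [affV, mat_s_apply, sub_smul, Finset.sum_sub_distrib, ite_smul, one_smul, zero_smul,
    Finset.sum_ite_eq, Finset.mem_univ, if_true, contr, map_sum, map_smul, Finset.smul_sum,
    smul_smul]

lemma contr_affV (v : Fin N → ℂ) (α : D.Root) (j : ℤ) (F : Fin N → Pol N) :
    contr v (affV α j F) = aff α j (contr (mat (s α) *ᵥ v) F) := by
  have h : contr (mat (s α) *ᵥ v) F = contr v F - (v ⬝ᵥ coroot α) • contr (vec α) F := by
    rw [mat_s_mulVec]
    simp only [contr, Pi.sub_apply, Pi.smul_apply, sub_smul, Finset.sum_sub_distrib, coroot,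
      dotProduct_smul, smul_eq_mul, Finset.smul_sum, smul_smul]
    congr 1
    refine Finset.sum_congr rfl fun i _ => ?_
    rw [dotProduct_comm]
    congr 1
    ring
  rw [h, map_sub, map_smul]
  simp only [contr, affV_apply, map_sum, map_smul, smul_sub, Finset.sum_sub_distrib, smul_smul,
    dotProduct, Finset.sum_smul]

namespace Height

variable (H : D.Height)

/-- The indices of the Shi hyperplanes parallel to a root. -/
def Allowed (β : D.Root) (i : ℤ) : Prop :=
  -(mul β : ℤ) + H.pos β ≤ i ∧ i ≤ mul β - 1 + H.pos β

lemma allowed_neg {β : D.Root} {i : ℤ} : H.Allowed (-β) i ↔ H.Allowed β (-i) := by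
  rw [Allowed, Allowed, H.pos_neg, mul_neg_root]
  constructor <;> intro h <;> constructor <;> omega

/-- Logarithmic vector fields of the extended Shi arrangement. -/
def Shi : Submodule (Pol N) (Fin N → Pol N) where
  carrier := {F | ∀ β i, H.Allowed β i → ell β - C (i : ℂ) ∣ contr (vec β) F}
  add_mem' hF hG β i h := by
    rw [contr_add]
    exact dvd_add (hF β i h) (hG β i h)
  zero_mem' β i _ := by
    rw [contr_zero]
    exact dvd_zero _
  smul_mem' q F hF β i h := by
    rw [contr_smul]
    exact (hF β i h).mul_left _

lemma prime_ell_sub (β : D.Root) (i : ℤ) : Prime (ell β - C (i : ℂ)) :=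
  prime_lin_sub_C (vec_ne_zero β) _

lemma neg_dvd_contr {β : D.Root} {i : ℤ} {F : Fin N → Pol N} :
    ell (-β) - C (i : ℂ) ∣ contr (vec (-β)) F ↔ ell β - C ((-i : ℤ) : ℂ) ∣ contr (vec β) F := by
  have : ell (-β) - C (i : ℂ) = -(ell β - C ((-i : ℤ) : ℂ)) := by
    rw [ell_neg, Int.cast_neg, C_neg]; ring
  rw [this, vec_neg, contr_neg_vec, neg_dvd, dvd_neg]

variable {H}

lemma Adm.exists_quot {α : D.Root} {j : ℤ} (hα : H.Adm α j) {F : Fin N → Pol N}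
    (hF : F ∈ H.Shi) : ∃ Q : Fin N → Pol N,
      ∀ n, (ell α - C (j : ℂ)) * Q n = C (mul α : ℂ) * (F n - affV α j F n) := by
  rcases Nat.eq_zero_or_pos (mul α) with h0 | h0
  · exact ⟨0, fun n => by simp [h0]⟩
  · have hd : ∀ n, ell α - C (j : ℂ) ∣ F n - affV α j F n := by
      intro n
      have hall : H.Allowed α j := by
        have := hα.mem
        rw [Allowed, H.pos_of_pos hα.pos]
        omega
      obtain ⟨b, hb⟩ := hF α j hall
      have h1 := dvd_aff_sub α j (F n)
      have h2 : ell α - C (j : ℂ) ∣ aff α j (contr (vec α) F) := by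
        have := (dvd_aff_sub α j (contr (vec α) F))
        rw [hb] at this ⊢
        exact (dvd_sub_left (dvd_mul_right _ _)).mp this
      rw [affV_apply, sub_sub_eq_add_sub, add_comm, add_sub_assoc, smul_eq_C_mul]
      refine dvd_add (h2.mul_left _) ?_
      rwa [dvd_sub_comm]
    choose Q hQ using hd
    exact ⟨fun n => C (mul α : ℂ) * Q n, fun n => by rw [hQ]; ring⟩

lemma Adm.mem_Shi {α : D.Root} {j : ℤ} (hα : H.Adm α j) {F Q : Fin N → Pol N} (hF : F ∈ H.Shi)
    (hQ : ∀ n, (ell α - C (j : ℂ)) * Q n = C (mul α : ℂ) * (F n - affV α j F n)) :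
    affV α j F + (C ((1 - 2 * j : ℤ) : ℂ) : Pol N) • Q ∈ H.Shi := by
  set ε : Pol N := C ((1 - 2 * j : ℤ) : ℂ) with hε
  set m : Pol N := C (mul α : ℂ) with hm
  set L := ell α - C (j : ℂ) with hL
  have hQv : ∀ v, L * contr v Q = m * (contr v F - contr v (affV α j F)) := by
    intro v
    rw [← contr_smul, ← contr_sub, ← contr_smul]
    congr 1
    funext n
    exact hQ n
  have key : ∀ v, L * contr v (affV α j F + ε • Q) =
      (L - ε * m) * contr v (affV α j F) + ε * m * contr v F := by
    intro v
    rw [contr_add, contr_smul]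
    linear_combination ε * hQv v
  have hαα : ∀ i, H.Allowed α i → ell α - C (i : ℂ) ∣ contr (vec α) (affV α j F + ε • Q) := by
    intro i hi
    have hs : contr (vec α) (affV α j F) = -aff α j (contr (vec α) F) := by
      rw [contr_affV, ← vec_smul, s_smul_self, vec_neg, contr_neg_vec, map_neg]
    have haff : ∀ k : ℤ, aff α j (ell α - C (k : ℂ)) = -(ell α - C ((2 * j - k : ℤ) : ℂ)) := by
      intro k
      have hc : cart α α = 2 := by
        have : (cart α α : ℝ) = ((2 : ℤ) : ℝ) := by
          rw [← cart_spec, mul_div_assoc, div_self (root_dot_pos α).ne']; norm_num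
        exact_mod_cast this
      rw [aff_ell, s_smul_self, ell_neg, hc, mul_comm j 2, ← neg_sub (2 * j) k, Int.cast_neg, C_neg]
      ring
    rcases eq_or_ne i j with rfl | hij
    · obtain ⟨b, hb⟩ := hF α i hi
      have h1 := key (vec α)
      have h2 : aff α i (contr (vec α) F) = -(L * aff α i b) := by
        rw [hb, map_mul, haff, two_mul, add_sub_cancel_right]; ring
      rw [hs, h2, hb] at h1
      have h3 : contr (vec α) (affV α i F + ε • Q) = L * aff α i b - ε * m * (aff α i b - b) := by
        refine mul_left_cancel₀ (prime_ell_sub α i).ne_zero ?_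
        rw [h1]
        ring
      rw [h3]
      exact dvd_sub (dvd_mul_right _ _) ((dvd_aff_sub α i b).mul_left _)
    · refine ((prime_ell_sub α i).dvd_or_dvd (a := L) ?_).resolve_left ?_
      · rw [key]
        refine dvd_add ?_ ((hF α i hi).mul_left _)
        by_cases hi' : H.Allowed α (2 * j - i)
        · rw [hs]
          refine Dvd.dvd.mul_left ((dvd_neg (α := Pol N)).mpr ?_) _
          have h1 := map_dvd (aff α j) (hF α _ hi')
          rw [haff, sub_sub_cancel, neg_dvd] at h1
          exact h1
        · refine Dvd.dvd.mul_right (dvd_of_eq ?_) _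
          rw [hL, hε, hm, sub_sub, ← C_mul, ← C_add]
          congr 2
          rw [Allowed, H.pos_of_pos hα.pos] at hi hi'
          have hmem := hα.mem
          have hii : i = j + (1 - 2 * j) * mul α := by
            rcases hmem with rfl | rfl <;> simp only [not_and_or, not_le] at hi' <;> omega
          rw [hii]
          push_cast
          ring
      · intro h
        rcases ell_sub_C_dvd h with ⟨-, h⟩ | ⟨h, -⟩
        · exact hij (by exact_mod_cast h.symm)
        · exact neg_ne_self α h.symm
  intro β i hi
  by_cases h1 : β = α
  · subst h1
    exact hαα i hi
  by_cases h2 : β = -α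
  · subst h2
    rw [neg_dvd_contr]
    exact hαα _ (H.allowed_neg.mp hi)
  refine ((prime_ell_sub β i).dvd_or_dvd (a := L) ?_).resolve_left ?_
  · rw [key]
    refine dvd_add (Dvd.dvd.mul_left ?_ _) ((hF β i hi).mul_left _)
    have hi' : H.Allowed (s α • β) (i - j * cart β α) := by
      rw [Allowed, hα.smul β h1 h2, mul_smul_root]
      rw [Allowed] at hi
      omega
    have h3 := map_dvd (aff α j) (hF _ _ hi')
    rw [aff_ell, cart_s_smul, smul_smul, s_mul_self, one_smul] at h3
    rw [contr_affV, ← vec_smul]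
    convert h3 using 4
    ring
  · intro h
    rcases ell_sub_C_dvd h with ⟨h, -⟩ | ⟨h, -⟩
    · exact h1 h.symm
    · exact h2 (by rw [h, neg_neg])

end Height

end RootDatum

end Catalan

namespace Catalan

open Matrix

variable {N : ℕ}

/-- Componentwise homogeneous part of a polynomial vector field. -/
def hV (k : ℤ) (F : Fin N → Pol N) : Fin N → Pol N := fun n => hZ k (F n)

/-- Componentwise degree bound on a polynomial vector field. -/
def VDegLe (d : ℤ) (F : Fin N → Pol N) : Prop := ∀ n, DegLe d (F n)

/-- Componentwise directional derivative. -/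
def dirV (c : Fin N → ℂ) (F : Fin N → Pol N) : Fin N → Pol N := fun n => dir c (F n)

lemma hZ_contr (k : ℤ) (v : Fin N → ℂ) (F : Fin N → Pol N) :
    hZ k (contr v F) = contr v (hV k F) := by
  simp [contr, hV, map_sum]

lemma VDegLe.contr {d : ℤ} {F : Fin N → Pol N} (h : VDegLe d F) (v : Fin N → ℂ) :
    DegLe d (contr v F) := DegLe.sum fun i _ => (h i).smul _

namespace RootDatum

variable {D : RootDatum N}

lemma actV_add (g : D.W) (F G : Fin N → Pol N) : actV g (F + G) = actV g F + actV g G := by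
  funext n
  simp [actV, Finset.sum_add_distrib]

lemma actV_sub (g : D.W) (F G : Fin N → Pol N) : actV g (F - G) = actV g F - actV g G := by
  funext n
  simp [actV, smul_sub, Finset.sum_sub_distrib]

lemma actV_csmul (g : D.W) (c : ℂ) (F : Fin N → Pol N) : actV g (c • F) = c • actV g F := by
  funext n
  simp only [actV, Pi.smul_apply, map_smul, Finset.smul_sum]
  exact Finset.sum_congr rfl fun j _ => smul_comm _ _ _

lemma actV_smul (g : D.W) (p : Pol N) (F : Fin N → Pol N) :
    actV g (p • F) = act g p • actV g F := by
  funext n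
  simp [actV, Finset.mul_sum]

lemma actV_mul (g h : D.W) (F : Fin N → Pol N) : actV (g * h) F = actV g (actV h F) := by
  funext n
  simp only [actV, mat_mul, Matrix.mul_apply, act_mul, map_sum, map_smul, Finset.sum_smul,
    Finset.smul_sum, smul_smul]
  exact Finset.sum_comm

lemma actV_one (F : Fin N → Pol N) : actV (1 : D.W) F = F := by
  funext n
  simp [actV, mat_one, Matrix.one_apply]

lemma actV_s_s (β : D.Root) (F : Fin N → Pol N) : actV (s β) (actV (s β) F) = F := by
  rw [← actV_mul, s_mul_self, actV_one]

lemma contr_actV (v : Fin N → ℂ) (g : D.W) (F : Fin N → Pol N) :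
    contr (mat g *ᵥ v) (actV g F) = act g (contr v F) := by
  simp only [contr, actV, map_sum, map_smul, Finset.smul_sum, smul_smul]
  rw [Finset.sum_comm]
  refine Finset.sum_congr rfl fun j _ => ?_
  rw [← Finset.sum_smul]
  congr 1
  have h : mat g⁻¹ *ᵥ (mat g *ᵥ v) = v := by
    rw [mulVec_mulVec, ← mat_mul, inv_mul_cancel, mat_one, one_mulVec]
  rw [mat_inv] at h
  conv_rhs => rw [← h]
  simp only [mulVec, dotProduct, transpose_apply]
  exact Finset.sum_congr rfl fun i _ => mul_comm _ _

open DunklKernel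

section Field

set_option linter.unusedSectionVars false

variable (K : Type*) [Field K] [Algebra (Pol N) K] [IsFractionRing (Pol N) K] [Algebra ℂ K]
  [IsScalarTower ℂ (Pol N) K]

/-- The inclusion of polynomial vector fields in rational vector fields. -/
def emb : (Fin N → Pol N) →ₗ[ℂ] (Fin N → K) where
  toFun F n := algebraMap (Pol N) K (F n)
  map_add' F G := by funext n; exact map_add _ _ _
  map_smul' c F := by
    funext n
    simp only [Pi.smul_apply, RingHom.id_apply]
    rw [algebraMap_csmul, Algebra.smul_def]

lemma emb_apply (F : Fin N → Pol N) (n : Fin N) : emb K F n = algebraMap (Pol N) K (F n) := rfl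

/-- The action of the Weyl group on rational vector fields. -/
def actK (g : D.W) : (Fin N → K) →ₗ[ℂ] (Fin N → K) where
  toFun u n := ∑ j, mat g n j • extAut K (act g) (u j)
  map_add' u v := by funext n; simp [Finset.sum_add_distrib]
  map_smul' c u := by
    funext n
    simp only [Pi.smul_apply, map_smul, RingHom.id_apply, Finset.smul_sum]
    exact Finset.sum_congr rfl fun j _ => smul_comm _ _ _

lemma actK_apply (g : D.W) (u : Fin N → K) (n : Fin N) :
    actK K g u n = ∑ j, mat g n j • extAut K (act g) (u j) := rfl

lemma actK_mul (g h : D.W) (u : Fin N → K) : actK K (g * h) u = actK K g (actK K h u) := by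
  have hh : ∀ x : K, extAut K (act (g * h)) x = extAut K (act g) (extAut K (act h) x) := fun x => by
    rw [map_mul, map_mul]; rfl
  funext n
  simp only [actK_apply, mat_mul, Matrix.mul_apply, hh, map_sum, map_smul, Finset.sum_smul,
    Finset.smul_sum, smul_smul]
  exact Finset.sum_comm

lemma actK_one (u : Fin N → K) : actK K (1 : D.W) u = u := by
  funext n
  simp [actK_apply, mat_one, Matrix.one_apply]

lemma actK_smul (g : D.W) (k : K) (u : Fin N → K) :
    actK K g (k • u) = extAut K (act g) k • actK K g u := by
  funext n
  simp [actK_apply, Finset.mul_sum]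

lemma actK_emb (g : D.W) (F : Fin N → Pol N) : actK K g (emb K F) = emb K (actV g F) := by
  funext n
  simp only [actK_apply, emb_apply, actV, map_sum, algebraMap_csmul, extAut_algebraMap]
  simp only [Algebra.smul_def]

/-- The divided difference attached to a root. -/
def dq (β : D.Root) (F : Fin N → Pol N) : Fin N → K :=
  (algebraMap ℂ K (mul β) / el K β) • emb K (F - actV (s β) F)

lemma actK_dq (g : D.W) (β : D.Root) (F : Fin N → Pol N) :
    actK K g (dq K β F) = dq K (g • β) (actV g F) := by
  rw [dq, actK_smul, actK_emb, actV_sub, ← actV_mul, ← s_conj, actV_mul, map_div₀, extAut_el,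
    AlgEquiv.commutes, dq, mul_smul_root]

lemma dq_neg (β : D.Root) (F : Fin N → Pol N) : dq K (-β) F = -dq K β F := by
  rw [dq, dq, s_neg, mul_neg_root, el, ell_neg, map_neg, ← el, div_neg, neg_smul]

lemma dq_s (β : D.Root) (F : Fin N → Pol N) : dq K β (actV (s β) F) = -dq K β F := by
  rw [dq, dq, actV_s_s, ← smul_neg, ← map_neg, neg_sub]

lemma emb_dirV (ξ : Fin N → ℂ) (F : Fin N → Pol N) (n : Fin N) :
    emb K (dirV ξ F) n = dK K ξ (algebraMap (Pol N) K (F n)) := by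
  rw [dK_algebraMap, emb_apply, dirV, dir_apply]

lemma actK_emb_dirV (g : D.W) (ξ : Fin N → ℂ) (F : Fin N → Pol N) :
    actK K g (emb K (dirV ξ F)) = emb K (dirV (mat g *ᵥ ξ) (actV g F)) := by
  funext n
  rw [actK_apply]
  simp only [emb_dirV, extAut_dK]
  simp only [actV, map_sum, algebraMap_csmul, Derivation.leibniz, ← extAut_algebraMap]
  refine Finset.sum_congr rfl fun j _ => ?_
  rw [Derivation.map_algebraMap, smul_zero, add_zero, Algebra.smul_def, smul_eq_mul, extAut_algebraMap]

end Field

namespace Height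

variable (H : D.Height)

lemma pow_dvd_top {F : Fin N → Pol N} (hF : F ∈ H.Shi) {d : ℤ} (hd : VDegLe d F) (β : D.Root) :
    ell β ^ (2 * mul β) ∣ contr (vec β) (hV d F) := by
  set t := Finset.Icc (-(mul β : ℤ) + H.pos β) (mul β - 1 + H.pos β) with ht
  have hcard : t.card = 2 * mul β := by
    rw [ht, Int.card_Icc]
    omega
  rw [← hZ_contr, ← hcard]
  refine pow_dvd_hZ (vec_ne_zero β) t (hd.contr _) fun i hi => hF β i ?_
  rw [ht, Finset.mem_Icc] at hi
  exact hi

/-- The affine Dunkl-type operator attached to an admissible root, on the two leading components. -/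
lemma Adm.exists_transform {H : D.Height} {α : D.Root} {j : ℤ} (hα : H.Adm α j)
    {F : Fin N → Pol N} (hF : F ∈ H.Shi) {d : ℤ} (hd : VDegLe d F) :
    ∃ F' ∈ H.Shi, VDegLe d F' ∧ hV d F' = actV (s α) (hV d F) ∧ ∃ q : Fin N → Pol N,
      (∀ n, ell α * q n = C (mul α : ℂ) * (hV d F n - actV (s α) (hV d F) n)) ∧
      hV (d - 1) F' = actV (s α) (hV (d - 1) F + dirV ((j : ℂ) • coroot α) (hV d F)) +
        ((1 - 2 * j : ℤ) : ℂ) • q := by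
  obtain ⟨Q, hQ⟩ := hα.exists_quot hF
  have hσ : ∀ i, ((act (s α) : Pol N →ₐ[ℂ] Pol N) (X i)).IsHomogeneous 1 := fun i =>
    act_isHomogeneous (s α) (isHomogeneous_X ℂ i)
  have haff := fun n => hZ_affHom (c := (j : ℂ) • coroot α) hσ (hd n)
  have hdaff : VDegLe d (affV α j F) := fun n => DegLe.sum fun k _ => (haff k).1.smul _
  have htop : hV d (affV α j F) = actV (s α) (hV d F) := by
    funext n
    simp only [hV, affV, actV, map_sum, map_smul]
    exact Finset.sum_congr rfl fun k _ => by rw [aff, (haff k).2.1]; rfl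
  have hsub : hV (d - 1) (affV α j F) =
      actV (s α) (hV (d - 1) F + dirV ((j : ℂ) • coroot α) (hV d F)) := by
    funext n
    simp only [hV, affV, actV, map_sum, map_smul]
    exact Finset.sum_congr rfl fun k _ => by rw [aff, (haff k).2.2]; rfl
  have hdR : ∀ n, DegLe d ((ell α - C (j : ℂ)) * Q n) := fun n => by
    rw [hQ, ← smul_eq_C_mul]
    exact ((hd n).sub (hdaff n)).smul _
  have hdQ : VDegLe (d - 1) Q := fun n => (hdR n).of_lin_mul (vec_ne_zero α)
  refine ⟨_, hα.mem_Shi hF hQ, fun n => ?_, ?_, hV (d - 1) Q, fun n => ?_, ?_⟩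
  · rw [Pi.add_apply, Pi.smul_apply, smul_eq_mul, ← smul_eq_C_mul]
    exact (hdaff n).add (((hdQ n).mono (by omega)).smul _)
  · rw [← htop]
    funext n
    simp only [hV, Pi.add_apply, Pi.smul_apply, smul_eq_mul, ← smul_eq_C_mul, map_add, map_smul]
    rw [hdQ n d (by omega), smul_zero, add_zero]
  · rw [← htop]
    simp only [hV]
    rw [ell, ← hZ_lin_mul_top (vec_ne_zero α) (hdR n), ← ell, hQ, ← smul_eq_C_mul, ← smul_eq_C_mul,
      map_smul, map_sub]
  · rw [← hsub]
    funext n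
    simp only [hV, Pi.add_apply, Pi.smul_apply, smul_eq_mul, ← smul_eq_C_mul, map_add, map_smul]

section Field

set_option linter.unusedSectionVars false

variable (K : Type*) [Field K] [Algebra (Pol N) K] [IsFractionRing (Pol N) K] [Algebra ℂ K]
  [IsScalarTower ℂ (Pol N) K]

/-- The symmetrised subleading component of a vector field. -/
def lam (d : ℤ) (F : Fin N → Pol N) : Fin N → K :=
  emb K (hV (d - 1) F) + (1 / 4 : ℂ) • ∑ β : D.Root, (2 * (H.pos β : ℂ) - 1) • dq K β (hV d F)

/-- The defect of the Dunkl equation in the direction `ξ`. -/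
def defect (ξ : Fin N → ℂ) (f : Fin N → Pol N) : Fin N → K :=
  emb K (dirV ξ f) - (1 / 2 : ℂ) • ∑ β : D.Root, (vec β ⬝ᵥ ξ) • dq K β f

variable {H}

lemma Adm.exists_lam {α : D.Root} {j : ℤ} (hα : H.Adm α j) {F : Fin N → Pol N} (hF : F ∈ H.Shi)
    {d : ℤ} (hd : VDegLe d F) :
    ∃ F' ∈ H.Shi, VDegLe d F' ∧ hV d F' = actV (s α) (hV d F) ∧
      H.lam K d F' = actK K (s α) (H.lam K d F) +
        (j : ℂ) • actK K (s α) (defect (D := D) K (coroot α) (hV d F)) := by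
  obtain ⟨F', h1, h2, h3, q, hq, h4⟩ := hα.exists_transform hF hd
  refine ⟨F', h1, h2, h3, ?_⟩
  set f := hV d F with hf
  set g : D.Root → Fin N → K := fun β => dq K β (actV (s α) f) with hg
  have hqe : emb K q = - g α := by
    rw [hg]
    simp only
    rw [dq_s, neg_neg, dq]
    funext n
    have := congrArg (algebraMap (Pol N) K) (hq n)
    rw [map_mul, map_mul] at this
    simp only [Pi.smul_apply, emb_apply, Pi.sub_apply, smul_eq_mul]
    have hc : algebraMap (Pol N) K (C (mul α : ℂ)) = algebraMap ℂ K (mul α) :=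
      (IsScalarTower.algebraMap_apply ℂ (Pol N) K _).symm
    rw [hc] at this
    rw [div_mul_eq_mul_div, eq_div_iff (el_ne_zero α), mul_comm, ← this]
    rfl
  have hd : dirV ((j : ℂ) • coroot α) f = (j : ℂ) • dirV (coroot α) f := by
    funext n
    simp only [dirV, dir_apply, Pi.smul_apply, smul_eq_mul, Finset.smul_sum, mul_smul]
  have hre : ∀ c : D.Root → ℂ, ∑ β, c β • g (s α • β) = ∑ β, c (s α • β) • g β := by
    intro c
    rw [← Equiv.sum_comp (MulAction.toPerm (s α) : Equiv.Perm D.Root)]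
    refine Finset.sum_congr rfl fun β _ => ?_
    rw [MulAction.toPerm_apply, smul_smul, s_mul_self, one_smul]
  have hkey : ∑ β, ((1 / 4 : ℂ) * ((2 * (H.pos β : ℂ) - 1) - (2 * (H.pos (s α • β) : ℂ) - 1)) -
      1 / 2 * j * cart β α) • g β = (1 - 2 * j : ℂ) • g α := by
    have hc : cart α α = 2 := by
      have : (cart α α : ℝ) = ((2 : ℤ) : ℝ) := by
        rw [← cart_spec, mul_div_assoc, div_self (root_dot_pos α).ne']; norm_num
      exact_mod_cast this
    rw [Fintype.sum_eq_add α (-α) (neg_ne_self α).symm]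
    · have hgn : g (-α) = - g α := dq_neg K α _
      rw [hgn, smul_neg_root, s_smul_self, neg_neg, H.pos_neg, H.pos_of_pos hα.pos, cart_neg_left,
        hc]
      push_cast
      module
    · rintro β ⟨hβ, hβ'⟩
      rw [hα.smul β hβ hβ']
      push_cast
      convert zero_smul ℂ (g β) using 2
      ring
  simp only [lam, defect, h3, h4, ← hf, map_add, map_sub, map_smul, map_sum, actV_add, hd,
    actV_csmul, actK_emb, actK_dq, vec_dot_coroot, hqe]
  change _ + (1 / 4 : ℂ) • ∑ β, (2 * (H.pos β : ℂ) - 1) • g β =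
    _ + (1 / 4 : ℂ) • ∑ β, (2 * (H.pos β : ℂ) - 1) • g (s α • β) +
      (j : ℂ) • (_ - (1 / 2 : ℂ) • ∑ β, (cart β α : ℂ) • g (s α • β))
  rw [hre fun β => 2 * (H.pos β : ℂ) - 1, hre fun β => (cart β α : ℂ)]
  simp only [cart_s_smul, Int.cast_neg, neg_smul, Finset.sum_neg_distrib]
  have hkey' : (1 / 4 : ℂ) • ∑ β, (2 * (H.pos β : ℂ) - 1) • g β -
      (1 / 4 : ℂ) • ∑ β, (2 * (H.pos (s α • β) : ℂ) - 1) • g β -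
      (1 / 2 * (j : ℂ)) • ∑ β, (cart β α : ℂ) • g β = (1 - 2 * j : ℂ) • g α := by
    rw [← hkey]
    simp only [Finset.smul_sum, smul_smul, ← Finset.sum_sub_distrib, ← sub_smul]
    refine Finset.sum_congr rfl fun β _ => ?_
    congr 1
    ring
  push_cast
  linear_combination (norm := module) hkey'

end Field

end Height

end RootDatum

end Catalan

namespace Catalan

open Matrix

variable {N : ℕ}

/-- The homogeneous component of a vector field as a linear map. -/
def hVLin (k : ℤ) : (Fin N → Pol N) →ₗ[ℂ] (Fin N → Pol N) := (hZ k).compLeft (Fin N)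

lemma hVLin_apply (k : ℤ) (F : Fin N → Pol N) : hVLin k F = hV k F := rfl

lemma hV_sub (k : ℤ) (F G : Fin N → Pol N) : hV k (F - G) = hV k F - hV k G :=
  map_sub (hVLin k) F G

lemma hV_add (k : ℤ) (F G : Fin N → Pol N) : hV k (F + G) = hV k F + hV k G :=
  map_add (hVLin k) F G

lemma hV_sum {ι : Type*} (k : ℤ) (t : Finset ι) (F : ι → Fin N → Pol N) :
    hV k (∑ i ∈ t, F i) = ∑ i ∈ t, hV k (F i) :=
  map_sum (hVLin k) F t

lemma VDegLe.add {d : ℤ} {F G : Fin N → Pol N} (hF : VDegLe d F) (hG : VDegLe d G) :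
    VDegLe d (F + G) := fun n => (hF n).add (hG n)

lemma VDegLe.sub {d : ℤ} {F G : Fin N → Pol N} (hF : VDegLe d F) (hG : VDegLe d G) :
    VDegLe d (F - G) := fun n => (hF n).sub (hG n)

lemma VDegLe.sum {ι : Type*} {d : ℤ} {t : Finset ι} {F : ι → Fin N → Pol N}
    (h : ∀ i ∈ t, VDegLe d (F i)) : VDegLe d (∑ i ∈ t, F i) := fun n => by
  rw [Finset.sum_apply]
  exact DegLe.sum fun i hi => h i hi n

lemma VDegLe.sub_hV {d : ℤ} {F : Fin N → Pol N} (hF : VDegLe d F) (h : hV d F = 0) :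
    VDegLe (d - 1) F := fun n => (hF n).sub_hZ (congrFun h n)

lemma VDegLe.eq_zero {d : ℤ} (hd : d < 0) {F : Fin N → Pol N} (hF : VDegLe d F) : F = 0 := by
  funext n
  rcases degLe_iff.mp (hF n) with h | h
  · exact h
  · omega

lemma exists_vDegLe (F : Fin N → Pol N) : ∃ d : ℕ, VDegLe d F :=
  ⟨∑ n, (F n).totalDegree, fun n => degLe_natCast.mpr
    (Finset.single_le_sum (f := fun n => (F n).totalDegree) (fun _ _ => Nat.zero_le _)
      (Finset.mem_univ n))⟩

namespace RootDatum

variable {D : RootDatum N}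

/-- The action on vector fields as a linear map. -/
def actVLin (g : D.W) : (Fin N → Pol N) →ₗ[ℂ] (Fin N → Pol N) where
  toFun := actV g
  map_add' := actV_add g
  map_smul' c F := actV_csmul g c F

lemma actV_sum {ι : Type*} (g : D.W) (t : Finset ι) (F : ι → Fin N → Pol N) :
    actV g (∑ i ∈ t, F i) = ∑ i ∈ t, actV g (F i) :=
  map_sum (actVLin g) F t

namespace Height

section Defect

variable (K : Type*) [Field K] [Algebra (Pol N) K] [IsFractionRing (Pol N) K] [Algebra ℂ K]
  [IsScalarTower ℂ (Pol N) K]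

lemma actK_defect (g : D.W) (ξ : Fin N → ℂ) (f : Fin N → Pol N) :
    actK K g (defect (D := D) K ξ f) = defect (D := D) K (mat g *ᵥ ξ) (actV g f) := by
  simp only [defect, map_sub, map_smul, map_sum, actK_emb_dirV, actK_dq]
  congr 2
  rw [← Equiv.sum_comp (MulAction.toPerm g : Equiv.Perm D.Root)
    fun β => (vec β ⬝ᵥ mat g *ᵥ ξ) • dq K β (actV g f)]
  refine Finset.sum_congr rfl fun β _ => ?_
  rw [MulAction.toPerm_apply, vec_smul, dot_mat]

lemma defect_add (ξ η : Fin N → ℂ) (f : Fin N → Pol N) :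
    defect (D := D) K (ξ + η) f = defect (D := D) K ξ f + defect (D := D) K η f := by
  have h : dirV (ξ + η) f = dirV ξ f + dirV η f := by
    funext n
    simp [dirV, dir_apply, add_smul, Finset.sum_add_distrib]
  simp only [defect, h, map_add, dotProduct_add, add_smul, Finset.sum_add_distrib, smul_add]
  abel

lemma defect_smul (c : ℂ) (ξ : Fin N → ℂ) (f : Fin N → Pol N) :
    defect (D := D) K (c • ξ) f = c • defect (D := D) K ξ f := by
  have h : dirV (c • ξ) f = c • dirV ξ f := by
    funext n
    simp only [dirV, dir_apply, Pi.smul_apply, smul_eq_mul, Finset.smul_sum, mul_smul]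
  simp only [defect, h, map_smul, dotProduct_smul, smul_eq_mul, mul_smul, ← Finset.smul_sum]
  rw [smul_sub, smul_comm c (1 / 2 : ℂ)]

lemma actK_injective (g : D.W) : Function.Injective (actK K g) := fun u v h => by
  have := congrArg (actK K g⁻¹) h
  rwa [← actK_mul, ← actK_mul, inv_mul_cancel, actK_one, actK_one] at this

end Defect

variable (H : D.Height)

lemma exists_shi_ne_zero (hN : 0 < N) : ∃ F ∈ H.Shi, F ≠ 0 := by
  set p : Pol N := ∏ β : D.Root, ∏ i ∈ Finset.Icc (-(mul β : ℤ) + H.pos β) (mul β - 1 + H.pos β),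
    (ell β - C (i : ℂ)) with hp
  refine ⟨p • Pi.single ⟨0, hN⟩ 1, fun β i hi => ?_, fun h => ?_⟩
  · rw [contr_smul]
    refine Dvd.dvd.mul_right ?_ _
    exact (Finset.dvd_prod_of_mem (fun i : ℤ => ell β - C (i : ℂ))
      (Finset.mem_Icc.mpr hi)).trans (Finset.dvd_prod_of_mem (fun β : D.Root =>
        ∏ i ∈ Finset.Icc (-(mul β : ℤ) + H.pos β) (mul β - 1 + H.pos β),
          (ell β - C (i : ℂ))) (Finset.mem_univ β))
  · have := congrFun h ⟨0, hN⟩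
    simp only [Pi.smul_apply, Pi.single_eq_same, smul_eq_mul, mul_one, Pi.zero_apply] at this
    rw [hp, Finset.prod_eq_zero_iff] at this
    obtain ⟨β, -, h⟩ := this
    rw [Finset.prod_eq_zero_iff] at h
    obtain ⟨i, -, h⟩ := h
    exact (prime_ell_sub β i).ne_zero h

/-- The minimal degree of a nonzero element of the Shi module admits vector fields determined by
their top components. -/
lemma exists_minDeg (hN : 0 < N) : ∃ d : ℕ, (∃ F ∈ H.Shi, F ≠ 0 ∧ VDegLe d F) ∧
    ∀ F ∈ H.Shi, VDegLe d F → hV d F = 0 → F = 0 := by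
  classical
  have hex : ∃ d : ℕ, ∃ F ∈ H.Shi, F ≠ 0 ∧ VDegLe d F := by
    obtain ⟨F, hF, h0⟩ := H.exists_shi_ne_zero hN
    obtain ⟨d, hd⟩ := exists_vDegLe F
    exact ⟨d, F, hF, h0, hd⟩
  refine ⟨Nat.find hex, Nat.find_spec hex, fun F hF hd h => ?_⟩
  by_contra h0
  have hd' := hd.sub_hV h
  rcases Nat.eq_zero_or_pos (Nat.find hex) with hz | hz
  · exact h0 (hd'.eq_zero (by omega))
  · refine Nat.find_min hex (m := Nat.find hex - 1) (by omega) ⟨F, hF, h0, ?_⟩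
    rwa [Nat.cast_sub hz, Nat.cast_one]

variable {H}

/-- Elements of the Shi module of degree at most `d`. -/
def shiLe (H : D.Height) (d : ℕ) : Submodule ℂ (Fin N → Pol N) where
  carrier := {F | F ∈ H.Shi ∧ VDegLe d F}
  add_mem' hF hG := ⟨H.Shi.add_mem hF.1 hG.1, hF.2.add hG.2⟩
  zero_mem' := ⟨H.Shi.zero_mem, fun _ _ _ => map_zero _⟩
  smul_mem' c F hF := ⟨by
    have := H.Shi.smul_mem (C c) hF.1
    convert this using 1
    funext n
    simp [smul_eq_C_mul], fun n => (hF.2 n).smul c⟩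

/-- A degree `d` in which elements of the Shi module are determined by their top components. -/
def IsRigid (H : D.Height) (d : ℕ) : Prop := ∀ F ∈ H.Shi, VDegLe d F → hV d F = 0 → F = 0

namespace IsRigid

variable {d : ℕ}

lemma eq_of_hV_eq (hd : H.IsRigid d) {F G : Fin N → Pol N} (hF : F ∈ H.shiLe d)
    (hG : G ∈ H.shiLe d) (h : hV d F = hV d G) : F = G :=
  sub_eq_zero.mp (hd _ (H.Shi.sub_mem hF.1 hG.1) (hF.2.sub hG.2) (by rw [hV_sub, h, sub_self]))

section Field

variable (K : Type*) [Field K] [Algebra (Pol N) K] [IsFractionRing (Pol N) K] [Algebra ℂ K]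
  [IsScalarTower ℂ (Pol N) K]

lemma exists_act (g : D.W) : ∀ F ∈ H.shiLe d, ∃ F' ∈ H.shiLe d,
    hV d F' = actV g (hV d F) ∧ H.lam K d F' = actK K g (H.lam K d F) := by
  induction g using H.simple_induction with
  | hs α hα =>
    intro F hF
    obtain ⟨F', h1, h2, h3, h4⟩ := hα.adm.exists_lam K hF.1 hF.2
    exact ⟨F', ⟨h1, h2⟩, h3, by rw [h4]; simp⟩
  | h1 => exact fun F hF => ⟨F, hF, (actV_one _).symm, (actK_one K _).symm⟩
  | hm g h hg hh =>
    intro F hF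
    obtain ⟨F', h1, h2, h3⟩ := hh F hF
    obtain ⟨F'', h4, h5, h6⟩ := hg F' h1
    exact ⟨F'', h4, by rw [h5, h2, actV_mul], by rw [h6, h3, actK_mul]⟩

lemma defect_coroot (hd : H.IsRigid d) {θ : D.Root} (hθ : H.Adm θ 1) {F : Fin N → Pol N}
    (hF : F ∈ H.shiLe d) : defect (D := D) K (coroot θ) (hV d F) = 0 := by
  obtain ⟨F', h1, h2, h3, h4⟩ := hθ.exists_lam K hF.1 hF.2
  obtain ⟨F'', h5, h6, h7⟩ := exists_act K (s θ) F hF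
  rw [hd.eq_of_hV_eq ⟨h1, h2⟩ h5 (h3.trans h6.symm), h7, Int.cast_one, one_smul,
    left_eq_add] at h4
  exact actK_injective K (s θ) (h4.trans (map_zero _).symm)

lemma defect_eq_zero (hd : H.IsRigid d) (hN : 0 < N) {F : Fin N → Pol N}
    (hF : F ∈ H.shiLe d) (ξ : Fin N → ℂ) : defect (D := D) K ξ (hV d F) = 0 := by
  let U : Submodule ℂ (Fin N → ℂ) :=
    { carrier := {ξ | ∀ F ∈ H.shiLe d, defect (D := D) K ξ (hV d F) = 0}
      add_mem' := fun h1 h2 F hF => by rw [defect_add, h1 F hF, h2 F hF, add_zero]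
      zero_mem' := fun F _ => by
        have := defect_smul (D := D) K 0 0 (hV d F)
        rwa [zero_smul, zero_smul] at this
      smul_mem' := fun c ξ h F hF => by rw [defect_smul, h F hF, smul_zero] }
  obtain ⟨θ, hθ⟩ := H.exists_adm_one hN
  have hU : U = ⊤ := by
    refine irr_complex (D := D) U (fun β v hv F hF => ?_) ?_
    · obtain ⟨F', h1, h2, -⟩ := exists_act K (s β) F hF
      have : hV d F = actV (s β) (hV d F') := by rw [h2, actV_s_s]
      rw [this, ← actK_defect, hv F' h1, map_zero]
    · rw [Submodule.ne_bot_iff]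
      refine ⟨coroot θ, fun F hF => hd.defect_coroot K hθ hF, fun h => ?_⟩
      have h2 := vec_dot_coroot θ θ
      rw [h, dotProduct_zero] at h2
      have hc : cart θ θ = 2 := by
        have : (cart θ θ : ℝ) = ((2 : ℤ) : ℝ) := by
          rw [← cart_spec, mul_div_assoc, div_self (root_dot_pos θ).ne']; norm_num
        exact_mod_cast this
      rw [hc] at h2
      norm_num at h2
  have : ξ ∈ U := hU ▸ Submodule.mem_top
  exact this F hF

end Field

end IsRigid

/-- A Dunkl kernel whose elements are leading components of elements of the Shi module. -/
theorem exists_kernel (H : D.Height) (hN : 0 < N) :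
    ∃ (r : ℕ) (B : D.DunklKernel (Fin r)) (L : Fin r → Fin N → Pol N),
      ∀ i, L i ∈ H.Shi ∧ VDegLe B.deg (L i) ∧ hV B.deg (L i) = B.b i := by
  obtain ⟨d, ⟨F₀, hF₀, hF₀', hd₀⟩, hd⟩ := H.exists_minDeg hN
  replace hd : H.IsRigid d := hd
  set τ : Submodule ℂ (Fin N → Pol N) := (H.shiLe d).map (hVLin d) with hτ
  have hτle : τ ≤ Submodule.pi Set.univ fun _ => homogeneousSubmodule (Fin N) ℂ d := by
    rintro _ ⟨F, -, rfl⟩ n -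
    exact hZ_isHomogeneous d (F n)
  have hfin : FiniteDimensional ℂ τ := by
    have h1 : (Submodule.pi Set.univ fun _ : Fin N => homogeneousSubmodule (Fin N) ℂ d).FG :=
      Submodule.fg_pi fun _ => homogeneousSubmodule_fg _ _ d
    have := Module.Finite.iff_fg.mpr h1
    exact Submodule.finiteDimensional_of_le hτle
  have hact : ∀ g : D.W, ∀ f ∈ τ, actV g f ∈ τ := by
    rintro g _ ⟨F, hF, rfl⟩
    obtain ⟨F', h1, h2, -⟩ := IsRigid.exists_act (FractionRing (Pol N)) g F hF
    exact ⟨F', h1, h2⟩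
  set e := Module.finBasis ℂ τ with he
  have hlift : ∀ i, ∃ F ∈ H.shiLe d, hV d F = (e i : Fin N → Pol N) := fun i => (e i).2
  choose L hL hLe using hlift
  have hind : LinearIndependent ℂ fun i => (e i : Fin N → Pol N) :=
    e.linearIndependent.map' τ.subtype τ.ker_subtype
  let ρ : D.W → Matrix _ _ ℂ := fun g => Matrix.of fun i j => e.repr ⟨_, hact g _ (e j).2⟩ i
  have hρ : ∀ g j, actV g (e j : Fin N → Pol N) = ∑ i, ρ g i j • (e i : Fin N → Pol N) := by
    intro g j
    have := congrArg (Subtype.val) (e.sum_repr ⟨_, hact g _ (e j).2⟩)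
    rw [Submodule.coe_sum] at this
    exact this.symm
  refine ⟨_, ⟨ρ, fun g h => ?_, ?_, fun i => e i, d, fun i n => hτle (e i).2 n trivial, hind, ?_, hρ,
    fun i β => ?_, fun ξ j n => ?_⟩, L, fun i => ⟨(hL i).1, (hL i).2, hLe i⟩⟩
  · ext i j
    have h1 := hρ (g * h) j
    rw [actV_mul, hρ h j, actV_sum] at h1
    simp only [actV_csmul, hρ g, Finset.smul_sum, smul_smul] at h1
    rw [Finset.sum_comm] at h1
    simp only [← Finset.sum_smul] at h1
    have h2 := linearIndependent_iff_injective_fintypeLinearCombination.mp hind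
    have h3 := @h2 (fun i => ∑ k, ρ h k j * ρ g i k) (fun i => ρ (g * h) i j)
      (by simpa only [Fintype.linearCombination_apply] using h1)
    rw [Matrix.mul_apply, ← congrFun h3 i]
    exact Finset.sum_congr rfl fun _ _ => mul_comm _ _
  · ext i j
    have h1 := hρ 1 j
    rw [actV_one] at h1
    have h2 := linearIndependent_iff_injective_fintypeLinearCombination.mp hind
    have h3 := @h2 (fun i => ρ 1 i j) (fun i => (1 : Matrix _ _ ℂ) i j)
      (by simp only [Fintype.linearCombination_apply, ← h1, Matrix.one_apply, ite_smul, one_smul,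
        zero_smul, Finset.sum_ite_eq', Finset.mem_univ, if_true])
    exact congrFun h3 i
  · have h0 : hV d F₀ ≠ 0 := fun h => hF₀' (hd F₀ hF₀ hd₀ h)
    by_contra! hall
    refine h0 ?_
    have hmem : hV d F₀ ∈ τ := ⟨F₀, ⟨hF₀, hd₀⟩, rfl⟩
    have := congrArg Subtype.val (e.sum_repr ⟨_, hmem⟩)
    rw [Submodule.coe_sum] at this
    refine this.symm.trans ?_
    refine Finset.sum_eq_zero fun i _ => ?_
    rw [Submodule.coe_smul, hall, smul_zero]
  · rw [← hLe]
    exact H.pow_dvd_top (hL i).1 (hL i).2 β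
  · have h1 := congrFun (hd.defect_eq_zero (FractionRing (Pol N)) hN (hL j) ξ) n
    rw [hLe, defect, Pi.sub_apply, Pi.zero_apply, sub_eq_zero, emb_apply] at h1
    rw [← dir_apply]
    refine h1.trans ?_
    rw [Finset.smul_sum, Finset.sum_apply]
    refine Finset.sum_congr rfl fun β _ => ?_
    rw [Pi.smul_apply, Pi.smul_apply, Algebra.smul_def, Algebra.smul_def, dq, Pi.smul_apply,
      smul_eq_mul, emb_apply, Pi.sub_apply, map_mul, map_div₀, map_div₀, DunklKernel.el, map_ofNat,
      map_one]
    ring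

end Height

end RootDatum

end Catalan

namespace Catalan

open Matrix

variable {N : ℕ}

lemma DegLe.mul {d e : ℤ} {p q : Pol N} (hp : DegLe d p) (hq : DegLe e q) :
    DegLe (d + e) (p * q) := by
  rw [degLe_iff] at *
  rcases hp with rfl | hp
  · exact .inl (zero_mul _)
  rcases hq with rfl | hq
  · exact .inl (mul_zero _)
  have := totalDegree_mul p q
  exact .inr (by omega)

lemma hZ_mul_top {d : ℕ} {e : ℤ} {p q : Pol N} (hp : DegLe d p) (hq : DegLe e q) :
    hZ (d + e) (p * q) = hZ d p * hZ e q := by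
  have h1 : DegLe (d - 1) (p - hZ d p) := by
    refine DegLe.sub_hZ (hp.sub (DegLe.of_isHomogeneous (hZ_isHomogeneous d p))) ?_
    rw [map_sub, hZ_of_isHomogeneous (hZ_isHomogeneous d p), if_pos rfl, sub_self]
  have h2 := h1.mul hq (d + e) (by omega)
  rw [sub_mul, map_sub, sub_eq_zero] at h2
  rw [h2, mul_comm, hZ_mul (hZ_isHomogeneous d p), add_sub_cancel_left, mul_comm]

lemma prod_top {ι : Type*} (t : Finset ι) (e : ι → ℕ) (x y : ι → Pol N)
    (h : ∀ i ∈ t, DegLe (e i) (x i) ∧ hZ (e i) (x i) = y i) :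
    DegLe (∑ i ∈ t, e i : ℕ) (∏ i ∈ t, x i) ∧
      hZ (∑ i ∈ t, e i : ℕ) (∏ i ∈ t, x i) = ∏ i ∈ t, y i := by
  classical
  induction t using Finset.induction_on with
  | empty =>
    have h1 : (1 : Pol N).IsHomogeneous 0 := isHomogeneous_one _ _
    exact ⟨DegLe.of_isHomogeneous h1, by simp [hZ_of_isHomogeneous h1]⟩
  | insert i t hi ih =>
    obtain ⟨h1, h2⟩ := h i (Finset.mem_insert_self _ _)
    obtain ⟨h3, h4⟩ := ih fun k hk => h k (Finset.mem_insert_of_mem hk)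
    rw [Finset.sum_insert hi, Finset.prod_insert hi, Finset.prod_insert hi, Nat.cast_add]
    exact ⟨h1.mul h3, by rw [hZ_mul_top h1 h3, h2, h4]⟩

lemma VDegLe.smul {d e : ℤ} {p : Pol N} {F : Fin N → Pol N} (hp : DegLe d p) (hF : VDegLe e F) :
    VDegLe (d + e) (p • F) := fun n => hp.mul (hF n)

lemma hV_smul_top {d : ℕ} {e : ℤ} {p : Pol N} {F : Fin N → Pol N} (hp : DegLe d p)
    (hF : VDegLe e F) : hV (d + e) (p • F) = hZ d p • hV e F := by
  funext n
  exact hZ_mul_top hp (hF n)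

namespace RootDatum

variable {D : RootDatum N}

lemma dvd_act_s_sub (α : D.Root) (q : Pol N) : ell α ∣ act (s α) q - q := by
  refine dvd_aut_sub (fun i => ⟨-C (coroot α i), ?_⟩) q
  rw [act_s_X, smul_eq_C_mul]
  ring

lemma dvd_of_odd {α : D.Root} {p : Pol N} (h : act (s α) p = -p) : ell α ∣ p := by
  have h1 := dvd_act_s_sub α p
  rw [h] at h1
  have h2 : p = C (-1 / 2 : ℂ) * (-p - p) := by
    have : (C (-1 / 2 : ℂ) : Pol N) * C (2 : ℂ) = -1 := by rw [← C_mul]; norm_num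
    have h3 : (C (2 : ℂ) : Pol N) = 2 := map_ofNat C 2
    rw [h3] at this
    linear_combination p * this
  rw [h2]
  exact h1.mul_left _

lemma ell_ne_zero (α : D.Root) : ell α ≠ 0 := (prime_ell α).ne_zero

lemma pow_dvd_of_odd {α : D.Root} {p : Pol N} (h : act (s α) p = -p) {k : ℕ}
    (hk : ell α ^ (2 * k) ∣ p) : ell α ^ (2 * k + 1) ∣ p := by
  obtain ⟨q, rfl⟩ := hk
  rw [pow_succ]
  refine mul_dvd_mul_left _ (dvd_of_odd ?_)
  rw [map_mul, map_pow, act_ell, s_smul_self, ell_neg, Even.neg_pow (even_two_mul k),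
    ← mul_neg] at h
  exact mul_left_cancel₀ (pow_ne_zero _ (ell_ne_zero α)) h

lemma actV_s_apply (α : D.Root) (F : Fin N → Pol N) (n : Fin N) :
    actV (s α) F n = act (s α) (F n) - coroot α n • act (s α) (contr (vec α) F) := by
  simp only [actV, mat_s_apply, sub_smul, Finset.sum_sub_distrib, ite_smul, one_smul, zero_smul,
    Finset.sum_ite_eq, Finset.mem_univ, if_true, contr, map_sum, map_smul, Finset.smul_sum,
    smul_smul]

lemma contr_odd {α : D.Root} {F : Fin N → Pol N} (h : actV (s α) F = F) :
    act (s α) (contr (vec α) F) = -contr (vec α) F := by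
  rw [← contr_actV, h, ← vec_smul, s_smul_self, vec_neg, contr_neg_vec]

lemma dvd_of_actV_odd {α : D.Root} {F : Fin N → Pol N} (h : actV (s α) F = -F)
    (hd : ell α ∣ contr (vec α) F) (n : Fin N) : ell α ∣ F n := by
  have h1 := actV_s_apply α F n
  rw [h, Pi.neg_apply] at h1
  have h2 : ell α ∣ act (s α) (contr (vec α) F) := by
    have := map_dvd (act (s α)) hd
    rwa [act_ell, s_smul_self, ell_neg, neg_dvd] at this
  have h3 : F n = C (-1 / 2 : ℂ) * ((act (s α) (F n) - F n) -
      C (coroot α n) * act (s α) (contr (vec α) F)) := by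
    have h4 : (C (-1 / 2 : ℂ) : Pol N) * C (2 : ℂ) = -1 := by rw [← C_mul]; norm_num
    have h5 : (C (2 : ℂ) : Pol N) = 2 := map_ofNat C 2
    rw [h5] at h4
    rw [smul_eq_C_mul] at h1
    linear_combination F n * h4 + C (-1 / 2 : ℂ) * h1
  rw [h3]
  exact (dvd_sub (dvd_act_s_sub α _) (h2.mul_left _)).mul_left _

lemma hZ_act (g : D.W) (k : ℤ) (p : Pol N) : hZ k (act g p) = act g (hZ k p) := by
  conv_lhs => rw [eq_sum_hZ p]
  conv_rhs => rw [eq_sum_hZ p]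
  simp only [map_sum]
  refine Finset.sum_congr rfl fun n _ => ?_
  have h1 := hZ_isHomogeneous n p
  rw [hZ_of_isHomogeneous (act_isHomogeneous g h1), hZ_of_isHomogeneous h1]
  split_ifs <;> simp

lemma DegLe.act {d : ℤ} {p : Pol N} (hp : DegLe d p) (g : D.W) : DegLe d (act g p) :=
  fun k hk => by rw [hZ_act, hp k hk, map_zero]

lemma hV_actV (g : D.W) (k : ℤ) (F : Fin N → Pol N) : hV k (actV g F) = actV g (hV k F) := by
  funext n
  simp only [hV, actV, map_sum, map_smul, hZ_act]

lemma VDegLe_actV {d : ℤ} {F : Fin N → Pol N} (g : D.W) (hF : VDegLe d F) :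
    VDegLe d (actV g F) := fun n k hk => by
  have h1 : hV k F = 0 := funext fun n => hF n k hk
  have h2 := congrFun (hV_actV g k F) n
  rw [h1] at h2
  refine h2.trans ?_
  exact congrFun (map_zero (actVLin g)) n

namespace Height

variable (H : D.Height)

open Classical in
/-- The product of the positive roots. -/
def delta : Pol N := ∏ β : D.Root, if 0 < H.ht β then ell β else 1

open Classical in
/-- The product of the positive roots shifted by their multiplicities. -/
def num : Pol N := ∏ β : D.Root, if 0 < H.ht β then ell β - C ((-mul β : ℤ) : ℂ) else 1

open Classical in
/-- The number of positive roots. -/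
def npos : ℕ := ∑ β : D.Root, if 0 < H.ht β then 1 else 0

lemma delta_isHomogeneous : H.delta.IsHomogeneous H.npos :=
  IsHomogeneous.prod _ _ _ fun β _ => by
    split_ifs
    · exact lin_isHomogeneous _
    · exact isHomogeneous_one _ _

lemma num_top : DegLe H.npos H.num ∧ hZ H.npos H.num = H.delta := by
  refine prod_top _ _ _ _ fun β _ => ?_
  split_ifs with h
  · have h1 : (ell β).IsHomogeneous 1 := lin_isHomogeneous _
    have h0 : (C ((-mul β : ℤ) : ℂ) : Pol N).IsHomogeneous 0 := isHomogeneous_C _ _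
    refine ⟨(DegLe.of_isHomogeneous h1).sub ((DegLe.of_isHomogeneous h0).mono (by norm_num)), ?_⟩
    rw [map_sub, hZ_of_isHomogeneous h1, hZ_of_isHomogeneous h0]
    simp
  · have h1 : (1 : Pol N).IsHomogeneous 0 := isHomogeneous_one _ _
    exact ⟨DegLe.of_isHomogeneous h1, by simp [hZ_of_isHomogeneous h1]⟩

lemma delta_ne_zero : H.delta ≠ 0 := by
  refine Finset.prod_ne_zero_iff.mpr fun β _ => ?_
  split_ifs
  · exact ell_ne_zero β
  · exact one_ne_zero

lemma act_delta (g : D.W) : act g H.delta = H.delta ∨ act g H.delta = -H.delta := by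
  classical
  have h1 : ∏ β : D.Root, ell β =
      (∏ β : D.Root, if 0 < H.ht β then (-1 : Pol N) else 1) * H.delta ^ 2 := by
    have h2 : ∏ β : D.Root, (if 0 < H.ht β then 1 else ell β) =
        (∏ β : D.Root, if 0 < H.ht β then (-1 : Pol N) else 1) * H.delta := by
      rw [delta, ← Finset.prod_mul_distrib, ← Equiv.prod_comp (Equiv.neg D.Root)]
      refine Finset.prod_congr rfl fun β _ => ?_
      rw [Equiv.neg_apply, H.ht_neg, ell_neg]
      rcases lt_or_gt_of_ne (H.ht_ne β) with h | h
      · rw [if_pos (by linarith), if_neg (by linarith), if_neg (by linarith), one_mul]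
      · rw [if_neg (by linarith), if_pos (by linarith), if_pos (by linarith), neg_one_mul]
    rw [pow_two, ← mul_assoc, ← h2, delta, ← Finset.prod_mul_distrib]
    refine Finset.prod_congr rfl fun β _ => ?_
    split_ifs <;> simp
  have h2 : act g (∏ β : D.Root, ell β) = ∏ β : D.Root, ell β := by
    rw [map_prod, ← Equiv.prod_comp (MulAction.toPerm g : Equiv.Perm D.Root) fun β => ell β]
    exact Finset.prod_congr rfl fun β _ => act_ell g β
  set e : Pol N := ∏ β : D.Root, if 0 < H.ht β then (-1 : Pol N) else 1 with he
  have he' : act g e = e := by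
    rw [he, map_prod]
    refine Finset.prod_congr rfl fun β _ => ?_
    split_ifs <;> simp
  have he0 : e ≠ 0 := Finset.prod_ne_zero_iff.mpr fun β _ => by split_ifs <;> simp
  rw [h1, map_mul, he', map_pow] at h2
  exact sq_eq_sq_iff_eq_or_eq_neg.mp (mul_left_cancel₀ he0 h2)

lemma act_s_delta (γ : D.Root) : act (s γ) H.delta = -H.delta := by
  classical
  wlog hγ : 0 < H.ht γ generalizing γ
  · rw [← s_neg]
    exact this (-γ) (H.ht_neg_pos hγ)
  refine (H.act_delta (s γ)).resolve_left fun h => ?_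
  have h1 : H.delta = ell γ * ∏ β ∈ Finset.univ.erase γ, if 0 < H.ht β then ell β else 1 := by
    rw [delta, ← Finset.mul_prod_erase _ _ (Finset.mem_univ γ), if_pos hγ]
  set q : Pol N := ∏ β ∈ Finset.univ.erase γ, if 0 < H.ht β then ell β else 1 with hq
  rw [h1, map_mul, act_ell, s_smul_self, ell_neg, neg_mul, ← mul_neg] at h
  have h2 : act (s γ) q = -q := neg_eq_iff_eq_neg.mp (mul_left_cancel₀ (ell_ne_zero γ) h)
  have h3 := dvd_of_odd h2
  rw [hq, (prime_ell γ).dvd_finsetProd_iff] at h3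
  obtain ⟨β, hβ, h3⟩ := h3
  split_ifs at h3 with hp
  · rcases ell_dvd_ell h3 with rfl | rfl
    · exact (Finset.mem_erase.mp hβ).1 rfl
    · rw [H.ht_neg] at hp
      linarith
  · exact (prime_ell γ).not_isUnit (isUnit_of_dvd_one h3)

lemma delta_dvd {p : Pol N} (h : ∀ γ, 0 < H.ht γ → ell γ ∣ p) : H.delta ∣ p := by
  classical
  refine Finset.prod_dvd_of_isRelPrime (fun β _ γ _ hne => ?_) fun β _ => ?_
  · change IsRelPrime (if 0 < H.ht β then ell β else 1) (if 0 < H.ht γ then ell γ else 1)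
    split_ifs with h1 h2 h2
    · refine (prime_ell β).irreducible.isRelPrime_iff_not_dvd.mpr fun h3 => ?_
      rcases ell_dvd_ell h3 with rfl | rfl
      · exact hne rfl
      · rw [H.ht_neg] at h2
        linarith
    · exact isRelPrime_one_right
    · exact isRelPrime_one_left
    · exact isRelPrime_one_left
  · split_ifs with h1
    · exact h β h1
    · exact one_dvd _

lemma not_dvd_delta {α : D.Root} {j : ℤ} (hj : j ≠ 0) : ¬ ell α - C (j : ℂ) ∣ H.delta := by
  classical
  intro h
  rw [delta, (prime_ell_sub α j).dvd_finsetProd_iff] at h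
  obtain ⟨β, -, h⟩ := h
  split_ifs at h with hp
  · have h' : ell α - C (j : ℂ) ∣ ell β - C 0 := by rwa [C_0, sub_zero]
    rcases ell_sub_C_dvd h' with ⟨-, h0⟩ | ⟨-, h0⟩
    · exact hj (by exact_mod_cast h0.symm)
    · exact hj (by exact_mod_cast neg_eq_zero.mp h0.symm)
  · exact (prime_ell_sub α j).not_isUnit (isUnit_of_dvd_one h)

lemma dvd_num {β : D.Root} (h : 0 < H.ht β) : ell β - C ((-mul β : ℤ) : ℂ) ∣ H.num := by
  classical
  have := Finset.dvd_prod_of_mem (fun β : D.Root => if 0 < H.ht β then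
    ell β - C ((-mul β : ℤ) : ℂ) else 1) (Finset.mem_univ β)
  rwa [if_pos h] at this

lemma dvd_num_mul_contr {F : Fin N → Pol N} (hF : F ∈ H.Shi) (β : D.Root) {j : ℤ}
    (h0 : 0 ≤ j) (hj : j ≤ mul β) : ell β - C (j : ℂ) ∣ H.num * contr (vec β) F := by
  by_cases hβ : 0 < H.ht β
  · rcases Nat.eq_zero_or_pos (mul β) with hm | hm
    · obtain rfl : j = 0 := by omega
      have := H.dvd_num hβ
      rw [hm, Nat.cast_zero, neg_zero] at this
      exact this.mul_right _
    · refine Dvd.dvd.mul_left (hF β j ?_) _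
      rw [Allowed, H.pos_of_pos hβ]
      omega
  · rcases hj.lt_or_eq with hj | rfl
    · refine Dvd.dvd.mul_left (hF β j ?_) _
      rw [Allowed, H.pos_of_neg (H.ht_neg_pos hβ)]
      omega
    · refine Dvd.dvd.mul_right ?_ _
      have := H.dvd_num (H.ht_neg_pos hβ)
      have h2 : ell (-β) - C ((-mul β : ℤ) : ℂ) = -(ell β - C ((mul β : ℤ) : ℂ)) := by
        rw [ell_neg, Int.cast_neg, C_neg]
        ring
      rwa [mul_neg_root, h2, neg_dvd] at this

/-- An invariant leading component of an element of the Shi module is the leading component of an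
invariant logarithmic vector field of the Catalan arrangement. -/
theorem exists_symmetrization {F : Fin N → Pol N} (hF : F ∈ H.Shi) {d : ℕ} (hd : VDegLe d F)
    (hinv : ∀ g : D.W, actV g (hV d F) = hV d F) :
    ∃ Θ : Fin N → Pol N, (∀ g : D.W, actV g Θ = Θ) ∧
      (∀ (α : D.Root) (j : ℤ), -(mul α : ℤ) ≤ j → j ≤ mul α →
        ell α - C (j : ℂ) ∣ contr (vec α) Θ) ∧ VDegLe d Θ ∧ hV d Θ = hV d F := by
  classical
  set G : Fin N → Pol N := ∑ g : D.W, actV g ((H.num * H.delta) • F) with hG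
  have hGinv : ∀ h : D.W, actV h G = G := by
    intro h
    rw [hG, actV_sum, ← Equiv.sum_comp (Equiv.mulLeft h) fun g => actV g ((H.num * H.delta) • F)]
    exact Finset.sum_congr rfl fun g _ => (actV_mul h g _).symm
  have hsq : ∀ g : D.W, act g (H.delta ^ 2) = H.delta ^ 2 := fun g => by
    rw [map_pow]
    rcases H.act_delta g with h | h <;> rw [h]
    exact neg_sq _
  have hcontr : ∀ (α : D.Root) (j : ℤ), 0 ≤ j → j ≤ mul α → ∀ g : D.W,
      ell α - C (j : ℂ) ∣ contr (vec α) (actV g (H.num • F)) := by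
    intro α j h0 hj g
    have h1 := map_dvd (act g) (H.dvd_num_mul_contr hF (g⁻¹ • α) h0 (by rwa [mul_smul_root]))
    rwa [← contr_smul, ← contr_actV, map_sub, act_ell, act_C, ← vec_smul, smul_inv_smul] at h1
  have hex : ∀ g : D.W, ∃ e : Pol N, act g H.delta = e * H.delta := fun g => by
    rcases H.act_delta g with h | h
    · exact ⟨1, by rw [h, one_mul]⟩
    · exact ⟨-1, by rw [h, neg_one_mul]⟩
  choose e he using hex
  set A : Fin N → Pol N := ∑ g : D.W, e g • actV g (H.num • F) with hA
  have hGA : G = H.delta • A := by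
    rw [hG, hA, Finset.smul_sum]
    refine Finset.sum_congr rfl fun g _ => ?_
    rw [mul_comm, mul_smul, actV_smul, he, smul_smul, mul_comm]
  have hAodd : ∀ γ : D.Root, actV (s γ) A = -A := by
    intro γ
    have h1 := hGinv (s γ)
    rw [hGA, actV_smul, H.act_s_delta, neg_smul, ← smul_neg] at h1
    exact neg_eq_iff_eq_neg.mp (smul_right_injective _ H.delta_ne_zero h1)
  have hAdvd : ∀ n, H.delta ∣ A n := fun n => H.delta_dvd fun γ _ => by
    refine dvd_of_actV_odd (hAodd γ) ?_ n
    rw [hA, contr_sum]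
    refine Finset.dvd_sum fun g _ => ?_
    rw [contr_smul]
    have := hcontr γ 0 le_rfl (Nat.cast_nonneg _) g
    rw [Int.cast_zero, C_0, sub_zero] at this
    exact this.mul_left _
  choose Θ hΘ using hAdvd
  have hGΘ : G = H.delta ^ 2 • Θ := by
    rw [hGA, pow_two, mul_smul]
    congr 1
    exact funext hΘ
  have hd0 : H.delta ^ 2 ≠ 0 := pow_ne_zero _ H.delta_ne_zero
  have hdh : (H.delta ^ 2).IsHomogeneous (H.npos * 2) := H.delta_isHomogeneous.pow 2
  have hΘinv : ∀ g : D.W, actV g Θ = Θ := fun g => by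
    have h1 := hGinv g
    rw [hGΘ, actV_smul, hsq] at h1
    exact smul_right_injective _ hd0 h1
  have hΘpos : ∀ (α : D.Root) (j : ℤ), 0 < j → j ≤ mul α →
      ell α - C (j : ℂ) ∣ contr (vec α) Θ := by
    intro α j h0 hj
    have h1 : ell α - C (j : ℂ) ∣ contr (vec α) G := by
      rw [hGA, contr_smul, hA, contr_sum]
      refine Dvd.dvd.mul_left (Finset.dvd_sum fun g _ => ?_) _
      rw [contr_smul]
      exact (hcontr α j h0.le hj g).mul_left _
    rw [hGΘ, contr_smul] at h1
    exact ((prime_ell_sub α j).dvd_or_dvd h1).resolve_left fun h =>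
      H.not_dvd_delta h0.ne' ((prime_ell_sub α j).dvd_of_dvd_pow h)
  have hnd := H.num_top.1.mul (DegLe.of_isHomogeneous H.delta_isHomogeneous)
  have hndF : VDegLe (H.npos + H.npos + d : ℤ) ((H.num * H.delta) • F) := VDegLe.smul hnd hd
  have hGdeg : VDegLe (H.npos + H.npos + d : ℤ) G := by
    rw [hG]
    exact VDegLe.sum fun g _ => VDegLe_actV g hndF
  have hmulV : ∀ k n, hZ k (G n) = hZ (k - (H.npos * 2 : ℕ)) (Θ n) * H.delta ^ 2 := by
    intro k n
    rw [hGΘ, Pi.smul_apply, smul_eq_mul, mul_comm, hZ_mul hdh]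
  have hΘdeg : VDegLe d Θ := fun n k hk => by
    have h1 := hmulV (k + (H.npos * 2 : ℕ)) n
    rw [add_sub_cancel_right, hGdeg n _ (by push_cast; omega)] at h1
    exact (mul_eq_zero.mp h1.symm).resolve_right hd0
  have hΘtop : hV d Θ = (Fintype.card D.W : ℂ) • hV d F := by
    have h1 : hV (H.npos + H.npos + d : ℤ) G = (Fintype.card D.W : ℂ) • (H.delta ^ 2 • hV d F) := by
      rw [hG, hV_sum]
      have : ∀ g : D.W, hV (H.npos + H.npos + d : ℤ) (actV g ((H.num * H.delta) • F)) =
          H.delta ^ 2 • hV d F := by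
        intro g
        rw [hV_actV]
        have h2 := hV_smul_top (d := H.npos + H.npos) (p := H.num * H.delta)
          (by exact_mod_cast hnd) hd
        rw [Nat.cast_add] at h2
        rw [h2, hZ_mul_top H.num_top.1 (DegLe.of_isHomogeneous H.delta_isHomogeneous),
          H.num_top.2, hZ_of_isHomogeneous H.delta_isHomogeneous, if_pos rfl, ← pow_two,
          actV_smul, hsq, hinv]
      rw [Finset.sum_congr rfl fun g _ => this g, Finset.sum_const, Finset.card_univ,
        Nat.cast_smul_eq_nsmul]
    funext n
    have h2 := hmulV (H.npos + H.npos + d : ℤ) n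
    have h3 : (H.npos + H.npos + d : ℤ) - (H.npos * 2 : ℕ) = d := by push_cast; ring
    rw [h3] at h2
    have h4 := congrFun h1 n
    change hZ _ (G n) = _ at h4
    rw [h2] at h4
    refine mul_right_cancel₀ hd0 (h4.trans ?_)
    simp only [Pi.smul_apply, smul_eq_mul, smul_mul_assoc]
    rw [mul_comm]
  have hcard : (Fintype.card D.W : ℂ) ≠ 0 := Nat.cast_ne_zero.mpr Fintype.card_ne_zero
  refine ⟨(Fintype.card D.W : ℂ)⁻¹ • Θ, fun g => by rw [actV_csmul, hΘinv], fun α j h1 h2 => ?_,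
    fun n => (hΘdeg n).smul _, ?_⟩
  · rw [contr_csmul, smul_eq_C_mul]
    refine Dvd.dvd.mul_left ?_ _
    rcases lt_trichotomy j 0 with hj | rfl | hj
    · have h3 := hΘpos (-α) (-j) (by omega) (by rw [mul_neg_root]; omega)
      rwa [neg_dvd_contr, neg_neg] at h3
    · rw [Int.cast_zero, C_0, sub_zero]
      exact dvd_of_odd (contr_odd (hΘinv _))
    · exact hΘpos α j hj h2
  · rw [← hVLin_apply, map_smul, hVLin_apply, hΘtop, smul_smul, inv_mul_cancel₀ hcard, one_smul]

end Height

end RootDatum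

end Catalan

namespace Catalan

open Matrix

variable {N : ℕ}

namespace RootDatum

variable {D : RootDatum N}

/-- Vector fields of the Coxeter multiarrangement with multiplicities `2 * mul β + k`. -/
def logM (D : RootDatum N) (k : ℕ) : Submodule (Pol N) (Fin N → Pol N) where
  carrier := {F | ∀ β : D.Root, ell β ^ (2 * mul β + k) ∣ contr (vec β) F}
  add_mem' hF hG β := by
    rw [contr_add]
    exact dvd_add (hF β) (hG β)
  zero_mem' β := by
    rw [contr_zero]
    exact dvd_zero _
  smul_mem' q F hF β := by
    rw [contr_smul]
    exact (hF β).mul_left _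

lemma actV_mem_logM {k : ℕ} (g : D.W) {F : Fin N → Pol N} (hF : F ∈ D.logM k) :
    actV g F ∈ D.logM k := fun β => by
  have h1 := map_dvd (act g) (hF (g⁻¹ • β))
  rwa [mul_smul_root, map_pow, act_ell, ← contr_actV, ← vec_smul, smul_inv_smul] at h1

lemma hV_mem_logM {k : ℕ} (d : ℤ) {F : Fin N → Pol N} (hF : F ∈ D.logM k) :
    hV d F ∈ D.logM k := fun β => by
  obtain ⟨q, hq⟩ := hF β
  have h1 : (ell β ^ (2 * mul β + k)).IsHomogeneous (1 * (2 * mul β + k)) :=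
    (lin_isHomogeneous (vec β)).pow _
  rw [← hZ_contr, hq, mul_comm _ q, hZ_mul h1]
  exact dvd_mul_left _ _

/-- Invariance of a vector field under the Weyl group. -/
def InvV (D : RootDatum N) (F : Fin N → Pol N) : Prop := ∀ g : D.W, actV g F = F

lemma InvV.mem_logM_one {F : Fin N → Pol N} (hF : D.InvV F) (h : F ∈ D.logM 0) :
    F ∈ D.logM 1 := fun β => pow_dvd_of_odd (contr_odd (hF _)) (h β)

lemma logM_one_le : D.logM 1 ≤ D.logM 0 := fun _ hF β =>
  (pow_dvd_pow _ (Nat.le_succ _)).trans (hF β)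

lemma InvV.hV {F : Fin N → Pol N} (hF : D.InvV F) (d : ℤ) : D.InvV (hV d F) := fun g => by
  rw [← hV_actV, hF]

lemma InvV.sub {F G : Fin N → Pol N} (hF : D.InvV F) (hG : D.InvV G) : D.InvV (F - G) :=
  fun g => by rw [actV_sub, hF, hG]

/-- The algebra of invariant polynomials. -/
def inv (D : RootDatum N) : Subalgebra ℂ (Pol N) where
  carrier := {p | ∀ g : D.W, act g p = p}
  mul_mem' hp hq g := by rw [map_mul, hp, hq]
  add_mem' hp hq g := by rw [map_add, hp, hq]
  algebraMap_mem' c g := act_C g c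

lemma InvV.smul {p : Pol N} {F : Fin N → Pol N} (hp : p ∈ D.inv) (hF : D.InvV F) :
    D.InvV (p • F) := fun g => by rw [actV_smul, hp, hF]

/-- The sum of the translates of a polynomial. -/
def avg (D : RootDatum N) : Pol N →ₗ[ℂ] Pol N :=
  ∑ g : D.W, (act g : Pol N →ₐ[ℂ] Pol N).toLinearMap

lemma avg_apply (p : Pol N) : D.avg p = ∑ g : D.W, act g p := by
  rw [avg, LinearMap.sum_apply]
  rfl

lemma avg_mem_inv (p : Pol N) : D.avg p ∈ D.inv := fun h => by
  rw [avg_apply, map_sum, ← Equiv.sum_comp (Equiv.mulLeft h) fun g => act g p]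
  exact Finset.sum_congr rfl fun g _ => (by rw [Equiv.coe_mulLeft, act_mul])

lemma avg_mul {p : Pol N} (hp : p ∈ D.inv) (q : Pol N) : D.avg (p * q) = p * D.avg q := by
  simp only [avg_apply, Finset.mul_sum, map_mul, hp _]

lemma card_ne_zero : (Fintype.card D.W : ℂ) ≠ 0 := Nat.cast_ne_zero.mpr Fintype.card_ne_zero

/-- The sum of the translates of a vector field. -/
def avgV (D : RootDatum N) : (Fin N → Pol N) →ₗ[ℂ] (Fin N → Pol N) := ∑ g : D.W, actVLin g

lemma avgV_apply (F : Fin N → Pol N) : D.avgV F = ∑ g : D.W, actV g F := by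
  rw [avgV, LinearMap.sum_apply]
  rfl

lemma invV_avgV (F : Fin N → Pol N) : D.InvV (D.avgV F) := fun h => by
  rw [avgV_apply, actV_sum, ← Equiv.sum_comp (Equiv.mulLeft h) fun g => actV g F]
  exact Finset.sum_congr rfl fun g _ => (actV_mul h g F).symm

lemma avgV_mem_logM {k : ℕ} {F : Fin N → Pol N} (hF : F ∈ D.logM k) : D.avgV F ∈ D.logM k := by
  rw [avgV_apply]
  exact Submodule.sum_mem _ fun g _ => actV_mem_logM g hF

lemma avgV_smul {p : Pol N} (hp : p ∈ D.inv) (F : Fin N → Pol N) :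
    D.avgV (p • F) = p • D.avgV F := by
  simp only [avgV_apply, Finset.smul_sum, actV_smul, hp _]

lemma avgV_smul' (p : Pol N) {F : Fin N → Pol N} (hF : D.InvV F) :
    D.avgV (p • F) = D.avg p • F := by
  simp only [avgV_apply, avg_apply, Finset.sum_smul, actV_smul, hF _]

lemma InvV.avgV {F : Fin N → Pol N} (hF : D.InvV F) : D.avgV F = (Fintype.card D.W : ℂ) • F := by
  rw [avgV_apply, Finset.sum_congr rfl fun g _ => hF g, Finset.sum_const, Finset.card_univ,
    Nat.cast_smul_eq_nsmul]

lemma exists_divDiff (α : D.Root) {F : Fin N → Pol N} (hF : F ∈ D.logM 1) :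
    ∃ Q ∈ D.logM 1, ell α • Q = F - actV (s α) F := by
  have hdvd : ∀ n, ell α ∣ F n - actV (s α) F n := by
    intro n
    have h1 : ell α ∣ act (s α) (contr (vec α) F) := by
      have := map_dvd (act (s α)) ((dvd_pow_self (ell α) (Nat.succ_ne_zero _)).trans (hF α))
      rwa [act_ell, s_smul_self, ell_neg, neg_dvd] at this
    have h2 : F n - actV (s α) F n =
        -(act (s α) (F n) - F n) + C (coroot α n) * act (s α) (contr (vec α) F) := by
      rw [actV_s_apply, smul_eq_C_mul]
      ring
    rw [h2]
    exact dvd_add ((dvd_neg (α := Pol N)).mpr (dvd_act_s_sub α _)) (h1.mul_left _)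
  choose Q hQ using hdvd
  have hQe : ell α • Q = F - actV (s α) F := funext fun n => (hQ n).symm
  have hQα : ell α ^ (2 * mul α + 1) ∣ contr (vec α) Q := by
    obtain ⟨q, hq⟩ := hF α
    have h1 : contr (vec α) (actV (s α) F) = ell α ^ (2 * mul α + 1) * act (s α) q := by
      have h2 := contr_actV (-vec α) (s α) F
      rw [mulVec_neg, ← vec_smul, s_smul_self, vec_neg, neg_neg, contr_neg_vec, hq, map_neg,
        map_mul, map_pow, act_ell, s_smul_self, ell_neg,
        Odd.neg_pow (odd_two_mul_add_one (mul α))] at h2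
      rw [h2]
      ring
    have h3 := congrArg (contr (vec α)) hQe
    rw [contr_smul, contr_sub, h1, hq, ← mul_sub] at h3
    obtain ⟨t, ht⟩ := dvd_act_s_sub α q
    refine ⟨-t, mul_left_cancel₀ (ell_ne_zero α) ?_⟩
    rw [h3]
    linear_combination (-(ell α ^ (2 * mul α + 1))) * ht
  refine ⟨Q, fun β => ?_, hQe⟩
  by_cases h1 : β = α
  · rw [h1]; exact hQα
  by_cases h2 : β = -α
  · rw [h2, ell_neg, vec_neg, contr_neg_vec, dvd_neg, mul_neg_root,
      Odd.neg_pow (odd_two_mul_add_one (mul α)), neg_dvd]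
    exact hQα
  have h3 : ell β ^ (2 * mul β + 1) ∣ ell α * contr (vec β) Q := by
    rw [← contr_smul, hQe]
    exact (D.logM 1).sub_mem hF (actV_mem_logM _ hF) β
  refine (prime_ell β).pow_dvd_of_dvd_mul_left _ (fun h => ?_) h3
  rcases ell_dvd_ell h with h | h
  · exact h1 h.symm
  · exact h2 (by rw [h, neg_neg])

/-- `D_m` is generated by its invariant elements. -/
theorem logM_one_le_span :
    D.logM 1 ≤ Submodule.span (Pol N) {F | F ∈ D.logM 1 ∧ D.InvV F} := by
  set M := Submodule.span (Pol N) {F | F ∈ D.logM 1 ∧ D.InvV F} with hM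
  have hstab : ∀ g : D.W, ∀ F ∈ M, actV g F ∈ M := by
    intro g F hF
    induction hF using Submodule.span_induction with
    | mem F h => rw [h.2]; exact Submodule.subset_span h
    | zero => rw [← zero_smul (Pol N) (0 : Fin N → Pol N), actV_smul, map_zero, zero_smul]
              exact M.zero_mem
    | add F G _ _ h1 h2 => rw [actV_add]; exact M.add_mem h1 h2
    | smul p F _ h => rw [actV_smul]; exact M.smul_mem _ h
  have key : ∀ d : ℕ, ∀ F ∈ D.logM 1, VDegLe (d - 1) F → F ∈ M := by
    intro d
    induction d with
    | zero =>
      intro F _ hd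
      rw [hd.eq_zero (by norm_num)]
      exact M.zero_mem
    | succ d ih =>
      intro F hF hd
      have h1 : ∀ g : D.W, F - actV g F ∈ M := by
        intro g
        induction g using W_induction with
        | hs α =>
          obtain ⟨Q, hQ, hQe⟩ := exists_divDiff α hF
          rw [← hQe]
          refine M.smul_mem _ (ih Q hQ fun n => ?_)
          push_cast at hd
          have h2 : DegLe d ((ell α - C 0) * Q n) := by
            have h3 := congrFun hQe n
            rw [Pi.smul_apply, smul_eq_mul] at h3
            rw [C_0, sub_zero, h3]
            have h4 := hd.sub (VDegLe_actV (s α) hd) n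
            rwa [add_sub_cancel_right] at h4
          exact h2.of_lin_mul (vec_ne_zero α)
        | h1 => rw [actV_one, sub_self]; exact M.zero_mem
        | hm g h hg hh =>
          have : F - actV (g * h) F = (F - actV g F) + actV g (F - actV h F) := by
            rw [actV_sub, actV_mul]; abel
          rw [this]
          exact M.add_mem hg (hstab g _ hh)
      have h2 : (Fintype.card D.W : ℂ) • F = D.avgV F + ∑ g : D.W, (F - actV g F) := by
        rw [avgV_apply, ← Finset.sum_add_distrib]
        simp only [add_sub_cancel, Finset.sum_const, Finset.card_univ, Nat.cast_smul_eq_nsmul]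
      have h3 : (C (Fintype.card D.W : ℂ) : Pol N) • F ∈ M := by
        have : (C (Fintype.card D.W : ℂ) : Pol N) • F = (Fintype.card D.W : ℂ) • F := by
          funext n
          simp only [Pi.smul_apply, smul_eq_C_mul, smul_eq_mul]
        rw [this, h2]
        exact M.add_mem (Submodule.subset_span ⟨avgV_mem_logM hF, invV_avgV F⟩)
          (Submodule.sum_mem _ fun g _ => h1 g)
      have h4 := M.smul_mem (C (Fintype.card D.W : ℂ)⁻¹) h3
      rwa [smul_smul, ← C_mul, inv_mul_cancel₀ card_ne_zero, C_1, one_smul] at h4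
  intro F hF
  obtain ⟨d, hd⟩ := exists_vDegLe F
  exact key (d + 1) F hF (by push_cast; rwa [add_sub_cancel_right])

/-- The ideal of `S` generated by invariants without constant term. -/
def hilb (D : RootDatum N) : Ideal (Pol N) :=
  Ideal.span {p | p ∈ D.inv ∧ constantCoeff p = 0}

lemma act_mem_hilb (g : D.W) {p : Pol N} (hp : p ∈ D.hilb) : act g p ∈ D.hilb := by
  induction hp using Submodule.span_induction with
  | mem p h => rw [h.1]; exact Ideal.subset_span h
  | zero => rw [map_zero]; exact D.hilb.zero_mem
  | add p q _ _ h1 h2 => rw [map_add]; exact D.hilb.add_mem h1 h2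
  | smul r p _ h => rw [smul_eq_mul, map_mul]; exact D.hilb.mul_mem_left _ h

/-- Chevalley's argument: a linear form vanishing on the constant terms of invariant relations maps
all relations into the Hilbert ideal. -/
lemma sum_mem_hilb {r : ℕ} {f : Fin r → Pol N} (hf : ∀ j, f j ∈ D.inv) (l : Fin r → ℂ)
    (hl : ∀ c : Fin r → Pol N, (∀ j, c j ∈ D.inv) → ∑ j, f j * c j = 0 →
      ∑ j, l j * constantCoeff (c j) = 0) {g : Fin r → Pol N} (hg : ∑ j, f j * g j = 0) :
    ∑ j, l j • g j ∈ D.hilb := by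
  have key : ∀ d : ℕ, ∀ g : Fin r → Pol N, ∑ j, f j * g j = 0 →
      DegLe (d - 1) (∑ j, l j • g j) → ∑ j, l j • g j ∈ D.hilb := by
    intro d
    induction d with
    | zero =>
      intro g _ hd
      rcases degLe_iff.mp hd with h | h
      · rw [h]; exact D.hilb.zero_mem
      · push_cast at h; omega
    | succ d ih =>
      intro g hg hd
      set p := ∑ j, l j • g j with hp
      have hs : ∀ w : D.W, p - act w p ∈ D.hilb := by
        intro w
        induction w using W_induction with
        | hs α =>
          have h1 : ∀ j, ∃ q, g j - act (s α) (g j) = ell α * q := fun j => by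
            have := dvd_act_s_sub α (g j)
            rwa [dvd_sub_comm] at this
          choose q hq using h1
          have h2 : p - act (s α) p = ell α * ∑ j, l j • q j := by
            rw [hp, map_sum, ← Finset.sum_sub_distrib, Finset.mul_sum]
            refine Finset.sum_congr rfl fun j _ => ?_
            rw [map_smul, ← smul_sub, hq, mul_smul_comm]
          rw [h2]
          refine D.hilb.mul_mem_left _ (ih q ?_ ?_)
          · refine mul_left_cancel₀ (ell_ne_zero α) ?_
            have h3 : ∑ j, f j * (act (s α) (g j)) = 0 := by
              have := congrArg (act (s α)) hg
              rw [map_sum, map_zero] at this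
              simpa only [map_mul, hf _ _] using this
            rw [mul_zero, Finset.mul_sum, ← sub_zero (0 : Pol N)]
            nth_rewrite 1 [← hg]
            rw [← h3, ← Finset.sum_sub_distrib]
            refine Finset.sum_congr rfl fun j _ => ?_
            rw [← mul_sub, hq]
            ring
          · push_cast at hd
            rw [add_sub_cancel_right] at hd
            have h4 : DegLe d ((ell α - C 0) * ∑ j, l j • q j) := by
              rw [C_0, sub_zero, ← h2]
              exact hd.sub (DegLe.act hd _)
            exact h4.of_lin_mul (vec_ne_zero α)
        | h1 => rw [act_one, sub_self]; exact D.hilb.zero_mem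
        | hm u v hu hv =>
          have : p - act (u * v) p = (p - act u p) + act u (p - act v p) := by
            rw [map_sub, act_mul]; ring
          rw [this]
          exact D.hilb.add_mem hu (act_mem_hilb u hv)
      have h1 : D.avg p ∈ D.hilb := by
        refine Ideal.subset_span ⟨avg_mem_inv p, ?_⟩
        have h2 := hl (fun j => D.avg (g j)) (fun j => avg_mem_inv _) (by
          rw [← map_zero D.avg, ← hg, map_sum]
          exact Finset.sum_congr rfl fun j _ => (avg_mul (hf j) _).symm)
        rw [← h2, hp]
        simp only [map_sum, map_smul]
        exact Finset.sum_congr rfl fun j _ => by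
          rw [smul_eq_C_mul, map_mul, constantCoeff_C]
      have h2 : (Fintype.card D.W : ℂ) • p = D.avg p + ∑ w : D.W, (p - act w p) := by
        rw [avg_apply, ← Finset.sum_add_distrib]
        simp only [add_sub_cancel, Finset.sum_const, Finset.card_univ, Nat.cast_smul_eq_nsmul]
      have h3 : C (Fintype.card D.W : ℂ) * p ∈ D.hilb := by
        rw [← smul_eq_C_mul, h2]
        exact D.hilb.add_mem h1 (Submodule.sum_mem _ fun w _ => hs w)
      have h4 := D.hilb.mul_mem_left (C (Fintype.card D.W : ℂ)⁻¹) h3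
      rwa [← mul_assoc, ← C_mul, inv_mul_cancel₀ card_ne_zero, C_1, one_mul] at h4
  refine key ((∑ j, l j • g j).totalDegree + 1) g hg ?_
  push_cast
  rw [add_sub_cancel_right]
  exact degLe_natCast.mpr le_rfl

end RootDatum

end Catalan

namespace Catalan

variable {N : ℕ}

lemma hV_smul_hom {p : Pol N} {e : ℕ} (hp : p.IsHomogeneous e) (k : ℤ) (F : Fin N → Pol N) :
    hV k (p • F) = p • hV (k - e) F := funext fun n => by
  change hZ k (p * F n) = p * hZ (k - e) (F n)
  rw [mul_comm, hZ_mul hp, mul_comm]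

lemma DegLe.hZ_self (d : ℤ) (p : Pol N) : DegLe d (hZ d p) := by
  rcases lt_or_ge d 0 with h | h
  · rw [hZ_neg h]
    exact fun k _ => map_zero _
  · lift d to ℕ using h
    exact DegLe.of_isHomogeneous (hZ_isHomogeneous d _)

lemma hZ_hZ_self (d : ℤ) (p : Pol N) : hZ d (hZ d p) = hZ d p := by
  rcases lt_or_ge d 0 with h | h
  · rw [hZ_neg h, hZ_neg h]
  · lift d to ℕ using h
    rw [hZ_of_isHomogeneous (hZ_isHomogeneous d p), if_pos rfl]

lemma VDegLe.hV_self (d : ℤ) (F : Fin N → Pol N) : VDegLe d (hV d F) :=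
  fun n => DegLe.hZ_self d (F n)

lemma VDegLe.mono {d e : ℤ} {F : Fin N → Pol N} (h : VDegLe d F) (hde : d ≤ e) : VDegLe e F :=
  fun n => (h n).mono hde

lemma hV_of_isHomogeneous {F : Fin N → Pol N} {d : ℕ} (hF : ∀ n, (F n).IsHomogeneous d) (k : ℤ) :
    hV k F = if k = d then F else 0 := funext fun n => by
  change hZ k (F n) = _
  rw [hZ_of_isHomogeneous (hF n)]
  split_ifs <;> rfl

lemma hZ_zero (p : Pol N) : hZ 0 p = C (constantCoeff p) := by
  have := hZ_natCast 0 p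
  rw [Nat.cast_zero] at this
  rw [this, homogeneousComponent_zero, constantCoeff_eq]

namespace RootDatum

variable {D : RootDatum N}

/-- The span of the products of invariant vector fields by invariants without constant term. -/
def decomposables (D : RootDatum N) : Submodule ℂ (Fin N → Pol N) :=
  Submodule.span ℂ {G | ∃ p ∈ D.inv, constantCoeff p = 0 ∧ ∃ F ∈ D.logM 0, D.InvV F ∧ G = p • F}

lemma avgV_smul_mem {p : Pol N} (hp : p ∈ D.hilb) :
    ∀ F ∈ D.logM 0, D.avgV (p • F) ∈ D.decomposables := by
  induction hp using Submodule.span_induction with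
  | mem p h =>
    intro F hF
    rw [avgV_smul h.1]
    exact Submodule.subset_span ⟨p, h.1, h.2, _, avgV_mem_logM hF, invV_avgV F, rfl⟩
  | zero =>
    intro F _
    rw [zero_smul, map_zero]
    exact D.decomposables.zero_mem
  | add p q _ _ hp hq =>
    intro F hF
    rw [add_smul, map_add]
    exact D.decomposables.add_mem (hp F hF) (hq F hF)
  | smul a p _ hp =>
    intro F hF
    rw [smul_assoc, smul_comm]
    exact hp _ ((D.logM 0).smul_mem a hF)

lemma InvV.mem_decomposables {ι : Type*} [Fintype ι] {F : Fin N → Pol N} (hF : D.InvV F)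
    {b : ι → Fin N → Pol N} (hb : ∀ i, b i ∈ D.logM 0) {H : ι → Pol N} (hH : ∀ i, H i ∈ D.hilb)
    (h : F = ∑ i, H i • b i) : F ∈ D.decomposables := by
  have h1 : D.avgV F ∈ D.decomposables := by
    rw [h, map_sum]
    exact Submodule.sum_mem _ fun i _ => avgV_smul_mem (hH i) _ (hb i)
  rw [hF.avgV] at h1
  have h2 := D.decomposables.smul_mem (Fintype.card D.W : ℂ)⁻¹ h1
  rwa [smul_smul, inv_mul_cancel₀ card_ne_zero, one_smul] at h2

/-- Invariant vector fields independent modulo decomposables are independent over invariants. -/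
lemma eq_zero_of_indep {ι : Type*} [Fintype ι] [DecidableEq ι] (B : D.DunklKernel ι) {r : ℕ}
    {h : Fin r → Fin N → Pol N} (hI : ∀ j, D.InvV (h j)) (hM : ∀ j, h j ∈ D.logM 0)
    (hl : ∀ l : Fin r → ℂ, ∑ j, l j • h j ∈ D.decomposables → l = 0)
    {f : Fin r → Pol N} (hf : ∀ j, f j ∈ D.inv) (hs : ∑ j, f j • h j = 0) : f = 0 := by
  set V : Submodule ℂ (Fin r → ℂ) :=
    { carrier := {v | ∃ c : Fin r → Pol N, (∀ j, c j ∈ D.inv) ∧ ∑ j, f j * c j = 0 ∧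
        ∀ j, v j = constantCoeff (c j)}
      add_mem' := by
        rintro v w ⟨c, hc, hc0, hv⟩ ⟨d, hd, hd0, hw⟩
        refine ⟨c + d, fun j => D.inv.add_mem (hc j) (hd j), ?_, fun j => ?_⟩
        · simp only [Pi.add_apply, mul_add, Finset.sum_add_distrib, hc0, hd0, add_zero]
        · rw [Pi.add_apply, Pi.add_apply, map_add, hv, hw]
      zero_mem' := ⟨0, fun j => D.inv.zero_mem, by simp, fun j => by simp⟩
      smul_mem' := by
        rintro a v ⟨c, hc, hc0, hv⟩
        refine ⟨a • c, fun j => D.inv.smul_mem (hc j) a, ?_, fun j => ?_⟩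
        · simp only [Pi.smul_apply, mul_smul_comm, ← Finset.smul_sum, hc0, smul_zero]
        · rw [Pi.smul_apply, Pi.smul_apply, smul_eq_C_mul, map_mul, constantCoeff_C, hv,
            smul_eq_mul] } with hV
  have hVtop : V = ⊤ := by
    by_contra hne
    obtain ⟨φ, hφ0, hφ⟩ := Submodule.exists_le_ker_of_lt_top V (lt_top_iff_ne_top.mpr hne)
    have hφe : ∀ v, φ v = ∑ j, φ (Pi.single j 1) * v j := fun v => by
      conv_lhs => rw [pi_eq_sum_univ' v]
      rw [map_sum]
      refine Finset.sum_congr rfl fun j _ => ?_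
      rw [map_smul, smul_eq_mul, mul_comm]
    choose H hH using fun j => B.exists_eq_sum (h j) (hM j)
    have h1 : ∀ i, ∑ j, f j * H j i = 0 := by
      refine B.eq_zero_of_sum_eq_zero (fun i => ∑ j, f j * H j i) fun n => ?_
      have := congrFun hs n
      simp only [Finset.sum_apply, Pi.smul_apply, smul_eq_mul, Pi.zero_apply, hH,
        Finset.mul_sum] at this
      rw [Finset.sum_comm] at this
      rw [← this]
      exact Finset.sum_congr rfl fun i _ => by
        rw [Finset.sum_mul]
        exact Finset.sum_congr rfl fun j _ => by ring
    have h2 : ∀ i, ∑ j, φ (Pi.single j 1) • H j i ∈ D.hilb := fun i => by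
      refine sum_mem_hilb hf _ (fun c hc hc0 => ?_) (h1 i)
      have h3 : (fun j => constantCoeff (c j)) ∈ V := ⟨c, hc, hc0, fun j => rfl⟩
      have h4 := hφ h3
      rwa [LinearMap.mem_ker, hφe] at h4
    have h3 := hl (fun j => φ (Pi.single j 1)) (by
      refine InvV.mem_decomposables (fun g => ?_) (b := B.b) (fun i => B.mem i) h2 ?_
      · rw [actV_sum]
        exact Finset.sum_congr rfl fun j _ => by rw [actV_csmul, hI]
      · funext n
        simp only [Finset.sum_apply, Pi.smul_apply, smul_eq_mul, hH, Finset.sum_mul,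
          Finset.smul_sum, smul_mul_assoc]
        exact Finset.sum_comm)
    refine hφ0 (LinearMap.ext fun v => ?_)
    rw [hφe, LinearMap.zero_apply]
    exact Finset.sum_eq_zero fun j _ => by rw [congrFun h3 j, Pi.zero_apply, zero_mul]
  have h1 : ∀ k : Fin r, ∃ c : Fin r → Pol N, (∀ j, c j ∈ D.inv) ∧ ∑ j, f j * c j = 0 ∧
      ∀ j, (Pi.single k 1 : Fin r → ℂ) j = constantCoeff (c j) := fun k => by
    have : (Pi.single k 1 : Fin r → ℂ) ∈ V := by rw [hVtop]; trivial
    exact this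
  choose c hc hc0 hc1 using h1
  refine Matrix.eq_zero_of_mulVec_eq_zero (M := Matrix.of c) (fun h0 => ?_) (funext fun k => ?_)
  · have h2 := congrArg constantCoeff h0
    rw [RingHom.map_det, map_zero] at h2
    have h3 : (constantCoeff (R := ℂ) (σ := Fin N)).mapMatrix (Matrix.of c) = 1 := by
      ext i j
      rw [RingHom.mapMatrix_apply, Matrix.map_apply, Matrix.of_apply, ← hc1, Pi.single_apply,
        Matrix.one_apply]
      simp only [eq_comm]
    rw [h3, Matrix.det_one] at h2
    exact one_ne_zero h2
  · rw [Matrix.mulVec, dotProduct, Pi.zero_apply, ← hc0 k]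
    exact Finset.sum_congr rfl fun j _ => mul_comm _ _

open Classical in
lemma linearIndependent_of_inv {r : ℕ} {h : Fin r → Fin N → Pol N} (hI : ∀ j, D.InvV (h j))
    (hs : ∀ f : Fin r → Pol N, (∀ j, f j ∈ D.inv) → ∑ j, f j • h j = 0 → f = 0) :
    LinearIndependent (Pol N) h := by
  rw [Fintype.linearIndependent_iff]
  intro a ha i
  by_contra hai
  set p : Pol N := ∏ w ∈ Finset.univ.erase (1 : D.W), act w (a i) with hp
  have h1 : (fun j => D.avg (p * a j)) = 0 := hs _ (fun j => avg_mem_inv _) (by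
    rw [← map_zero D.avgV, ← smul_zero p, ← ha, Finset.smul_sum, map_sum]
    exact Finset.sum_congr rfl fun j _ => by rw [smul_smul, avgV_smul' _ (hI j)])
  have h2 : p * a i = ∏ w : D.W, act w (a i) := by
    rw [← Finset.prod_erase_mul _ _ (Finset.mem_univ (1 : D.W)), act_one]
  have h3 : p * a i ∈ D.inv := fun g => by
    rw [h2, map_prod, ← Equiv.prod_comp (Equiv.mulLeft g) fun w => act w (a i)]
    exact Finset.prod_congr rfl fun w _ => by rw [Equiv.coe_mulLeft, act_mul]
  have h4 := congrFun h1 i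
  simp only [avg_apply, h3 _, Finset.sum_const, Finset.card_univ, Pi.zero_apply] at h4
  rw [← Nat.cast_smul_eq_nsmul ℂ, smul_eq_zero, or_iff_right card_ne_zero, h2,
    Finset.prod_eq_zero_iff] at h4
  obtain ⟨w, _, hw⟩ := h4
  exact hai ((map_eq_zero_iff _ (act w).injective).mp hw)

/-- Combinations of given vector fields with invariant coefficients. -/
def gen (D : RootDatum N) {r : ℕ} (h : Fin r → Fin N → Pol N) : Submodule ℂ (Fin N → Pol N) where
  carrier := {F | ∃ c : Fin r → Pol N, (∀ j, c j ∈ D.inv) ∧ F = ∑ j, c j • h j}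
  add_mem' := by
    rintro _ _ ⟨c, hc, rfl⟩ ⟨d, hd, rfl⟩
    exact ⟨c + d, fun j => D.inv.add_mem (hc j) (hd j), by
      simp only [Pi.add_apply, add_smul, Finset.sum_add_distrib]⟩
  zero_mem' := ⟨0, fun j => D.inv.zero_mem, by simp⟩
  smul_mem' := by
    rintro a _ ⟨c, hc, rfl⟩
    exact ⟨a • c, fun j => D.inv.smul_mem (hc j) a, by
      simp only [Pi.smul_apply, smul_assoc, Finset.smul_sum]⟩

variable {r : ℕ} {h : Fin r → Fin N → Pol N}

lemma smul_mem_gen {p : Pol N} (hp : p ∈ D.inv) {F : Fin N → Pol N} (hF : F ∈ D.gen h) :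
    p • F ∈ D.gen h := by
  obtain ⟨c, hc, rfl⟩ := hF
  exact ⟨fun j => p * c j, fun j => D.inv.mul_mem hp (hc j), by
    simp only [mul_smul, Finset.smul_sum]⟩

open Classical in
lemma self_mem_gen (j : Fin r) : h j ∈ D.gen h := by
  refine ⟨Pi.single j 1, fun i => ?_, ?_⟩
  · rw [Pi.single_apply]
    split_ifs
    · exact D.inv.one_mem
    · exact D.inv.zero_mem
  · rw [Finset.sum_eq_single j (fun i _ hi => by rw [Pi.single_eq_of_ne hi, zero_smul])
      (fun h => absurd (Finset.mem_univ _) h), Pi.single_eq_same, one_smul]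

lemma hZ_mem_inv (k : ℤ) {p : Pol N} (hp : p ∈ D.inv) : hZ k p ∈ D.inv := fun g => by
  rw [← hZ_act, hp]

/-- Graded Nakayama lemma. -/
lemma mem_gen_of_sup {e : Fin r → ℕ} (he : ∀ j n, (h j n).IsHomogeneous (e j))
    (hsup : ∀ d : ℕ, ∀ F ∈ D.logM 0, D.InvV F → (∀ n, (F n).IsHomogeneous d) →
      ∃ l : Fin r → ℂ, F - ∑ j, l j • h j ∈ D.decomposables) :
    ∀ F ∈ D.logM 0, D.InvV F → F ∈ D.gen h := by
  have key : ∀ d : ℕ, ∀ F ∈ D.logM 0, D.InvV F → VDegLe ((d : ℤ) - 1) F → F ∈ D.gen h := by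
    intro d
    induction d with
    | zero =>
      intro F _ _ hd
      rw [VDegLe.eq_zero (by norm_num) hd]
      exact (D.gen h).zero_mem
    | succ d ih =>
      intro F hF hI hd
      push_cast at hd
      rw [add_sub_cancel_right] at hd
      have hdec : ∀ G ∈ D.decomposables, hV d G ∈ D.gen h := by
        intro G hG
        induction hG using Submodule.span_induction with
        | zero =>
          rw [← hVLin_apply, map_zero]
          exact (D.gen h).zero_mem
        | add x y _ _ hx hy =>
          rw [hV_add]
          exact (D.gen h).add_mem hx hy
        | smul a x _ hx =>
          rw [← hVLin_apply, map_smul]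
          exact (D.gen h).smul_mem a hx
        | mem x hx =>
          obtain ⟨p, hp, hp0, G, hG, hGI, rfl⟩ := hx
          nth_rewrite 1 [eq_sum_hZ p]
          rw [Finset.sum_smul, hV_sum]
          refine Submodule.sum_mem _ fun n _ => ?_
          rw [hV_smul_hom (hZ_isHomogeneous n p)]
          rcases Nat.eq_zero_or_pos n with rfl | hn
          · rw [Nat.cast_zero, hZ_zero, hp0, C_0, zero_smul]
            exact (D.gen h).zero_mem
          · refine smul_mem_gen (hZ_mem_inv _ hp) (ih _ (hV_mem_logM _ hG) (hGI.hV _) ?_)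
            exact (VDegLe.hV_self _ _).mono (by omega)
      have h1 : hV d F ∈ D.gen h := by
        obtain ⟨l, hl⟩ := hsup d (hV d F) (hV_mem_logM _ hF) (hI.hV _)
          fun n => hZ_isHomogeneous d (F n)
        have h2 := hdec _ hl
        have h3 : hV d (hV (d : ℤ) F) = hV d F := by
          rw [hV_of_isHomogeneous (F := hV (d : ℤ) F) fun n => hZ_isHomogeneous d (F n),
            if_pos rfl]
        rw [hV_sub, h3, hV_sum] at h2
        rw [← sub_add_cancel (hV d F) (∑ j, hV d (l j • h j))]
        refine (D.gen h).add_mem h2 (Submodule.sum_mem _ fun j _ => ?_)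
        rw [← hVLin_apply, map_smul, hVLin_apply, hV_of_isHomogeneous (he j)]
        refine (D.gen h).smul_mem _ ?_
        split_ifs
        · exact self_mem_gen j
        · exact (D.gen h).zero_mem
      rw [← sub_add_cancel F (hV d F)]
      refine (D.gen h).add_mem (ih _ ((D.logM 0).sub_mem hF (hV_mem_logM _ hF))
        (hI.sub (hI.hV _)) ?_) h1
      refine (hd.sub (VDegLe.hV_self _ _)).sub_hV ?_
      rw [hV_sub, hV_of_isHomogeneous (F := hV (d : ℤ) F) fun n => hZ_isHomogeneous d (F n),
        if_pos rfl, sub_self]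
  intro F hF hI
  obtain ⟨d, hd⟩ := exists_vDegLe F
  exact key (d + 1) F hF hI (by push_cast; rwa [add_sub_cancel_right])

/-- A homogeneous basis of the invariant logarithmic vector fields. -/
theorem exists_basis {ι : Type*} [Fintype ι] [DecidableEq ι] (B : D.DunklKernel ι) :
    ∃ (h : Fin N → Fin N → Pol N) (e : Fin N → ℕ),
      (∀ j n, (h j n).IsHomogeneous (e j)) ∧ (∀ j, D.InvV (h j)) ∧ (∀ j, h j ∈ D.logM 1) ∧
      LinearIndependent (Pol N) h ∧ (∀ F ∈ D.logM 0, D.InvV F → F ∈ D.gen h) ∧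
      D.logM 1 ≤ Submodule.span (Pol N) (Set.range h) := by
  set P : ℕ → Prop := fun r => ∃ (h : Fin r → Fin N → Pol N) (e : Fin r → ℕ),
    (∀ j n, (h j n).IsHomogeneous (e j)) ∧ (∀ j, D.InvV (h j)) ∧ (∀ j, h j ∈ D.logM 0) ∧
      ∀ l : Fin r → ℂ, ∑ j, l j • h j ∈ D.decomposables → l = 0 with hP
  have hrank : Module.finrank (Pol N) (Fin N → Pol N) = N := by
    rw [Module.finrank_fintype_fun_eq_card, Fintype.card_fin]
  have hle : ∀ r, P r → r ≤ N := by
    rintro r ⟨h, e, -, hI, hM, hl⟩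
    have h1 := linearIndependent_of_inv hI fun f hf hs => eq_zero_of_indep B hI hM hl hf hs
    have h2 := h1.fintype_card_le_finrank
    rwa [hrank, Fintype.card_fin] at h2
  have hmax : ∃ r, P r ∧ ¬ P (r + 1) := by
    by_contra hne
    push Not at hne
    have h1 : ∀ r, P r := fun r => by
      induction r with
      | zero => exact ⟨fun j => j.elim0, fun j => j.elim0, fun j => j.elim0, fun j => j.elim0,
          fun j => j.elim0, fun l _ => Subsingleton.elim _ _⟩
      | succ r ih => exact hne r ih
    exact absurd (hle _ (h1 (N + 1))) (by omega)
  obtain ⟨r, ⟨h, e, he, hI, hM, hl⟩, hr⟩ := hmax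
  have hind := linearIndependent_of_inv hI fun f hf hs => eq_zero_of_indep B hI hM hl hf hs
  have hgen := mem_gen_of_sup (D := D) he fun d F hF hFI hd => by
    by_contra hne
    push Not at hne
    refine hr ⟨Fin.cons F h, Fin.cons d e, Fin.cases hd he, Fin.cases hFI hI, Fin.cases hF hM,
      fun l hs => ?_⟩
    rw [Fin.sum_univ_succ] at hs
    simp only [Fin.cons_zero, Fin.cons_succ] at hs
    have h0 : l 0 = 0 := by
      by_contra h0
      refine hne (fun j => -((l 0)⁻¹ * l j.succ)) ?_
      have h1 := D.decomposables.smul_mem (l 0)⁻¹ hs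
      rw [smul_add, smul_smul, inv_mul_cancel₀ h0, one_smul, Finset.smul_sum] at h1
      simpa only [neg_smul, Finset.sum_neg_distrib, sub_neg_eq_add, smul_smul] using h1
    rw [h0, zero_smul, zero_add] at hs
    have h1 := hl _ hs
    funext j
    exact Fin.cases h0 (fun j => congrFun h1 j) j
  have hspan : D.logM 1 ≤ Submodule.span (Pol N) (Set.range h) := by
    refine logM_one_le_span.trans (Submodule.span_le.mpr ?_)
    rintro F ⟨hF, hFI⟩
    obtain ⟨c, -, rfl⟩ := hgen F (logM_one_le hF) hFI
    exact Submodule.sum_mem _ fun j _ => Submodule.smul_mem _ _ (Submodule.subset_span ⟨j, rfl⟩)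
  have hN : N ≤ r := by
    set p : Pol N := ∏ β : D.Root, ell β ^ (2 * mul β + 1) with hp
    have hp0 : p ≠ 0 := Finset.prod_ne_zero_iff.mpr fun β _ => pow_ne_zero _ (ell_ne_zero β)
    have h1 : ∀ F : Fin N → Pol N, p • F ∈ D.logM 1 := fun F β => by
      rw [contr_smul]
      exact (Finset.dvd_prod_of_mem _ (Finset.mem_univ β)).mul_right _
    set v : Fin N → Submodule.span (Pol N) (Set.range h) := fun i =>
      ⟨p • Pi.single i 1, hspan (h1 _)⟩ with hv
    have h2 : LinearIndependent (Pol N) v := by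
      refine LinearIndependent.of_comp (Submodule.subtype _) ?_
      rw [Fintype.linearIndependent_iff]
      intro a ha i
      have h3 := congrFun ha i
      simp only [Function.comp_apply, hv, Submodule.subtype_apply, Finset.sum_apply,
        Pi.smul_apply, smul_eq_mul, Pi.zero_apply, Pi.single_apply, mul_ite, mul_one, mul_zero,
        Finset.sum_ite_eq, Finset.mem_univ, if_true] at h3
      exact (mul_eq_zero.mp h3).resolve_right hp0
    have h3 : Module.finrank (Pol N) (Submodule.span (Pol N) (Set.range h)) = r := by
      rw [finrank_span_eq_card hind, Fintype.card_fin]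
    have : Module.Finite (Pol N) (Submodule.span (Pol N) (Set.range h)) :=
      Module.Finite.span_of_finite _ (Set.finite_range h)
    have h4 := h2.fintype_card_le_finrank
    rwa [h3, Fintype.card_fin] at h4
  obtain rfl : r = N := le_antisymm (hle r ⟨h, e, he, hI, hM, hl⟩) hN
  exact ⟨h, e, he, hI, fun j => (hI j).mem_logM_one (hM j), hind, hgen, hspan⟩

end RootDatum

end Catalan

namespace Catalan

variable {N : ℕ}

lemma hV_smul_top_int {d e : ℤ} {p : Pol N} {F : Fin N → Pol N} (hp : DegLe d p)
    (hF : VDegLe e F) : hV (d + e) (p • F) = hZ d p • hV e F := by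
  rcases lt_or_ge d 0 with hd | hd
  · have h0 : p = 0 := (degLe_iff.mp hp).resolve_right (by omega)
    rw [h0, zero_smul, map_zero, zero_smul, ← hVLin_apply, map_zero]
  · lift d to ℕ using hd
    exact hV_smul_top hp hF

lemma topVF_eq {F h : Fin N → Pol N} {d : ℕ} (hd : VDegLe d F) (ht : hV d F = h) (h0 : h ≠ 0) :
    topVF F = h := by
  have hdeg : vfDeg F = d := by
    refine le_antisymm (Finset.sup_le fun i _ => degLe_natCast.mp (hd i)) ?_
    obtain ⟨n, hn⟩ := Function.ne_iff.mp h0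
    by_contra hlt
    refine hn ?_
    rw [← ht]
    change hZ d (F n) = 0
    rw [hZ_natCast]
    have h1 : (F n).totalDegree ≤ vfDeg F :=
      Finset.le_sup (f := fun i => (F i).totalDegree) (Finset.mem_univ n)
    exact homogeneousComponent_eq_zero _ _ (by omega)
  funext n
  rw [← ht, topVF, hdeg]
  exact (hZ_natCast d (F n)).symm

lemma contr_cplx (a : Fin N → ℝ) (F : Fin N → Pol N) :
    contr (cplx a) F = ∑ i, C ((a i : ℝ) : ℂ) * F i :=
  Finset.sum_congr rfl fun _ _ => smul_eq_C_mul _ _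

lemma applyVF_C (F : Fin N → Pol N) (c : ℂ) : applyVF F (C c) = 0 := by simp [applyVF]

lemma applyVF_X (F : Fin N → Pol N) (i : Fin N) : applyVF F (X i) = F i := by
  simp [applyVF, pderiv_X, Pi.single_apply]

lemma applyVF_add (F : Fin N → Pol N) (p q : Pol N) :
    applyVF F (p + q) = applyVF F p + applyVF F q := by
  simp only [applyVF, map_add, mul_add, Finset.sum_add_distrib]

lemma applyVF_mul (F : Fin N → Pol N) (p q : Pol N) :
    applyVF F (p * q) = p * applyVF F q + q * applyVF F p := by
  simp only [applyVF, Derivation.leibniz, smul_eq_mul, mul_add, Finset.sum_add_distrib,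
    Finset.mul_sum]
  congr 1 <;> exact Finset.sum_congr rfl fun i _ => by ring

lemma applyVF_lin (F : Fin N → Pol N) (v : Fin N → ℂ) : applyVF F (lin v) = contr v F := by
  simp only [applyVF, contr, pderiv_lin, smul_eq_C_mul, mul_comm]

namespace RootDatum

variable {D : RootDatum N}

lemma reflM_applyVF (β : D.Root) (F : Fin N → Pol N) (p : Pol N) :
    polyActM (reflM β.1) (applyVF F (polyActM (reflM β.1) p)) = applyVF (actV (s β) F) p := by
  rw [← act_s, ← act_s]
  induction p using MvPolynomial.induction_on with
  | C c => rw [act_C, applyVF_C, applyVF_C, map_zero]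
  | add p q hp hq => rw [map_add, applyVF_add, map_add, hp, hq, applyVF_add]
  | mul_X p i hp =>
    have h1 : ∀ q : Pol N, act (s β) (act (s β) q) = q := fun q => by
      rw [← act_mul, s_mul_self, act_one]
    have h2 : act (s β) (applyVF F (act (s β) (X i))) = actV (s β) F i := by
      rw [← lin_single, act_lin, applyVF_lin, contr, actV, map_sum]
      refine Finset.sum_congr rfl fun j _ => ?_
      rw [map_smul, Matrix.mulVec_single_one]
      congr 1
      have := congrFun (congrFun (reflM_transpose β.1) i) j
      exact this
    rw [map_mul, applyVF_mul, map_add, map_mul, map_mul, h1, h1, hp, h2, applyVF_mul, applyVF_X]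

lemma invV_iff {F : Fin N → Pol N} :
    D.InvV F ↔ ∀ a ∈ D.R, ∀ p : Pol N,
      polyActM (reflM a) (applyVF F (polyActM (reflM a) p)) = applyVF F p := by
  constructor
  · intro h a ha p
    rw [reflM_applyVF ⟨a, ha⟩, h]
  · intro h g
    induction g using W_induction with
    | hs β =>
      funext i
      rw [← applyVF_X (actV (s β) F) i, ← reflM_applyVF, h _ β.2, applyVF_X]
    | h1 => exact actV_one F
    | hm g g' hg hg' => rw [actV_mul, hg', hg]

lemma mem_inv_iff {p : Pol N} : p ∈ D.inv ↔ ∀ a ∈ D.R, polyActM (reflM a) p = p := by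
  constructor
  · intro h a ha
    exact h (s ⟨a, ha⟩)
  · intro h g
    induction g using W_induction with
    | hs β => exact h _ β.2
    | h1 => exact act_one p
    | hm g g' hg hg' => rw [act_mul, hg', hg]

/-- Logarithmic vector fields of the extended Catalan arrangement. -/
def logCat (D : RootDatum N) : Submodule (Pol N) (Fin N → Pol N) where
  carrier := {F | ∀ (α : D.Root) (j : ℤ), -(mul α : ℤ) ≤ j → j ≤ mul α →
    ell α - C (j : ℂ) ∣ contr (vec α) F}
  add_mem' hF hG α j h1 h2 := by
    rw [contr_add]
    exact dvd_add (hF α j h1 h2) (hG α j h1 h2)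
  zero_mem' α j _ _ := by
    rw [contr_zero]
    exact dvd_zero _
  smul_mem' q F hF α j h1 h2 := by
    rw [contr_smul]
    exact (hF α j h1 h2).mul_left _

lemma forall_root_iff {P : Finset (Fin N → ℝ)} (hP : ∀ a, a ∈ D.R ↔ (a ∈ P ∨ -a ∈ P))
    {φ : D.Root → Prop} (hφ : ∀ α, φ (-α) → φ α) :
    (∀ α, φ α) ↔ ∀ a (ha : a ∈ P), φ ⟨a, (hP a).mpr (.inl ha)⟩ := by
  refine ⟨fun h a ha => h _, fun h α => ?_⟩
  rcases (hP α.1).mp α.2 with hα | hα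
  · exact h _ hα
  · exact hφ _ (h _ hα)

lemma mem_logCat_iff {P : Finset (Fin N → ℝ)} (hP : ∀ a, a ∈ D.R ↔ (a ∈ P ∨ -a ∈ P))
    {F : Fin N → Pol N} :
    F ∈ D.logCat ↔ ∀ a ∈ P, ∀ j : ℤ, -(D.m a : ℤ) ≤ j → j ≤ (D.m a : ℤ) →
      (linPoly (cplx a) - C (j : ℂ)) ∣ ∑ i, C ((a i : ℝ) : ℂ) * F i := by
  simp only [← contr_cplx]
  refine forall_root_iff hP (φ := fun α => ∀ j : ℤ, -(mul α : ℤ) ≤ j → j ≤ mul α →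
    ell α - C (j : ℂ) ∣ contr (vec α) F) fun α h j h1 h2 => ?_
  rw [mul_neg_root] at h
  have h3 := Height.neg_dvd_contr.mp (h (-j) (by omega) (by omega))
  rwa [neg_neg] at h3

lemma mem_logM_one_iff {P : Finset (Fin N → ℝ)} (hP : ∀ a, a ∈ D.R ↔ (a ∈ P ∨ -a ∈ P))
    {F : Fin N → Pol N} :
    F ∈ D.logM 1 ↔ ∀ a ∈ P, linPoly (cplx a) ^ (2 * D.m a + 1) ∣
      ∑ i, C ((a i : ℝ) : ℂ) * F i := by
  simp only [← contr_cplx]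
  refine forall_root_iff hP (φ := fun α => ell α ^ (2 * mul α + 1) ∣ contr (vec α) F)
    fun α h => ?_
  rwa [mul_neg_root, ell_neg, neg_pow, vec_neg, contr_neg_vec, dvd_neg,
    (isUnit_one.neg.pow _).mul_left_dvd] at h

lemma hV_mem_logM_one {F : Fin N → Pol N} (hF : F ∈ D.logCat) {d : ℤ} (hd : VDegLe d F) :
    hV d F ∈ D.logM 1 := fun β => by
  have hcard : (Finset.Icc (-(mul β : ℤ)) (mul β)).card = 2 * mul β + 1 := by
    rw [Int.card_Icc]
    omega
  rw [← hZ_contr, ← hcard]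
  refine pow_dvd_hZ (vec_ne_zero β) _ (hd.contr _) fun i hi => ?_
  rw [Finset.mem_Icc] at hi
  exact hF β i hi.1 hi.2

/-- Homogeneous elements of `D.logM 0` are the top parts of Shi vector fields. -/
lemma Height.exists_lift (H : D.Height) {r : ℕ} (B : D.DunklKernel (Fin r))
    {L : Fin r → Fin N → Pol N}
    (hL : ∀ i, L i ∈ H.Shi ∧ VDegLe B.deg (L i) ∧ hV B.deg (L i) = B.b i)
    {h : Fin N → Pol N} {d : ℕ} (hM : h ∈ D.logM 0) (hd : ∀ n, (h n).IsHomogeneous d) :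
    ∃ F ∈ H.Shi, VDegLe d F ∧ hV d F = h := by
  obtain ⟨q, hq⟩ := B.exists_eq_sum h hM
  have hsum : ∀ i, VDegLe d (hZ ((d : ℤ) - B.deg) (q i) • L i) ∧
      hV d (hZ ((d : ℤ) - B.deg) (q i) • L i) = hZ ((d : ℤ) - B.deg) (q i) • B.b i := fun i => by
    have h1 := VDegLe.smul (DegLe.hZ_self ((d : ℤ) - B.deg) (q i)) (hL i).2.1
    have h2 := hV_smul_top_int (DegLe.hZ_self ((d : ℤ) - B.deg) (q i)) (hL i).2.1
    rw [sub_add_cancel] at h1 h2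
    rw [hZ_hZ_self, (hL i).2.2] at h2
    exact ⟨h1, h2⟩
  refine ⟨∑ i, hZ ((d : ℤ) - B.deg) (q i) • L i,
    Submodule.sum_mem _ fun i _ => H.Shi.smul_mem _ (hL i).1,
    VDegLe.sum fun i _ => (hsum i).1, ?_⟩
  rw [hV_sum, Finset.sum_congr rfl fun i _ => (hsum i).2]
  funext n
  have h1 := hZ_of_isHomogeneous (hd n) (d : ℤ)
  rw [if_pos rfl, hq, map_sum] at h1
  rw [hq, ← h1, Finset.sum_apply]
  exact Finset.sum_congr rfl fun i _ => (hZ_mul (B.hom i n) d (q i)).symm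

/-- Invariant vector fields with homogeneous basis as top parts. -/
theorem exists_logCat_basis (hN : 0 < N) (D : RootDatum N) :
    ∃ (θ h : Fin N → Fin N → Pol N) (e : Fin N → ℕ),
      (∀ k, D.InvV (θ k) ∧ θ k ∈ D.logCat ∧ VDegLe (e k) (θ k) ∧ hV (e k) (θ k) = h k) ∧
      (∀ k, D.InvV (h k) ∧ h k ∈ D.logM 1) ∧ LinearIndependent (Pol N) h ∧
      (∀ F ∈ D.logM 1, D.InvV F → F ∈ D.gen h) ∧
      D.logM 1 ≤ Submodule.span (Pol N) (Set.range h) := by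
  obtain ⟨H⟩ := exists_height (D := D)
  obtain ⟨r, B, L, hL⟩ := H.exists_kernel hN
  obtain ⟨h, e, he, hI, hM, hind, hgen, hspan⟩ := exists_basis B
  have hθ : ∀ k, ∃ θ : Fin N → Pol N,
      D.InvV θ ∧ θ ∈ D.logCat ∧ VDegLe (e k) θ ∧ hV (e k) θ = h k := fun k => by
    obtain ⟨F, hF, hd, ht⟩ := H.exists_lift B hL (logM_one_le (hM k)) (he k)
    obtain ⟨θ, h1, h2, h3, h4⟩ := H.exists_symmetrization hF hd fun g => by rw [ht, hI k]
    exact ⟨θ, h1, h2, h3, h4.trans ht⟩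
  choose θ hθ using hθ
  exact ⟨θ, h, e, hθ, fun k => ⟨hI k, hM k⟩, hind, fun F hF => hgen F (logM_one_le hF), hspan⟩

section Triangular

variable {θ h : Fin N → Fin N → Pol N} {e : Fin N → ℕ}

lemma eq_zero_of_top_independent
    (hθ : ∀ k, VDegLe (e k) (θ k) ∧ hV (e k) (θ k) = h k) (hh : LinearIndependent (Pol N) h)
    {c : Fin N → Pol N} (hc : ∑ k, c k • θ k = 0) (k : Fin N) : c k = 0 := by
  obtain ⟨d, hd⟩ := exists_vDegLe c
  set m : ℕ := d + ∑ k, e k with hm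
  have hem : ∀ k, e k ≤ ∑ k, e k := fun k =>
    Finset.single_le_sum (f := e) (fun _ _ => Nat.zero_le _) (Finset.mem_univ k)
  have key : ∀ n : ℕ, ∀ k, DegLe ((m : ℤ) - n - e k) (c k) := fun n => by
    induction n with
    | zero =>
      intro k
      have := hem k
      exact (hd k).mono (by push_cast; omega)
    | succ n ih =>
      have h1 : hV ((m : ℤ) - n) (∑ k, c k • θ k) =
          ∑ k, hZ ((m : ℤ) - n - e k) (c k) • h k := by
        rw [hV_sum]
        refine Finset.sum_congr rfl fun k _ => ?_
        have := hV_smul_top_int (ih k) (hθ k).1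
        rwa [sub_add_cancel, (hθ k).2] at this
      rw [hc, ← hVLin_apply, map_zero] at h1
      intro k
      have h2 := (ih k).sub_hZ (Fintype.linearIndependent_iff.mp hh _ h1.symm k)
      exact h2.mono (by push_cast; omega)
  refine (degLe_iff.mp (key (m + 1) k)).resolve_right ?_
  push_cast
  omega

lemma mem_gen_of_top (hθ : ∀ k, D.InvV (θ k) ∧ θ k ∈ D.logCat ∧ VDegLe (e k) (θ k) ∧
    hV (e k) (θ k) = h k) (hgen : ∀ F ∈ D.logM 1, D.InvV F → F ∈ D.gen h)
    {F : Fin N → Pol N} (hF : F ∈ D.logCat) (hFI : D.InvV F) : F ∈ D.gen θ := by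
  have key : ∀ d : ℕ, ∀ F ∈ D.logCat, D.InvV F → VDegLe ((d : ℤ) - 1) F → F ∈ D.gen θ := by
    intro d
    induction d with
    | zero =>
      intro F _ _ hd
      rw [VDegLe.eq_zero (by norm_num) hd]
      exact (D.gen θ).zero_mem
    | succ d ih =>
      intro F hF hFI hd
      push_cast at hd
      rw [add_sub_cancel_right] at hd
      obtain ⟨c, hc, hce⟩ := hgen _ (hV_mem_logM_one hF hd) (hFI.hV _)
      set G := ∑ k, hZ ((d : ℤ) - e k) (c k) • θ k with hG
      have hterm : ∀ k, VDegLe d (hZ ((d : ℤ) - e k) (c k) • θ k) ∧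
          hV d (hZ ((d : ℤ) - e k) (c k) • θ k) = hZ ((d : ℤ) - e k) (c k) • h k := fun k => by
        have h1 := VDegLe.smul (DegLe.hZ_self ((d : ℤ) - e k) (c k)) (hθ k).2.2.1
        have h2 := hV_smul_top_int (DegLe.hZ_self ((d : ℤ) - e k) (c k)) (hθ k).2.2.1
        rw [sub_add_cancel] at h1 h2
        rw [hZ_hZ_self, (hθ k).2.2.2] at h2
        exact ⟨h1, h2⟩
      have hGgen : G ∈ D.gen θ := ⟨_, fun k => hZ_mem_inv _ (hc k), rfl⟩
      have hGI : D.InvV G := fun g => by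
        rw [hG, actV_sum]
        exact Finset.sum_congr rfl fun k _ => (hθ k).1.smul (hZ_mem_inv _ (hc k)) g
      have hGtop : hV d G = hV d F := by
        have h1 : hV d (hV (d : ℤ) F) = hV d F := funext fun n => hZ_hZ_self d (F n)
        rw [← h1, hce, hG, hV_sum, hV_sum]
        refine Finset.sum_congr rfl fun k _ => ?_
        rw [(hterm k).2]
        funext n
        have h2 : (h k n).IsHomogeneous (e k) := by
          rw [← (hθ k).2.2.2]
          exact hZ_isHomogeneous _ _
        exact (hZ_mul h2 d (c k)).symm
      rw [← sub_add_cancel F G]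
      refine (D.gen θ).add_mem (ih _ (D.logCat.sub_mem hF ?_) (hFI.sub hGI) ?_) hGgen
      · exact Submodule.sum_mem _ fun k _ => D.logCat.smul_mem _ (hθ k).2.1
      · exact (hd.sub (VDegLe.sum fun k _ => (hterm k).1)).sub_hV
          (by rw [hV_sub, ← hG, hGtop, sub_self])
  obtain ⟨d, hd⟩ := exists_vDegLe F
  exact key (d + 1) F hF hFI (by push_cast; rwa [add_sub_cancel_right])

end Triangular

end RootDatum

end Catalan

open Catalan Catalan.RootDatum

/-- `D(Cat)^W` is a free module over `S^W` admitting a free basis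
`θ_1,…,θ_N` whose top-degree homogeneous parts `θ̄_1,…,θ̄_N` are `W`-invariant, belong to
`D_m`, and form a free basis of the `S`-module `D_m`. Invariance under the Weyl group `W`
is expressed as invariance under each of the generating reflections `s_α`, `α ∈ R`. -/
theorem stmt_12 (N : ℕ) (hN : 0 < N)
    -- `R` is a reduced crystallographic root system spanning `ℝ^N`, acting irreducibly
    (R : Finset (Fin N → ℝ)) (hR0 : (0 : Fin N → ℝ) ∉ R)
    (hspan : Submodule.span ℝ (R : Set (Fin N → ℝ)) = ⊤)
    (hreduced : ∀ a ∈ R, ∀ c : ℝ, c • a ∈ R → c = 1 ∨ c = -1)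
    (hrefl : ∀ a ∈ R, ∀ b ∈ R,
      (b - (2 * (∑ i, a i * b i) / (∑ i, a i * a i)) • a) ∈ R)
    (hcrys : ∀ a ∈ R, ∀ b ∈ R, ∃ k : ℤ,
      2 * (∑ i, a i * b i) / (∑ i, b i * b i) = (k : ℝ))
    (hirr : ∀ U : Submodule ℝ (Fin N → ℝ),
      (∀ a ∈ R, ∀ v ∈ U, (v - (2 * (∑ i, a i * v i) / (∑ i, a i * a i)) • a) ∈ U) →
      U = ⊥ ∨ U = ⊤)
    -- `R_+` is a choice of positive roots
    (Rp : Finset (Fin N → ℝ))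
    (hRp : ∀ a, a ∈ R ↔ (a ∈ Rp ∨ -a ∈ Rp)) (hRpdisj : ∀ a, ¬(a ∈ Rp ∧ -a ∈ Rp))
    -- `m` is a `W`-invariant multiplicity function
    (m : (Fin N → ℝ) → ℕ)
    (hminv : ∀ a ∈ R, ∀ b ∈ R,
      m (b - (2 * (∑ i, a i * b i) / (∑ i, a i * a i)) • a) = m b) :
    ∃ θ : Fin N → (Fin N → MvPolynomial (Fin N) ℂ),
      -- each `θ_k` belongs to `D(Cat)` and is `W`-invariant
      (∀ k, (∀ a ∈ Rp, ∀ j : ℤ, -(m a : ℤ) ≤ j → j ≤ (m a : ℤ) →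
          (linPoly (cplx a) - MvPolynomial.C (j : ℂ)) ∣
            ∑ i, MvPolynomial.C ((a i : ℝ) : ℂ) * θ k i) ∧
        (∀ a ∈ R, ∀ p : MvPolynomial (Fin N) ℂ,
          polyActM (reflM a) (applyVF (θ k) (polyActM (reflM a) p)) = applyVF (θ k) p)) ∧
      -- the `θ_k` generate `D(Cat)^W` over `S^W`
      (∀ f : Fin N → MvPolynomial (Fin N) ℂ,
        (∀ a ∈ Rp, ∀ j : ℤ, -(m a : ℤ) ≤ j → j ≤ (m a : ℤ) →
          (linPoly (cplx a) - MvPolynomial.C (j : ℂ)) ∣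
            ∑ i, MvPolynomial.C ((a i : ℝ) : ℂ) * f i) →
        (∀ a ∈ R, ∀ p : MvPolynomial (Fin N) ℂ,
          polyActM (reflM a) (applyVF f (polyActM (reflM a) p)) = applyVF f p) →
        ∃ c : Fin N → MvPolynomial (Fin N) ℂ,
          (∀ k, ∀ a ∈ R, polyActM (reflM a) (c k) = c k) ∧
          (∀ i, f i = ∑ k, c k * θ k i)) ∧
      -- and are independent over `S^W`
      (∀ c : Fin N → MvPolynomial (Fin N) ℂ,
        (∀ k, ∀ a ∈ R, polyActM (reflM a) (c k) = c k) →
        (∀ i, (∑ k, c k * θ k i) = 0) → ∀ k, c k = 0) ∧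
      -- the top-degree parts `θ̄_k` are `W`-invariant and belong to `D_m`
      (∀ k, (∀ a ∈ R, ∀ p : MvPolynomial (Fin N) ℂ,
          polyActM (reflM a) (applyVF (topVF (θ k)) (polyActM (reflM a) p))
            = applyVF (topVF (θ k)) p) ∧
        (∀ a ∈ Rp, linPoly (cplx a) ^ (2 * m a + 1) ∣
          ∑ i, MvPolynomial.C ((a i : ℝ) : ℂ) * topVF (θ k) i)) ∧
      -- the `θ̄_k` generate `D_m` over `S`
      (∀ f : Fin N → MvPolynomial (Fin N) ℂ,
        (∀ a ∈ Rp, linPoly (cplx a) ^ (2 * m a + 1) ∣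
          ∑ i, MvPolynomial.C ((a i : ℝ) : ℂ) * f i) →
        ∃ c : Fin N → MvPolynomial (Fin N) ℂ, ∀ i, f i = ∑ k, c k * topVF (θ k) i) ∧
      -- and are independent over `S`
      (∀ c : Fin N → MvPolynomial (Fin N) ℂ,
        (∀ i, (∑ k, c k * topVF (θ k) i) = 0) → ∀ k, c k = 0) := by
  set D : RootDatum N := ⟨R, hR0, hspan, hreduced, hrefl, hcrys, hirr, m, hminv⟩ with hD
  obtain ⟨θ, h, e, hθ, hh, hind, hgen, hlogM⟩ := exists_logCat_basis hN D
  have htop : ∀ k, topVF (θ k) = h k := fun k =>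
    topVF_eq (hθ k).2.2.1 (hθ k).2.2.2 (hind.ne_zero k)
  have hcat := fun F : Fin N → Pol N => mem_logCat_iff (D := D) hRp (F := F)
  have hone := fun F : Fin N → Pol N => mem_logM_one_iff (D := D) hRp (F := F)
  have hsum : ∀ (c : Fin N → Pol N) (G : Fin N → Fin N → Pol N) (i : Fin N),
      (∑ k, c k • G k) i = ∑ k, c k * G k i := fun c G i => by
    simp only [Finset.sum_apply, Pi.smul_apply, smul_eq_mul]
  refine ⟨θ, fun k => ⟨(hcat _).mp (hθ k).2.1, invV_iff.mp (hθ k).1⟩, fun f hf hfI => ?_,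
    fun c _ hc => ?_, fun k => ?_, fun f hf => ?_, fun c hc => ?_⟩
  · obtain ⟨c, hc, hfc⟩ := mem_gen_of_top hθ hgen ((hcat f).mpr hf) (invV_iff.mpr hfI)
    exact ⟨c, fun k => mem_inv_iff.mp (hc k), fun i => by rw [hfc, hsum]⟩
  · exact eq_zero_of_top_independent (fun k => (hθ k).2.2) hind
      (funext fun i => by rw [hsum, hc, Pi.zero_apply])
  · rw [htop]
    exact ⟨invV_iff.mp (hh k).1, (hone _).mp (hh k).2⟩
  · obtain ⟨c, hc⟩ := (Submodule.mem_span_range_iff_exists_fun _).mp (hlogM ((hone f).mpr hf))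
    exact ⟨c, fun i => by simp only [htop, ← hc, hsum]⟩
  · simp only [htop] at hc
    exact Fintype.linearIndependent_iff.mp hind c (funext fun i => by rw [hsum, hc, Pi.zero_apply])

end
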